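/- arXiv:0905.1082 — 2 statements merged into one kernel-verified Lean document; each statement's English description precedes it below -/
import Mathlib

section
/- Let k be a field of characteristic 0 and let m ≥ 1 be an integer. Then CP(G_0(m)) = S(m) + T(G_0(m)), where S(m) is the nonunitary T-space of F_0 generated by [x_1, x_2] if m is even, and by the two elements [x_1, x_2] and x_1 ∘ x_2 ∘ ⋯ ∘ x_{(m+1)/2} if m is odd. -/
open Pointwise

noncomputable section

/-- The `i`-th variable `x_i` of the free unital associative algebra `k⟨X⟩`. -/
def xx (k : Type*) [Field k] (i : ℕ) : FreeAlgebra k ℕ := FreeAlgebra.ι k i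

/-- Commutator `[a,b] = ab - ba`. -/
def brk {A : Type*} [Ring A] (a b : A) : A := a * b - b * a

/-- The `i`-th standard generator (1-indexed, for `1 ≤ i ≤ m`) of the Grassmann
(exterior) algebra `G(m) = ExteriorAlgebra k (Fin m → k)`. -/
def ee (k : Type*) [Field k] (m : ℕ) (i : ℕ) : ExteriorAlgebra k (Fin m → k) :=
  ExteriorAlgebra.ι k (fun j : Fin m => if (j : ℕ) + 1 = i then 1 else 0)

/-- `G_0(m)`: the nonunitary subalgebra of `G(m)` generated by `e_1, …, e_m`. -/
def G0 (k : Type*) [Field k] (m : ℕ) : Submodule k (ExteriorAlgebra k (Fin m → k)) :=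
  Submodule.span k {u | ∃ r : ℕ, 1 ≤ r ∧ ∃ s : Fin r → ℕ, StrictMono s ∧
    (∀ a, 1 ≤ s a ∧ s a ≤ m) ∧ u = (List.ofFn fun a => ee k m (s a)).prod}

/-- The left-associated circle product `f 1 ∘ f 2 ∘ ⋯ ∘ f n`, where `x ∘ y = xy + yx`. -/
def circFold {A : Type*} [Ring A] (f : ℕ → A) (n : ℕ) : A :=
  (List.range (n - 1)).foldl (fun acc i => acc * f (i + 2) + f (i + 2) * acc) (f 1)

/-- `F_0`: the two-sided ideal of `k⟨X⟩` generated by the variables. -/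
def F0 (k : Type*) [Field k] : Submodule k (FreeAlgebra k ℕ) :=
  Submodule.span k {y | ∃ (a : FreeAlgebra k ℕ) (i : ℕ) (b : FreeAlgebra k ℕ),
    y = a * FreeAlgebra.ι k i * b}

/-- `T(G_0(m))`: identities of the nonunitary Grassmann algebra `G_0(m)`. -/
def T0 (k : Type*) [Field k] (m : ℕ) : Set (FreeAlgebra k ℕ) :=
  {f | f ∈ F0 k ∧ ∀ φ : FreeAlgebra k ℕ →ₐ[k] ExteriorAlgebra k (Fin m → k),
    (∀ i, φ (xx k i) ∈ G0 k m) → φ f = 0}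

/-- `CP(G_0(m))`: central polynomials (together with identities) of `G_0(m)`. -/
def CP0 (k : Type*) [Field k] (m : ℕ) : Set (FreeAlgebra k ℕ) :=
  {f | f ∈ F0 k ∧ ∀ φ : FreeAlgebra k ℕ →ₐ[k] ExteriorAlgebra k (Fin m → k),
    (∀ i, φ (xx k i) ∈ G0 k m) → ∀ a ∈ G0 k m, φ f * a = a * φ f}

section Superforms

/-- Supercommutation relations between even generators `inl i` and odd generators `inr i`. -/
inductive SuperRel (k : Type*) [Field k] : FreeAlgebra k (ℕ ⊕ ℕ) → FreeAlgebra k (ℕ ⊕ ℕ) → Prop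
  | even_even (i j : ℕ) : SuperRel k
      (FreeAlgebra.ι k (Sum.inl i) * FreeAlgebra.ι k (Sum.inl j))
      (FreeAlgebra.ι k (Sum.inl j) * FreeAlgebra.ι k (Sum.inl i))
  | even_odd (i j : ℕ) : SuperRel k
      (FreeAlgebra.ι k (Sum.inl i) * FreeAlgebra.ι k (Sum.inr j))
      (FreeAlgebra.ι k (Sum.inr j) * FreeAlgebra.ι k (Sum.inl i))
  | odd_odd (i j : ℕ) : SuperRel k
      (FreeAlgebra.ι k (Sum.inr i) * FreeAlgebra.ι k (Sum.inr j))
      (-(FreeAlgebra.ι k (Sum.inr j) * FreeAlgebra.ι k (Sum.inr i)))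

/-- The free supercommutative algebra on even generators `z_i` and odd generators `y_i`,
thought of as the polynomial differential forms in the `z_i` with `y_i = dz_i`. -/
def Superforms (k : Type*) [Field k] : Type _ := RingQuot (SuperRel k)

namespace Superforms

variable {k : Type*} [Field k]

instance : Ring (Superforms k) := inferInstanceAs (Ring (RingQuot (SuperRel k)))

instance : Algebra k (Superforms k) := inferInstanceAs (Algebra k (RingQuot (SuperRel k)))

/-- The quotient map from the free algebra. -/
def mk : FreeAlgebra k (ℕ ⊕ ℕ) →ₐ[k] Superforms k := RingQuot.mkAlgHom k (SuperRel k)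

/-- The even generator `z_i`. -/
def Z (i : ℕ) : Superforms k := mk (FreeAlgebra.ι k (Sum.inl i))

/-- The odd generator `y_i`. -/
def Y (i : ℕ) : Superforms k := mk (FreeAlgebra.ι k (Sum.inr i))

lemma mk_rel {a b : FreeAlgebra k (ℕ ⊕ ℕ)} (h : SuperRel k a b) : mk a = mk b :=
  RingQuot.mkAlgHom_rel k h

lemma Z_mul_Z (i j : ℕ) : (Z i * Z j : Superforms k) = Z j * Z i := by
  simpa [Z] using mk_rel (SuperRel.even_even (k := k) i j)

lemma Z_mul_Y (i j : ℕ) : (Z i * Y j : Superforms k) = Y j * Z i := by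
  simpa [Z, Y] using mk_rel (SuperRel.even_odd (k := k) i j)

lemma Y_mul_Y (i j : ℕ) : (Y i * Y j : Superforms k) = -(Y j * Y i) := by
  simpa [Y] using mk_rel (SuperRel.odd_odd (k := k) i j)

/-- The universal property of `Superforms`. -/
lemma exists_lift {B : Type*} [Ring B] [Algebra k B] (z y : ℕ → B)
    (hzz : ∀ i j, z i * z j = z j * z i) (hzy : ∀ i j, z i * y j = y j * z i)
    (hyy : ∀ i j, y i * y j = -(y j * y i)) :
    ∃ F : Superforms k →ₐ[k] B, (∀ i, F (Z i) = z i) ∧ ∀ i, F (Y i) = y i := by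
  refine ⟨RingQuot.liftAlgHom k ⟨FreeAlgebra.lift k (Sum.elim z y), ?_⟩, ?_, ?_⟩
  · rintro _ _ (⟨i, j⟩ | ⟨i, j⟩ | ⟨i, j⟩)
    · simp [hzz i j]
    · simp [hzy i j]
    · simp [hyy i j]
  · intro i
    exact (RingQuot.liftAlgHom_mkAlgHom_apply k _ _ _).trans (by simp)
  · intro i
    exact (RingQuot.liftAlgHom_mkAlgHom_apply k _ _ _).trans (by simp)

/-- Induction on superforms by left multiplication with generators. -/
@[elab_as_elim]
theorem induction_left {P : Superforms k → Prop} (one : P 1)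
    (add : ∀ a b, P a → P b → P (a + b)) (smul : ∀ (c : k) a, P a → P (c • a))
    (Z_mul : ∀ i a, P a → P (Z i * a)) (Y_mul : ∀ i a, P a → P (Y i * a))
    (a : Superforms k) : P a := by
  have key : ∀ w : FreeAlgebra k (ℕ ⊕ ℕ), ∀ b, P b →
      P (mk w * b) := by
    intro w
    induction w using FreeAlgebra.induction with
    | grade0 r =>
      intro b hb
      rw [AlgHom.commutes, ← Algebra.smul_def]
      exact smul r b hb
    | grade1 x =>
      intro b hb
      rcases x with i | i
      · exact Z_mul i b hb
      · exact Y_mul i b hb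
    | mul u v hu hv =>
      intro b hb
      rw [map_mul, mul_assoc]
      exact hu _ (hv _ hb)
    | add u v hu hv =>
      intro b hb
      rw [map_add, add_mul]
      exact add _ _ (hu _ hb) (hv _ hb)
  obtain ⟨w, rfl⟩ : ∃ w, mk w = a := RingQuot.mkAlgHom_surjective k (SuperRel k) a
  simpa using key w 1 one

lemma Z_mul_comm (i : ℕ) (a : Superforms k) : Z i * a = a * Z i := by
  induction a using induction_left with
  | one => simp
  | add a b ha hb => rw [mul_add, add_mul, ha, hb]
  | smul c a ha => rw [mul_smul_comm, smul_mul_assoc, ha]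
  | Z_mul j a ha => rw [← mul_assoc, Z_mul_Z, mul_assoc, ha, mul_assoc]
  | Y_mul j a ha => rw [← mul_assoc, Z_mul_Y, mul_assoc, ha, mul_assoc]

lemma exists_parity : ∃ F : Superforms k →ₐ[k] Superforms k,
    (∀ i, F (Z i) = Z i) ∧ ∀ i, F (Y i) = -Y i := by
  refine exists_lift _ _ Z_mul_Z (fun i j => ?_) (fun i j => ?_)
  · simp [Z_mul_Y i j]
  · simp [Y_mul_Y i j]

/-- The parity automorphism. -/
def parity : Superforms k →ₐ[k] Superforms k := exists_parity.choose

@[simp] lemma parity_Z (i : ℕ) : parity (Z i : Superforms k) = Z i :=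
  exists_parity.choose_spec.1 i

@[simp] lemma parity_Y (i : ℕ) : parity (Y i : Superforms k) = -Y i :=
  exists_parity.choose_spec.2 i

@[simp] lemma parity_parity (a : Superforms k) : parity (parity a) = a := by
  induction a using induction_left with
  | one => simp
  | add a b ha hb => simp [ha, hb]
  | smul c a ha => simp [ha]
  | Z_mul j a ha => simp [ha]
  | Y_mul j a ha => simp [ha]

lemma Y_mul_eq (i : ℕ) (a : Superforms k) : Y i * a = parity a * Y i := by
  induction a using induction_left with
  | one => simp
  | add a b ha hb => rw [mul_add, map_add, add_mul, ha, hb]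
  | smul c a ha => rw [mul_smul_comm, map_smul, smul_mul_assoc, ha]
  | Z_mul j a ha => rw [← mul_assoc, ← Z_mul_Y, mul_assoc, ha, map_mul, parity_Z, mul_assoc]
  | Y_mul j a ha =>
    rw [← mul_assoc, Y_mul_Y, neg_mul, mul_assoc, ha, map_mul, parity_Y, neg_mul, neg_mul,
      mul_assoc]

lemma mul_comm_of_even {a : Superforms k} (ha : parity a = a) (b : Superforms k) :
    a * b = b * a := by
  induction b using induction_left with
  | one => simp
  | add b c hb hc => rw [mul_add, add_mul, hb, hc]
  | smul c b hb => rw [mul_smul_comm, smul_mul_assoc, hb]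
  | Z_mul j b hb => rw [← mul_assoc, ← Z_mul_comm, mul_assoc, hb, mul_assoc]
  | Y_mul j b hb =>
    have := Y_mul_eq j a
    rw [ha] at this
    rw [← mul_assoc, ← this, mul_assoc, hb, mul_assoc]

lemma mul_eq_of_odd {a : Superforms k} (ha : parity a = -a) (b : Superforms k) :
    a * b = parity b * a := by
  induction b using induction_left with
  | one => simp
  | add b c hb hc => rw [mul_add, map_add, add_mul, hb, hc]
  | smul c b hb => rw [mul_smul_comm, map_smul, smul_mul_assoc, hb]
  | Z_mul j b hb => rw [← mul_assoc, ← Z_mul_comm, mul_assoc, hb, map_mul, parity_Z, mul_assoc]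
  | Y_mul j b hb =>
    have := Y_mul_eq j a
    rw [ha, neg_mul] at this
    rw [← mul_assoc, ← neg_neg (a * Y j), ← this, map_mul, parity_Y, neg_mul, mul_assoc, hb,
      neg_mul, neg_mul, mul_assoc]

/-- A superderivation (for `ε = -1`) or derivation (for `ε = 1`) with prescribed values
on the generators. -/
lemma exists_superderivation (ε : k) (p q : ℕ → Superforms k)
    (hzz : ∀ i j, Z i * p j + p i * Z j = Z j * p i + p j * Z i)
    (hzy : ∀ i j, Z i * q j + p i * Y j = ε • Y j * p i + q j * Z i)
    (hyy : ∀ i j, ε • Y i * q j + q i * Y j = -(ε • Y j * q i + q j * Y i)) :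
    ∃ D : Superforms k →ₗ[k] Superforms k, D 1 = 0 ∧
      (∀ i a, D (Z i * a) = Z i * D a + p i * a) ∧
      ∀ i a, D (Y i * a) = ε • Y i * D a + q i * a := by
  obtain ⟨F, hZ, hY⟩ := exists_lift (k := k)
    (fun i => !![Z i, p i; 0, Z i] : ℕ → Matrix (Fin 2) (Fin 2) (Superforms k))
    (fun i => !![ε • Y i, q i; 0, Y i]) (fun i j => by simp [Z_mul_Z i j, hzz i j])
    (fun i j => by simp [Z_mul_Y i j, hzy i j])
    (fun i j => by
      have := hyy i j
      ext a b
      fin_cases a <;> fin_cases b <;> simp [Y_mul_Y i j]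
      simpa [add_comm] using this)
  have h11 : ∀ a, F a 1 1 = a := by
    intro a
    induction a using induction_left with
    | one => simp
    | add a b ha hb => simp [ha, hb]
    | smul c a ha => simp [ha]
    | Z_mul j a ha => simp [ha, hZ, Matrix.mul_apply, Fin.sum_univ_two]
    | Y_mul j a ha => simp [ha, hY, Matrix.mul_apply, Fin.sum_univ_two]
  refine ⟨⟨⟨fun a => F a 0 1, fun a b => by simp⟩, fun c a => by simp⟩, ?_, ?_, ?_⟩
  · simp
  · intro i a
    simp [hZ, Matrix.mul_apply, Fin.sum_univ_two, h11]
  · intro i a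
    simp [hY, Matrix.mul_apply, Fin.sum_univ_two, h11]

/-! ### De Rham differential, contraction with the Euler field, partial derivatives -/

lemma exists_d : ∃ D : Superforms k →ₗ[k] Superforms k, D 1 = 0 ∧
    (∀ i a, D (Z i * a) = Z i * D a + Y i * a) ∧ ∀ i a, D (Y i * a) = -(Y i * D a) := by
  obtain ⟨D, h1, hZ, hY⟩ := exists_superderivation (-1 : k) Y 0
    (fun i j => by rw [Z_mul_Y, Z_mul_Y, add_comm])
    (fun i j => by simp [Y_mul_Y i j]) (fun i j => by simp)
  exact ⟨D, h1, hZ, by simpa using hY⟩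

/-- The de Rham differential `z_i ↦ y_i`, `y_i ↦ 0`. -/
def d : Superforms k →ₗ[k] Superforms k := exists_d.choose

@[simp] lemma d_one : d (1 : Superforms k) = 0 := exists_d.choose_spec.1

@[simp] lemma d_Z_mul (i : ℕ) (a : Superforms k) : d (Z i * a) = Z i * d a + Y i * a :=
  exists_d.choose_spec.2.1 i a

@[simp] lemma d_Y_mul (i : ℕ) (a : Superforms k) : d (Y i * a) = -(Y i * d a) :=
  exists_d.choose_spec.2.2 i a

lemma exists_contract : ∃ D : Superforms k →ₗ[k] Superforms k, D 1 = 0 ∧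
    (∀ i a, D (Z i * a) = Z i * D a) ∧ ∀ i a, D (Y i * a) = Z i * a - Y i * D a := by
  obtain ⟨D, h1, hZ, hY⟩ := exists_superderivation (-1 : k) 0 Z
    (fun i j => by simp) (fun i j => by simp [Z_mul_Z i j])
    (fun i j => by simp [Z_mul_Y])
  refine ⟨D, h1, by simpa using hZ, fun i a => ?_⟩
  rw [hY, neg_one_smul, neg_mul, sub_eq_neg_add]

/-- Contraction with the Euler vector field: `z_i ↦ 0`, `y_i ↦ z_i`. -/
def contract : Superforms k →ₗ[k] Superforms k := exists_contract.choose

@[simp] lemma contract_one : contract (1 : Superforms k) = 0 := exists_contract.choose_spec.1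

@[simp] lemma contract_Z_mul (i : ℕ) (a : Superforms k) :
    contract (Z i * a) = Z i * contract a :=
  exists_contract.choose_spec.2.1 i a

@[simp] lemma contract_Y_mul (i : ℕ) (a : Superforms k) :
    contract (Y i * a) = Z i * a - Y i * contract a :=
  exists_contract.choose_spec.2.2 i a

lemma exists_pderivZ (j : ℕ) : ∃ D : Superforms k →ₗ[k] Superforms k, D 1 = 0 ∧
    (∀ i a, D (Z i * a) = Z i * D a + if i = j then a else 0) ∧
    ∀ i a, D (Y i * a) = Y i * D a := by
  obtain ⟨D, h1, hZ, hY⟩ := exists_superderivation (1 : k) (fun i => if i = j then 1 else 0) 0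
    (fun i l => by split_ifs <;> simp [add_comm])
    (fun i l => by split_ifs <;> simp) (fun i l => by simp)
  refine ⟨D, h1, fun i a => ?_, by simpa using hY⟩
  rw [hZ]
  split_ifs <;> simp

/-- The partial derivative with respect to `z_j`. -/
def pderivZ (j : ℕ) : Superforms k →ₗ[k] Superforms k := (exists_pderivZ j).choose

@[simp] lemma pderivZ_one (j : ℕ) : pderivZ j (1 : Superforms k) = 0 :=
  (exists_pderivZ j).choose_spec.1

@[simp] lemma pderivZ_Z_mul (j i : ℕ) (a : Superforms k) :
    pderivZ j (Z i * a) = Z i * pderivZ j a + if i = j then a else 0 :=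
  (exists_pderivZ j).choose_spec.2.1 i a

@[simp] lemma pderivZ_Y_mul (j i : ℕ) (a : Superforms k) :
    pderivZ j (Y i * a) = Y i * pderivZ j a :=
  (exists_pderivZ j).choose_spec.2.2 i a

lemma exists_pderivY (j : ℕ) : ∃ D : Superforms k →ₗ[k] Superforms k, D 1 = 0 ∧
    (∀ i a, D (Z i * a) = Z i * D a) ∧
    ∀ i a, D (Y i * a) = -(Y i * D a) + if i = j then a else 0 := by
  obtain ⟨D, h1, hZ, hY⟩ := exists_superderivation (-1 : k) 0 (fun i => if i = j then 1 else 0)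
    (fun i l => by simp) (fun i l => by split_ifs <;> simp)
    (fun i l => by split_ifs <;> simp)
  refine ⟨D, h1, by simpa using hZ, fun i a => ?_⟩
  rw [hY]
  split_ifs <;> simp

/-- The odd partial derivative with respect to `y_j`. -/
def pderivY (j : ℕ) : Superforms k →ₗ[k] Superforms k := (exists_pderivY j).choose

@[simp] lemma pderivY_one (j : ℕ) : pderivY j (1 : Superforms k) = 0 :=
  (exists_pderivY j).choose_spec.1

@[simp] lemma pderivY_Z_mul (j i : ℕ) (a : Superforms k) :
    pderivY j (Z i * a) = Z i * pderivY j a :=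
  (exists_pderivY j).choose_spec.2.1 i a

@[simp] lemma pderivY_Y_mul (j i : ℕ) (a : Superforms k) :
    pderivY j (Y i * a) = -(Y i * pderivY j a) + if i = j then a else 0 :=
  (exists_pderivY j).choose_spec.2.2 i a

lemma parity_d (a : Superforms k) : parity (d a) = -d (parity a) := by
  induction a using induction_left with
  | one => simp
  | add a b ha hb => simp [ha, hb, add_comm]
  | smul c a ha => simp [ha]
  | Z_mul j a ha => simp [ha, add_comm]
  | Y_mul j a ha => simp [ha]

lemma parity_contract (a : Superforms k) : parity (contract a) = -contract (parity a) := by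
  induction a using induction_left with
  | one => simp
  | add a b ha hb => simp [ha, hb, add_comm]
  | smul c a ha => simp [ha]
  | Z_mul j a ha => simp [ha]
  | Y_mul j a ha => simp [ha]

/-- The projection onto the even part. -/
def even : Superforms k →ₗ[k] Superforms k :=
  (2⁻¹ : k) • (LinearMap.id + parity.toLinearMap)

/-- The projection onto the odd part. -/
def odd : Superforms k →ₗ[k] Superforms k :=
  (2⁻¹ : k) • (LinearMap.id - parity.toLinearMap)

lemma even_apply (a : Superforms k) : even a = (2⁻¹ : k) • (a + parity a) := by simp [even]

lemma odd_apply (a : Superforms k) : odd a = (2⁻¹ : k) • (a - parity a) := by simp [odd]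

@[simp] lemma parity_even (a : Superforms k) : parity (even a) = even a := by
  simp [even_apply, add_comm]

@[simp] lemma parity_odd (a : Superforms k) : parity (odd a) = -odd a := by
  rw [odd_apply, map_smul, map_sub, parity_parity, ← smul_neg, neg_sub]

lemma half_smul_add_self [CharZero k] {V : Type*} [AddCommGroup V] [Module k V] (a : V) :
    (2⁻¹ : k) • (a + a) = a := by
  rw [← two_smul k, smul_smul, inv_mul_cancel₀ two_ne_zero, one_smul]

lemma even_add_odd [CharZero k] (a : Superforms k) : even a + odd a = a := by
  rw [even_apply, odd_apply, ← smul_add]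
  convert half_smul_add_self (k := k) a using 2
  abel

lemma even_of_even [CharZero k] {a : Superforms k} (ha : parity a = a) : even a = a := by
  rw [even_apply, ha, half_smul_add_self]

lemma odd_of_odd [CharZero k] {a : Superforms k} (ha : parity a = -a) : odd a = a := by
  rw [odd_apply, ha, sub_neg_eq_add, half_smul_add_self]

lemma even_of_odd {a : Superforms k} (ha : parity a = -a) : even a = 0 := by
  rw [even_apply, ha]; simp

lemma odd_of_even {a : Superforms k} (ha : parity a = a) : odd a = 0 := by
  rw [odd_apply, ha]; simp

lemma eq_zero_of_eq_neg [CharZero k] {V : Type*} [AddCommGroup V] [Module k V] {a : V}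
    (h : a = -a) : a = 0 := by
  rw [← half_smul_add_self (k := k) a]
  nth_rewrite 2 [h]
  simp

lemma even_mul_of_even {a : Superforms k} (ha : parity a = a) (b : Superforms k) :
    even (a * b) = a * even b := by
  rw [even_apply, even_apply, map_mul, ha, ← mul_add, mul_smul_comm]

lemma odd_mul_of_even {a : Superforms k} (ha : parity a = a) (b : Superforms k) :
    odd (a * b) = a * odd b := by
  rw [odd_apply, odd_apply, map_mul, ha, ← mul_sub, mul_smul_comm]

lemma even_mul_of_odd {a : Superforms k} (ha : parity a = -a) (b : Superforms k) :
    even (a * b) = a * odd b := by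
  rw [even_apply, odd_apply, map_mul, ha, neg_mul, ← sub_eq_add_neg, ← mul_sub, mul_smul_comm]

lemma odd_mul_of_odd {a : Superforms k} (ha : parity a = -a) (b : Superforms k) :
    odd (a * b) = a * even b := by
  rw [even_apply, odd_apply, map_mul, ha, neg_mul, sub_neg_eq_add, ← mul_add, mul_smul_comm]

lemma even_mul [CharZero k] (a b : Superforms k) :
    even (a * b) = even a * even b + odd a * odd b := by
  nth_rewrite 1 [← even_add_odd a]
  rw [add_mul, map_add, even_mul_of_even (parity_even a), even_mul_of_odd (parity_odd a)]

lemma odd_mul [CharZero k] (a b : Superforms k) :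
    odd (a * b) = even a * odd b + odd a * even b := by
  nth_rewrite 1 [← even_add_odd a]
  rw [add_mul, map_add, odd_mul_of_even (parity_even a), odd_mul_of_odd (parity_odd a)]

lemma even_mul_comm (a b : Superforms k) : even a * b = b * even a :=
  mul_comm_of_even (parity_even a) b

lemma odd_mul_odd (a b : Superforms k) : odd a * odd b = -(odd b * odd a) := by
  rw [mul_eq_of_odd (parity_odd a), parity_odd, neg_mul]

lemma even_anticommutator [CharZero k] (a b : Superforms k) :
    even (a * b + b * a) = (2 : k) • (even a * even b) := by
  rw [map_add, even_mul, even_mul, odd_mul_odd b a, even_mul_comm b (even a), two_smul]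
  abel

lemma odd_anticommutator [CharZero k] (a b : Superforms k) :
    odd (a * b + b * a) = (2 : k) • (even a * odd b + even b * odd a) := by
  rw [map_add, odd_mul, odd_mul, ← even_mul_comm b (odd a), ← even_mul_comm a (odd b), two_smul]
  abel

lemma commutator_eq [CharZero k] (a b : Superforms k) :
    a * b - b * a = (2 : k) • (odd a * odd b) := by
  have h1 := even_mul_comm a (even b)
  have h2 := even_mul_comm a (odd b)
  have h3 := even_mul_comm b (odd a)
  have h4 := odd_mul_odd b a
  have key : (even a + odd a) * (even b + odd b) - (even b + odd b) * (even a + odd a) =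
      (2 : k) • (odd a * odd b) := by
    simp only [add_mul, mul_add, h1, h2, h3, h4, two_smul]
    abel
  rwa [even_add_odd, even_add_odd] at key

/-! ### The generic homomorphism from the free algebra -/

/-- The generic homomorphism `x_i ↦ z_i + y_i`. -/
def generic : FreeAlgebra k ℕ →ₐ[k] Superforms k := FreeAlgebra.lift k fun i => Z i + Y i

@[simp] lemma generic_ι (i : ℕ) : generic (FreeAlgebra.ι k i) = Z i + Y i := by simp [generic]

end Superforms

/-- Induction on noncommutative polynomials by left multiplication with variables. -/
@[elab_as_elim]
theorem FreeAlgebra.induction_left {k : Type*} [Field k] {P : FreeAlgebra k ℕ → Prop} (one : P 1)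
    (add : ∀ a b, P a → P b → P (a + b)) (smul : ∀ (c : k) a, P a → P (c • a))
    (ι_mul : ∀ i a, P a → P (FreeAlgebra.ι k i * a)) (a : FreeAlgebra k ℕ) : P a := by
  have key : ∀ w : FreeAlgebra k ℕ, ∀ b, P b → P (w * b) := by
    intro w
    induction w using FreeAlgebra.induction with
    | grade0 r =>
      intro b hb
      rw [← Algebra.smul_def]
      exact smul r b hb
    | grade1 x => exact ι_mul x
    | mul u v hu hv =>
      intro b hb
      rw [mul_assoc]
      exact hu _ (hv _ hb)
    | add u v hu hv =>
      intro b hb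
      rw [add_mul]
      exact add _ _ (hu _ hb) (hv _ hb)
  simpa using key a 1 one

/-- Homogeneous noncommutative polynomials of degree `n`. -/
def homogeneousFree (k : Type*) [Field k] : ℕ → Submodule k (FreeAlgebra k ℕ)
  | 0 => Submodule.span k {1}
  | n + 1 => Submodule.span k {u | ∃ i, ∃ w ∈ homogeneousFree k n, u = FreeAlgebra.ι k i * w}

namespace Superforms

variable {k : Type*} [Field k]

section CharZero

variable [CharZero k]

lemma even_generic_ι (i : ℕ) : even (generic (FreeAlgebra.ι k i)) = Z i := by
  rw [even_apply, generic_ι, map_add, parity_Z, parity_Y]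
  convert half_smul_add_self (k := k) (Z i : Superforms k) using 2
  abel

lemma odd_generic_ι (i : ℕ) : odd (generic (FreeAlgebra.ι k i)) = Y i := by
  rw [odd_apply, generic_ι, map_add, parity_Z, parity_Y]
  convert half_smul_add_self (k := k) (Y i : Superforms k) using 2
  abel

lemma d_generic (f : FreeAlgebra k ℕ) : d (generic f) = odd (generic f) := by
  induction f using FreeAlgebra.induction_left with
  | one => rw [map_one, d_one, odd_of_even (map_one _)]
  | add a b ha hb => simp [ha, hb]
  | smul c a ha => simp [ha]
  | ι_mul i a ha =>
    rw [map_mul, odd_mul, even_generic_ι, odd_generic_ι, generic_ι, add_mul, map_add, d_Z_mul,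
      d_Y_mul, ha]
    nth_rewrite 2 [← even_add_odd (generic a)]
    rw [mul_add]
    abel

lemma d_even_generic (f : FreeAlgebra k ℕ) : d (even (generic f)) = odd (generic f) := by
  have h : d (parity (generic f)) = odd (generic f) := by
    rw [← neg_neg (d (parity _)), ← parity_d, d_generic, parity_odd, neg_neg]
  rw [even_apply, map_smul, map_add, h, d_generic, half_smul_add_self]

/-- The operator of Cartan's homotopy formula acts on homogeneous elements as
multiplication by the degree. -/
lemma homotopy_generic (n : ℕ) {f : FreeAlgebra k ℕ} (hf : f ∈ homogeneousFree k n) :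
    d (contract (generic f)) + contract (d (generic f)) = (n : k) • generic f := by
  induction n generalizing f with
  | zero =>
    rw [homogeneousFree, Submodule.mem_span_singleton] at hf
    obtain ⟨c, rfl⟩ := hf
    simp
  | succ n ih =>
    rw [homogeneousFree] at hf
    induction hf using Submodule.span_induction with
    | mem x hx =>
      obtain ⟨i, w, hw, rfl⟩ := hx
      have := ih hw
      have h : d (contract (generic (FreeAlgebra.ι k i * w))) +
          contract (d (generic (FreeAlgebra.ι k i * w))) =
          (Z i + Y i) * (d (contract (generic w)) + contract (d (generic w))) +
            (Z i + Y i) * generic w := by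
        simp only [map_mul, generic_ι, add_mul, mul_add, map_add, d_Z_mul, d_Y_mul,
          contract_Z_mul, contract_Y_mul, map_sub, map_neg]
        abel
      rw [h, this, map_mul, generic_ι, mul_smul_comm]
      push_cast
      rw [add_smul, one_smul]
    | zero => simp
    | add x y _ _ hx hy =>
      rw [map_add, smul_add, ← hx, ← hy]
      simp only [map_add]
      abel
    | smul c x _ hx =>
      simp only [map_smul]
      rw [← smul_add, hx, smul_comm]

lemma homotopy_even_generic (n : ℕ) {f : FreeAlgebra k ℕ} (hf : f ∈ homogeneousFree k n) :
    d (contract (even (generic f))) + contract (odd (generic f)) =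
      (n : k) • even (generic f) := by
  have h1 := homotopy_generic n hf
  have h2 := congrArg parity h1
  simp only [map_add, parity_d, parity_contract, map_neg, neg_neg, map_smul] at h2
  rw [← d_even_generic]
  simp only [even_apply, map_smul, map_add]
  rw [← smul_add, smul_comm, smul_add (n : k), ← h1, ← h2]
  congr 1
  abel

end CharZero

/-! ### Weights -/

/-- Monomials of weight `w`, where `z_i` has weight `2` and `y_i` has weight `1`. -/
inductive IsMonomial : ℕ → Superforms k → Prop
  | one : IsMonomial 0 1
  | Z_mul (i : ℕ) {w : ℕ} {u : Superforms k} : IsMonomial w u → IsMonomial (w + 2) (Z i * u)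
  | Y_mul (i : ℕ) {w : ℕ} {u : Superforms k} : IsMonomial w u → IsMonomial (w + 1) (Y i * u)

/-- Superforms homogeneous of weight `w`. -/
def homogeneous (k : Type*) [Field k] (w : ℕ) : Submodule k (Superforms k) :=
  Submodule.span k {u | IsMonomial w u}

/-- The weight filtration: superforms all of whose terms have weight at least `r`. -/
def weightGE (k : Type*) [Field k] (r : ℕ) : Submodule k (Superforms k) :=
  Submodule.span k {u | ∃ w, r ≤ w ∧ IsMonomial w u}

lemma IsMonomial.mul {a b : ℕ} {u v : Superforms k} (hu : IsMonomial a u) (hv : IsMonomial b v) :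
    IsMonomial (a + b) (u * v) := by
  induction hu with
  | one => simpa using hv
  | Z_mul i _ ih =>
    rw [mul_assoc, add_right_comm]
    exact ih.Z_mul i
  | Y_mul i _ ih =>
    rw [mul_assoc, add_right_comm]
    exact ih.Y_mul i

lemma IsMonomial.parity {w : ℕ} {u : Superforms k} (hu : IsMonomial w u) :
    parity u = (-1 : k) ^ w • u := by
  induction hu with
  | one => simp
  | Z_mul i _ ih => rw [map_mul, ih, parity_Z, pow_add, mul_smul_comm]; simp
  | Y_mul i _ ih => rw [map_mul, ih, parity_Y, pow_add, mul_smul_comm]; simp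

lemma IsMonomial.mem_weightGE {r w : ℕ} {u : Superforms k} (hu : IsMonomial w u) (h : r ≤ w) :
    u ∈ weightGE k r :=
  Submodule.subset_span ⟨w, h, hu⟩

lemma weightGE_induction {r : ℕ} {P : Submodule k (Superforms k)}
    (h : ∀ w u, r ≤ w → IsMonomial w u → u ∈ P) {a : Superforms k} (ha : a ∈ weightGE k r) :
    a ∈ P := by
  refine Submodule.span_le.2 ?_ ha
  rintro u ⟨w, hw, hu⟩
  exact h w u hw hu

lemma weightGE_anti {r s : ℕ} (h : r ≤ s) : weightGE k s ≤ weightGE k r := fun _ ha =>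
  weightGE_induction (fun _ _ hw hu => hu.mem_weightGE (h.trans hw)) ha

lemma homogeneous_le_weightGE {r w : ℕ} (h : r ≤ w) : homogeneous k w ≤ weightGE k r :=
  Submodule.span_mono fun _ hu => ⟨w, h, hu⟩

lemma mem_weightGE_zero (a : Superforms k) : a ∈ weightGE k 0 := by
  induction a using induction_left with
  | one => exact IsMonomial.one.mem_weightGE le_rfl
  | add a b ha hb => exact add_mem ha hb
  | smul c a ha => exact Submodule.smul_mem _ c ha
  | Z_mul j a ha =>
    refine weightGE_induction (P := (weightGE k 0).comap (LinearMap.mulLeft k (Z j))) ?_ ha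
    exact fun w u _ hu => (hu.Z_mul j).mem_weightGE (Nat.zero_le _)
  | Y_mul j a ha =>
    refine weightGE_induction (P := (weightGE k 0).comap (LinearMap.mulLeft k (Y j))) ?_ ha
    exact fun w u _ hu => (hu.Y_mul j).mem_weightGE (Nat.zero_le _)

lemma mul_mem_weightGE {r s : ℕ} {a b : Superforms k} (ha : a ∈ weightGE k r)
    (hb : b ∈ weightGE k s) : a * b ∈ weightGE k (r + s) := by
  refine weightGE_induction (P := (weightGE k (r + s)).comap (LinearMap.mulRight k b)) ?_ ha
  intro w u hw hu
  refine weightGE_induction (P := (weightGE k (r + s)).comap (LinearMap.mulLeft k u)) ?_ hb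
  intro w' v hw' hv
  exact (hu.mul hv).mem_weightGE (by omega)

lemma Z_mem (i : ℕ) : (Z i : Superforms k) ∈ weightGE k 2 := by
  simpa using (IsMonomial.one.Z_mul (k := k) i).mem_weightGE le_rfl

lemma Y_mem (i : ℕ) : (Y i : Superforms k) ∈ weightGE k 1 := by
  simpa using (IsMonomial.one.Y_mul (k := k) i).mem_weightGE le_rfl

lemma contract_mem {r : ℕ} {a : Superforms k} (ha : a ∈ weightGE k r) :
    contract a ∈ weightGE k (r + 1) := by
  refine weightGE_induction (P := (weightGE k (r + 1)).comap contract) ?_ ha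
  intro w u hw hu
  refine weightGE_anti (Nat.succ_le_succ hw) ?_
  clear hw
  induction hu with
  | one => simp
  | Z_mul i _ ih =>
    rw [contract_Z_mul]
    exact weightGE_anti (by omega) (mul_mem_weightGE (Z_mem i) ih)
  | @Y_mul i w u hu ih =>
    rw [contract_Y_mul]
    exact sub_mem ((hu.Z_mul i).mem_weightGE (by omega))
      (weightGE_anti (by omega) (mul_mem_weightGE (Y_mem i) ih))

lemma even_mem {r : ℕ} {a : Superforms k} (ha : a ∈ weightGE k r) : even a ∈ weightGE k r := by
  refine weightGE_induction (P := (weightGE k r).comap even) ?_ ha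
  intro w u hw hu
  rw [Submodule.mem_comap, even_apply, hu.parity]
  have := hu.mem_weightGE hw
  exact Submodule.smul_mem _ _ (add_mem this (Submodule.smul_mem _ _ this))

lemma odd_mem {r : ℕ} {a : Superforms k} (ha : a ∈ weightGE k r) : odd a ∈ weightGE k r := by
  refine weightGE_induction (P := (weightGE k r).comap odd) ?_ ha
  intro w u hw hu
  rw [Submodule.mem_comap, odd_apply, hu.parity]
  have := hu.mem_weightGE hw
  exact Submodule.smul_mem _ _ (sub_mem this (Submodule.smul_mem _ _ this))

lemma even_mem_succ {r : ℕ} (hr : Odd r) {a : Superforms k} (ha : a ∈ weightGE k r) :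
    even a ∈ weightGE k (r + 1) := by
  refine weightGE_induction (P := (weightGE k (r + 1)).comap even) ?_ ha
  intro w u hw hu
  rcases hw.eq_or_lt with rfl | hw
  · rw [Submodule.mem_comap, even_apply, hu.parity, hr.neg_one_pow]
    simp
  · exact even_mem (hu.mem_weightGE hw)

lemma odd_mem_succ {r : ℕ} (hr : Even r) {a : Superforms k} (ha : a ∈ weightGE k r) :
    odd a ∈ weightGE k (r + 1) := by
  refine weightGE_induction (P := (weightGE k (r + 1)).comap odd) ?_ ha
  intro w u hw hu
  rcases hw.eq_or_lt with rfl | hw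
  · rw [Submodule.mem_comap, odd_apply, hu.parity, hr.neg_one_pow]
    simp
  · exact odd_mem (hu.mem_weightGE hw)

/-! ### Normal forms for superforms of given weight -/

/-- The span of iterated anticommutators of `j` polynomials without constant term. -/
def circSpan (k : Type*) [Field k] : ℕ → Submodule k (FreeAlgebra k ℕ)
  | 0 => ⊤
  | j + 1 => Submodule.span k {u | ∃ q ∈ circSpan k j, ∃ a ∈ F0 k, u = q * a + a * q}

lemma F0_mul_mem {a : FreeAlgebra k ℕ} (ha : a ∈ F0 k) (u v : FreeAlgebra k ℕ) :
    u * a * v ∈ F0 k := by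
  induction ha using Submodule.span_induction with
  | mem x hx =>
    obtain ⟨a, i, b, rfl⟩ := hx
    exact Submodule.subset_span ⟨u * a, i, b * v, by simp only [mul_assoc]⟩
  | zero => simp
  | add x y _ _ hx hy => rw [mul_add, add_mul]; exact add_mem hx hy
  | smul c x _ hx => rw [mul_smul_comm, smul_mul_assoc]; exact Submodule.smul_mem _ c hx

lemma ι_mem_F0 (i : ℕ) : FreeAlgebra.ι k i ∈ F0 k :=
  Submodule.subset_span ⟨1, i, 1, by simp⟩

lemma anticommutator_mem {j : ℕ} {q a : FreeAlgebra k ℕ} (hq : q ∈ circSpan k j)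
    (ha : a ∈ F0 k) : q * a + a * q ∈ circSpan k (j + 1) :=
  Submodule.subset_span ⟨q, hq, a, ha, rfl⟩

lemma circSpan_succ_le (j : ℕ) : circSpan k (j + 1) ≤ circSpan k j := by
  induction j with
  | zero => exact le_top
  | succ j ih =>
    refine Submodule.span_mono ?_
    rintro _ ⟨q, hq, a, ha, rfl⟩
    exact ⟨q, ih hq, a, ha, rfl⟩

lemma circSpan_one [CharZero k] : circSpan k 1 = F0 k := by
  refine le_antisymm (Submodule.span_le.2 ?_) fun a ha => ?_
  · rintro _ ⟨q, -, a, ha, rfl⟩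
    have h1 := F0_mul_mem ha q 1
    have h2 := F0_mul_mem ha 1 q
    rw [mul_one] at h1
    rw [one_mul] at h2
    exact add_mem h1 h2
  · rw [← half_smul_add_self (k := k) a]
    refine Submodule.smul_mem _ _ ?_
    simpa using anticommutator_mem (j := 0) (q := 1) Submodule.mem_top ha

/-- Superforms of the form `even (generic q)` with `q ∈ circSpan k j`. -/
def evenSpan (k : Type*) [Field k] (j : ℕ) : Submodule k (Superforms k) :=
  (circSpan k j).map (even ∘ₗ generic.toLinearMap)

lemma evenSpan_succ_le (j : ℕ) : evenSpan k (j + 1) ≤ evenSpan k j :=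
  Submodule.map_mono (circSpan_succ_le j)

lemma mul_mem_evenSpan [CharZero k] {j : ℕ} {a : Superforms k} (ha : a ∈ evenSpan k j)
    {f : FreeAlgebra k ℕ} (hf : f ∈ F0 k) : even (generic f) * a ∈ evenSpan k (j + 1) := by
  obtain ⟨q, hq, rfl⟩ := ha
  refine ⟨(2⁻¹ : k) • (q * f + f * q), Submodule.smul_mem _ _ (anticommutator_mem hq hf), ?_⟩
  simp only [LinearMap.comp_apply, AlgHom.toLinearMap_apply, map_smul]
  rw [map_add generic, map_mul, map_mul, even_anticommutator, smul_smul,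
    inv_mul_cancel₀ two_ne_zero, one_smul, even_mul_comm]

lemma Z_mul_mem_evenSpan [CharZero k] {j : ℕ} {a : Superforms k} (ha : a ∈ evenSpan k j) (i : ℕ) :
    Z i * a ∈ evenSpan k (j + 1) := by
  have := mul_mem_evenSpan ha (ι_mem_F0 i)
  rwa [even_generic_ι] at this

lemma Y_mul_Y_mul_mem_evenSpan [CharZero k] {j : ℕ} {a : Superforms k} (ha : a ∈ evenSpan k j)
    (i l : ℕ) :
    Y i * Y l * a ∈ evenSpan k (j + 1) := by
  have h : (2⁻¹ : k) • (FreeAlgebra.ι k i * FreeAlgebra.ι k l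
      - FreeAlgebra.ι k l * FreeAlgebra.ι k i) ∈ F0 k := by
    refine Submodule.smul_mem _ _ (sub_mem ?_ ?_)
    · simpa using F0_mul_mem (ι_mem_F0 (k := k) i) 1 (FreeAlgebra.ι k l)
    · simpa using F0_mul_mem (ι_mem_F0 (k := k) l) 1 (FreeAlgebra.ι k i)
  convert mul_mem_evenSpan ha h using 2
  rw [map_smul, map_sub, map_mul, map_mul, commutator_eq, smul_smul,
    inv_mul_cancel₀ two_ne_zero, one_smul, odd_generic_ι, odd_generic_ι, even_of_even]
  simp

lemma parity_of_mem_evenSpan {j : ℕ} {a : Superforms k} (ha : a ∈ evenSpan k j) :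
    parity a = a := by
  obtain ⟨q, hq, rfl⟩ := ha
  simp

/-- Sums of even forms in `evenSpan` and of products `a * y_i` with `a` in `evenSpan`. -/
def normalSpan (k : Type*) [Field k] (r : ℕ) : Submodule k (Superforms k) :=
  evenSpan k ((r + 1) / 2) ⊔ Submodule.span k {u | ∃ a ∈ evenSpan k (r / 2), ∃ i, u = a * Y i}

lemma evenSpan_anti {i j : ℕ} (h : i ≤ j) : evenSpan k j ≤ evenSpan k i :=
  antitone_nat_of_succ_le (f := evenSpan k) evenSpan_succ_le h

lemma normalSpan_anti {r s : ℕ} (h : r ≤ s) : normalSpan k s ≤ normalSpan k r := by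
  refine sup_le_sup (evenSpan_anti (by omega)) (Submodule.span_mono ?_)
  rintro _ ⟨a, ha, i, rfl⟩
  exact ⟨a, evenSpan_anti (by omega) ha, i, rfl⟩

lemma normalSpan_le {r : ℕ} {P : Submodule k (Superforms k)}
    (h1 : ∀ a ∈ evenSpan k ((r + 1) / 2), a ∈ P)
    (h2 : ∀ a ∈ evenSpan k (r / 2), ∀ i, a * Y i ∈ P) : normalSpan k r ≤ P := by
  refine sup_le h1 (Submodule.span_le.2 ?_)
  rintro _ ⟨a, ha, i, rfl⟩
  exact h2 a ha i

lemma IsMonomial.mem_normalSpan [CharZero k] {w : ℕ} {u : Superforms k} (hu : IsMonomial w u) :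
    u ∈ normalSpan k w := by
  have left : ∀ {r a}, a ∈ evenSpan k ((r + 1) / 2) → a ∈ normalSpan k r :=
    fun h => Submodule.mem_sup_left h
  have right : ∀ {r a} i, a ∈ evenSpan k (r / 2) → a * Y i ∈ normalSpan k r :=
    fun i h => Submodule.mem_sup_right (Submodule.subset_span ⟨_, h, i, rfl⟩)
  induction hu with
  | one =>
    refine left ⟨1, Submodule.mem_top, ?_⟩
    simpa using even_of_even (k := k) (map_one _)
  | @Z_mul i w u _ ih =>
    refine normalSpan_le (P := (normalSpan k (w + 2)).comap (LinearMap.mulLeft k (Z i)))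
      (fun a ha => ?_) (fun a ha l => ?_) ih
    · exact left (evenSpan_anti (by omega) (Z_mul_mem_evenSpan ha i))
    · rw [Submodule.mem_comap, LinearMap.mulLeft_apply, ← mul_assoc]
      exact right l (evenSpan_anti (by omega) (Z_mul_mem_evenSpan ha i))
  | @Y_mul i w u _ ih =>
    refine normalSpan_le (P := (normalSpan k (w + 1)).comap (LinearMap.mulLeft k (Y i)))
      (fun a ha => ?_) (fun a ha l => ?_) ih
    · rw [Submodule.mem_comap, LinearMap.mulLeft_apply,
        ← mul_comm_of_even (parity_of_mem_evenSpan ha)]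
      exact right i ha
    · rw [Submodule.mem_comap, LinearMap.mulLeft_apply,
        mul_comm_of_even (parity_of_mem_evenSpan ha), ← mul_assoc]
      exact left (evenSpan_anti (by omega) (Y_mul_Y_mul_mem_evenSpan ha i l))

lemma weightGE_le_normalSpan [CharZero k] (r : ℕ) : weightGE k r ≤ normalSpan k r := fun _ ha =>
  weightGE_induction (fun _ _ hw hu => normalSpan_anti hw hu.mem_normalSpan) ha

/-- Even forms of weight at least `2 * n` come from iterated anticommutators of length `n`. -/
lemma exists_circSpan_of_even [CharZero k] {n : ℕ} {a : Superforms k} (ha : a ∈ weightGE k (2 * n))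
    (h : parity a = a) : ∃ q ∈ circSpan k n, even (generic q) = a := by
  have : normalSpan k (2 * n) ≤ (evenSpan k n).comap even := by
    refine normalSpan_le (fun a ha => ?_) (fun a ha i => ?_)
    · rw [Submodule.mem_comap, even_of_even (parity_of_mem_evenSpan ha)]
      exact evenSpan_anti (by omega) ha
    · rw [Submodule.mem_comap, even_of_odd]
      · exact zero_mem _
      · rw [map_mul, parity_of_mem_evenSpan ha, parity_Y, mul_neg]
  have := this (weightGE_le_normalSpan _ ha)
  rw [Submodule.mem_comap, even_of_even h] at this
  exact this

/-- The span of commutators of elements of `F_0`. -/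
def commutatorSpan (k : Type*) [Field k] : Submodule k (FreeAlgebra k ℕ) :=
  Submodule.span k {u | ∃ a ∈ F0 k, ∃ b ∈ F0 k, u = a * b - b * a}

lemma exists_add_algebraMap (a : FreeAlgebra k ℕ) :
    ∃ b ∈ F0 k, ∃ c : k, a = b + algebraMap k _ c := by
  induction a using FreeAlgebra.induction_left with
  | one => exact ⟨0, zero_mem _, 1, by simp⟩
  | add a b ha hb =>
    obtain ⟨x, hx, c, rfl⟩ := ha
    obtain ⟨y, hy, c', rfl⟩ := hb
    exact ⟨x + y, add_mem hx hy, c + c', by rw [map_add]; abel⟩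
  | smul t a ha =>
    obtain ⟨x, hx, c, rfl⟩ := ha
    exact ⟨t • x, Submodule.smul_mem _ t hx, t * c, by
      rw [smul_add, map_mul, Algebra.smul_def t (algebraMap _ _ c)]⟩
  | ι_mul i a ha =>
    exact ⟨_, by simpa using F0_mul_mem (ι_mem_F0 i) 1 a, 0, by rw [map_zero, add_zero]⟩

lemma commutator_mem (a : FreeAlgebra k ℕ) {b : FreeAlgebra k ℕ} (hb : b ∈ F0 k) :
    a * b - b * a ∈ commutatorSpan k := by
  obtain ⟨x, hx, c, rfl⟩ := exists_add_algebraMap a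
  refine Submodule.subset_span ⟨x, hx, b, hb, ?_⟩
  rw [add_mul, mul_add, Algebra.commutes c b]
  abel

/-- The even part of an exact form comes from a combination of commutators. -/
lemma exists_commutatorSpan [CharZero k] (a : Superforms k) :
    ∃ c ∈ commutatorSpan k, generic c = even (d a) := by
  have : normalSpan k 0 ≤ ((commutatorSpan k).map generic.toLinearMap).comap (even ∘ₗ d) := by
    refine normalSpan_le (fun a ha => ?_) (fun a ha i => ?_)
    · obtain ⟨q, hq, rfl⟩ := ha
      simp only [Submodule.mem_comap, LinearMap.comp_apply, AlgHom.toLinearMap_apply]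
      rw [d_even_generic, even_of_odd (parity_odd _)]
      exact zero_mem _
    · obtain ⟨q, hq, rfl⟩ := ha
      simp only [Submodule.mem_comap, LinearMap.comp_apply, AlgHom.toLinearMap_apply]
      rw [even_mul_comm, d_Y_mul, d_even_generic, Y_mul_eq, parity_odd, neg_mul, neg_neg,
        ← odd_generic_ι i, ← half_smul_add_self (k := k) (odd _ * odd _), ← two_smul k,
        ← commutator_eq, ← map_mul, ← map_mul, ← map_sub, ← map_smul, even_of_even]
      · exact Submodule.mem_map_of_mem (Submodule.smul_mem _ _ (commutator_mem _ (ι_mem_F0 i)))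
      · rw [map_smul, map_sub, map_mul, map_mul, commutator_eq, smul_smul,
          inv_mul_cancel₀ two_ne_zero, one_smul, map_mul, parity_odd, parity_odd, neg_mul_neg]
  exact this (weightGE_le_normalSpan 0 (mem_weightGE_zero a))

/-! ### The exterior algebra -/

section Exterior

open ExteriorAlgebra

variable {M : Type*} [AddCommGroup M] [Module k M]

/-- The grade involution of the exterior algebra. -/
def involution : ExteriorAlgebra k M →ₐ[k] ExteriorAlgebra k M := CliffordAlgebra.involute

@[simp] lemma involution_ι (v : M) : involution (ι k v) = -ι k v :=
  CliffordAlgebra.involute_ι v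

@[simp] lemma involution_involution (a : ExteriorAlgebra k M) :
    involution (involution a) = a :=
  CliffordAlgebra.involute_involute a

lemma ι_mul_eq (v : M) (a : ExteriorAlgebra k M) : ι k v * a = involution a * ι k v := by
  induction a using ExteriorAlgebra.induction with
  | algebraMap c => rw [AlgHom.commutes, Algebra.commutes]
  | ι w => rw [involution_ι, neg_mul, eq_neg_iff_add_eq_zero, ι_add_mul_swap]
  | mul a b ha hb => rw [← mul_assoc, ha, mul_assoc, hb, map_mul, mul_assoc]
  | add a b ha hb => rw [mul_add, map_add, add_mul, ha, hb]

lemma mul_comm_of_involution_eq {u : ExteriorAlgebra k M} (hu : involution u = u)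
    (a : ExteriorAlgebra k M) : u * a = a * u := by
  induction a using ExteriorAlgebra.induction with
  | algebraMap c => rw [Algebra.commutes]
  | ι w => rw [ι_mul_eq, hu]
  | mul a b ha hb => rw [← mul_assoc, ha, mul_assoc, hb, mul_assoc]
  | add a b ha hb => rw [mul_add, add_mul, ha, hb]

lemma mul_eq_of_involution_eq_neg {u : ExteriorAlgebra k M} (hu : involution u = -u)
    (a : ExteriorAlgebra k M) : u * a = involution a * u := by
  induction a using ExteriorAlgebra.induction with
  | algebraMap c => rw [AlgHom.commutes, Algebra.commutes]
  | ι w => rw [involution_ι, neg_mul, ι_mul_eq, hu, neg_mul, neg_neg]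
  | mul a b ha hb => rw [← mul_assoc, ha, mul_assoc, hb, map_mul, mul_assoc]
  | add a b ha hb => rw [mul_add, map_add, add_mul, ha, hb]

/-- The augmentation ideal of the exterior algebra. -/
def augIdeal (k M : Type*) [Field k] [AddCommGroup M] [Module k M] :
    Submodule k (ExteriorAlgebra k M) :=
  LinearMap.range (ι k (M := M)) * ⊤

lemma augIdeal_mul_top : augIdeal k M * ⊤ ≤ augIdeal k M := by
  rw [augIdeal, mul_assoc]
  exact mul_le_mul' le_rfl le_top

lemma top_mul_range_le : (⊤ : Submodule k (ExteriorAlgebra k M)) * LinearMap.range (ι k (M := M)) ≤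
    LinearMap.range (ι k (M := M)) * ⊤ := by
  rw [Submodule.mul_le]
  rintro a - _ ⟨v, rfl⟩
  rw [← involution_involution a, ← ι_mul_eq]
  exact Submodule.mul_mem_mul ⟨v, rfl⟩ Submodule.mem_top

lemma top_mul_augIdeal : ⊤ * augIdeal k M ≤ augIdeal k M := by
  rw [augIdeal, ← mul_assoc]
  refine (mul_le_mul' top_mul_range_le le_rfl).trans ?_
  rw [mul_assoc]
  exact mul_le_mul' le_rfl le_top

lemma augIdeal_mul_mem {a : ExteriorAlgebra k M} (ha : a ∈ augIdeal k M)
    (b : ExteriorAlgebra k M) : a * b ∈ augIdeal k M :=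
  augIdeal_mul_top (Submodule.mul_mem_mul ha Submodule.mem_top)

lemma mul_augIdeal_mem {a : ExteriorAlgebra k M} (ha : a ∈ augIdeal k M)
    (b : ExteriorAlgebra k M) : b * a ∈ augIdeal k M :=
  top_mul_augIdeal (Submodule.mul_mem_mul Submodule.mem_top ha)

lemma ι_mem_augIdeal (v : M) : ι k v ∈ augIdeal k M := by
  have := Submodule.mul_mem_mul (LinearMap.mem_range_self (ι k) v)
    (Submodule.mem_top (R := k) (x := (1 : ExteriorAlgebra k M)))
  rwa [mul_one] at this

lemma sub_involution_mem (a : ExteriorAlgebra k M) : a - involution a ∈ augIdeal k M := by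
  induction a using ExteriorAlgebra.induction with
  | algebraMap c => simp
  | ι v =>
    rw [involution_ι, sub_neg_eq_add]
    exact add_mem (ι_mem_augIdeal v) (ι_mem_augIdeal v)
  | mul a b ha hb =>
    have : a * b - involution (a * b) =
        (a - involution a) * b + involution a * (b - involution b) := by
      rw [map_mul, sub_mul, mul_sub]; abel
    rw [this]
    exact add_mem (augIdeal_mul_mem ha b) (mul_augIdeal_mem hb _)
  | add a b ha hb =>
    rw [map_add, add_sub_add_comm]
    exact add_mem ha hb

lemma add_involution_mem {a : ExteriorAlgebra k M} (ha : a ∈ augIdeal k M) :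
    a + involution a ∈ augIdeal k M ^ 2 := by
  have : augIdeal k M ≤
      (augIdeal k M ^ 2).comap (LinearMap.id + (involution (M := M)).toLinearMap) := by
    conv_lhs => rw [augIdeal]
    rw [Submodule.mul_le]
    rintro _ ⟨v, rfl⟩ b -
    have h : ι k v * b + involution (ι k v * b) = ι k v * (b - involution b) := by
      rw [map_mul, involution_ι, mul_sub, neg_mul, sub_eq_add_neg]
    rw [Submodule.mem_comap, LinearMap.add_apply, LinearMap.id_apply, AlgHom.toLinearMap_apply, h,
      pow_two]
    exact Submodule.mul_mem_mul (ι_mem_augIdeal v) (sub_involution_mem b)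
  exact this ha

lemma augIdeal_pow_le (r : ℕ) : augIdeal k M ^ r ≤ LinearMap.range (ι k (M := M)) ^ r * ⊤ := by
  induction r with
  | zero => simp
  | succ r ih =>
    rw [pow_succ, pow_succ, mul_assoc]
    calc augIdeal k M ^ r * augIdeal k M
        ≤ LinearMap.range (ι k (M := M)) ^ r * ⊤ * augIdeal k M := mul_le_mul' ih le_rfl
      _ ≤ _ := by
        rw [mul_assoc]
        exact mul_le_mul' le_rfl top_mul_augIdeal

lemma augIdeal_pow_eq_bot (m : ℕ) : augIdeal k (Fin m → k) ^ (m + 1) = ⊥ := by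
  refine le_bot_iff.1 ((augIdeal_pow_le _).trans ?_)
  have : LinearMap.range (ι k (M := Fin m → k)) ^ (m + 1) = ⊥ := by
    refine le_bot_iff.1 ((ExteriorAlgebra.ιMulti_span_fixedDegree k (m + 1)).symm.le.trans ?_)
    refine Submodule.span_le.2 ?_
    rintro _ ⟨v, rfl⟩
    refine AlternatingMap.map_linearDependent _ v fun h => ?_
    simpa using h.fintype_card_le_finrank
  rw [this, Submodule.bot_mul]

lemma G0_le_augIdeal (m : ℕ) : G0 k m ≤ augIdeal k (Fin m → k) := by
  refine Submodule.span_le.2 ?_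
  rintro _ ⟨r, hr, s, -, -, rfl⟩
  obtain ⟨r, rfl⟩ := Nat.exists_eq_succ_of_ne_zero (by omega : r ≠ 0)
  rw [List.ofFn_succ, List.prod_cons]
  exact augIdeal_mul_mem (ι_mem_augIdeal _) _

lemma IsMonomial.map_mem {w : ℕ} {u : Superforms k} (hu : IsMonomial w u)
    {F : Superforms k →ₐ[k] ExteriorAlgebra k M} (hZ : ∀ i, F (Z i) ∈ augIdeal k M ^ 2)
    (hY : ∀ i, F (Y i) ∈ augIdeal k M) : F u ∈ augIdeal k M ^ w := by
  induction hu with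
  | one => simp
  | Z_mul i _ ih =>
    rw [map_mul, add_comm, pow_add]
    exact Submodule.mul_mem_mul (hZ i) ih
  | Y_mul i _ ih =>
    rw [map_mul, pow_succ']
    exact Submodule.mul_mem_mul (hY i) ih

variable [CharZero k]

/-- Every algebra homomorphism to the exterior algebra with values of the variables in the
augmentation ideal factors through `generic`. -/
lemma exists_factorization {φ : FreeAlgebra k ℕ →ₐ[k] ExteriorAlgebra k M}
    (hφ : ∀ i, φ (FreeAlgebra.ι k i) ∈ augIdeal k M) :
    ∃ F : Superforms k →ₐ[k] ExteriorAlgebra k M, (∀ f, F (generic f) = φ f) ∧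
      (∀ a, F (parity a) = involution (F a)) ∧
      (∀ i, F (Z i) ∈ augIdeal k M ^ 2) ∧ ∀ i, F (Y i) ∈ augIdeal k M := by
  set x := fun i => φ (FreeAlgebra.ι k i) with hx
  have hz : ∀ i, involution ((2⁻¹ : k) • (x i + involution (x i))) =
      (2⁻¹ : k) • (x i + involution (x i)) := fun i => by simp [add_comm]
  have hy : ∀ i, involution ((2⁻¹ : k) • (x i - involution (x i))) =
      -((2⁻¹ : k) • (x i - involution (x i))) := fun i => by
    rw [map_smul, map_sub, involution_involution, ← smul_neg, neg_sub]
  obtain ⟨F, hFZ, hFY⟩ := exists_lift (k := k) (fun i => (2⁻¹ : k) • (x i + involution (x i)))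
    (fun i => (2⁻¹ : k) • (x i - involution (x i)))
    (fun i j => mul_comm_of_involution_eq (hz i) _) (fun i j => mul_comm_of_involution_eq (hz i) _)
    (fun i j => by rw [mul_eq_of_involution_eq_neg (hy i), hy, neg_mul])
  refine ⟨F, fun f => ?_, fun a => ?_, fun i => ?_, fun i => ?_⟩
  · suffices h : F.comp generic = φ from DFunLike.congr_fun h f
    ext i
    simp only [AlgHom.coe_comp, Function.comp_apply, generic_ι, map_add, hFZ, hFY]
    rw [← smul_add]
    convert half_smul_add_self (k := k) (x i) using 2
    abel
  · induction a using induction_left with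
    | one => simp
    | add a b ha hb => simp [ha, hb]
    | smul c a ha => simp [ha]
    | Z_mul j a ha => rw [map_mul, parity_Z, map_mul, ha, hFZ, map_mul, map_mul, hFZ, hz]
    | Y_mul j a ha =>
      rw [map_mul, parity_Y, map_mul, ha, map_neg, hFY, map_mul, map_mul, hFY, hy]
  · rw [hFZ]
    exact Submodule.smul_mem _ _ (add_involution_mem (hφ i))
  · rw [hFY]
    exact Submodule.smul_mem _ _ (sub_involution_mem _)

end Exterior

/-! ### Decomposition into homogeneous components -/

lemma le_of_inf_homogeneous_le [Infinite k] {V : Type*} [AddCommGroup V] [Module k V]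
    {H : ℕ → Submodule k V} (hH : ⨆ i, H i = ⊤) (s : k → V →ₗ[k] V)
    (hs : ∀ t i, ∀ v ∈ H i, s t v = t ^ i • v) {P Q : Submodule k V}
    (hP : ∀ t, ∀ v ∈ P, s t v ∈ P) (hQ : ∀ i, P ⊓ H i ≤ Q) : P ≤ Q := by
  intro f hf
  obtain ⟨v, hv, rfl⟩ := (Submodule.mem_iSup_iff_exists_finsupp H f).1 (hH ▸ Submodule.mem_top)
  refine Submodule.sum_mem _ fun i hi => hQ i ⟨?_, hv i⟩
  change v i ∈ P
  rw [← Submodule.Quotient.mk_eq_zero, ← Module.forall_dual_apply_eq_zero_iff k]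
  intro g
  set p : Polynomial k := ∑ j ∈ v.support, Polynomial.monomial j (g (P.mkQ (v j))) with hp
  have h0 : p = 0 := by
    refine Polynomial.funext fun t => ?_
    have h1 := hP t _ hf
    rw [← Submodule.Quotient.mk_eq_zero, ← Submodule.mkQ_apply] at h1
    have h2 := congrArg g h1
    rw [Finsupp.sum, map_sum, map_sum, map_sum, map_zero] at h2
    rw [hp, Polynomial.eval_finsetSum, Polynomial.eval_zero, ← h2]
    refine Finset.sum_congr rfl fun j _ => ?_
    rw [hs t j _ (hv j), map_smul, map_smul, Polynomial.eval_monomial, smul_eq_mul, mul_comm]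
  have h3 : p.coeff i = g (P.mkQ (v i)) := by
    rw [hp, Polynomial.finsetSum_coeff, Finset.sum_eq_single i]
    · simp
    · intro j _ hj
      exact Polynomial.coeff_monomial_of_ne _ hj.symm
    · exact fun h => absurd hi h
  rw [h0, Polynomial.coeff_zero] at h3
  exact h3.symm

lemma iSup_homogeneous : ⨆ w, homogeneous k w = ⊤ := by
  refine eq_top_iff.2 fun a _ => weightGE_induction ?_ (mem_weightGE_zero a)
  intro w u _ hu
  exact Submodule.mem_iSup_of_mem w (Submodule.subset_span hu)

lemma exists_scaling (t : k) : ∃ F : Superforms k →ₐ[k] Superforms k,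
    (∀ i, F (Z i) = t ^ 2 • Z i) ∧ ∀ i, F (Y i) = t • Y i := by
  refine exists_lift _ _ (fun i j => ?_) (fun i j => ?_) (fun i j => ?_)
  · rw [smul_mul_smul_comm, smul_mul_smul_comm, Z_mul_Z]
  · rw [smul_mul_smul_comm, smul_mul_smul_comm, Z_mul_Y, mul_comm]
  · rw [smul_mul_smul_comm, smul_mul_smul_comm, Y_mul_Y, smul_neg]

/-- The scaling automorphism multiplying forms of weight `w` by `t ^ w`. -/
def scaling (t : k) : Superforms k →ₐ[k] Superforms k := (exists_scaling t).choose

@[simp] lemma scaling_Z (t : k) (i : ℕ) : scaling t (Z i) = t ^ 2 • Z i :=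
  (exists_scaling t).choose_spec.1 i

@[simp] lemma scaling_Y (t : k) (i : ℕ) : scaling t (Y i) = t • Y i :=
  (exists_scaling t).choose_spec.2 i

lemma scaling_of_mem_homogeneous (t : k) (w : ℕ) {a : Superforms k} (ha : a ∈ homogeneous k w) :
    scaling t a = t ^ w • a := by
  induction ha using Submodule.span_induction with
  | mem u hu =>
    change IsMonomial w u at hu
    induction hu with
    | one => simp
    | Z_mul i _ ih =>
      rw [map_mul, ih, scaling_Z, smul_mul_smul_comm, ← pow_add, add_comm]
    | Y_mul i _ ih =>
      rw [map_mul, ih, scaling_Y, smul_mul_smul_comm, ← pow_succ']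
  | zero => simp
  | add x y _ _ hx hy => rw [map_add, hx, hy, smul_add]
  | smul c x _ hx => rw [map_smul, hx, smul_comm]

/-- The Euler operator in the first `n` even and odd variables. -/
def euler (k : Type*) [Field k] (n : ℕ) : Superforms k →ₗ[k] Superforms k :=
  ∑ i ∈ Finset.range n, ((2 : k) • LinearMap.mulLeft k (Z i) ∘ₗ pderivZ i +
    LinearMap.mulLeft k (Y i) ∘ₗ pderivY i)

lemma euler_apply (n : ℕ) (a : Superforms k) : euler k n a =
    ∑ i ∈ Finset.range n, ((2 : k) • (Z i * pderivZ i a) + Y i * pderivY i a) := by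
  simp [euler]

lemma euler_Z_mul {n j : ℕ} (h : j < n) (a : Superforms k) :
    euler k n (Z j * a) = Z j * euler k n a + (2 : k) • (Z j * a) := by
  have : (2 : k) • (Z j * a) = ∑ i ∈ Finset.range n, if i = j then (2 : k) • (Z j * a) else 0 := by
    rw [Finset.sum_ite_eq', if_pos (Finset.mem_range.2 h)]
  rw [euler_apply, euler_apply, Finset.mul_sum, this, ← Finset.sum_add_distrib]
  refine Finset.sum_congr rfl fun i _ => ?_
  rw [pderivZ_Z_mul, pderivY_Z_mul, mul_add, mul_add, ← mul_assoc, ← mul_assoc, ← Z_mul_Y,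
    Z_mul_Z i j, mul_smul_comm, mul_assoc, mul_assoc, smul_add]
  rcases eq_or_ne i j with rfl | hij
  · simp only [if_true]
    abel
  · simp [hij, hij.symm]

lemma euler_Y_mul {n j : ℕ} (h : j < n) (a : Superforms k) :
    euler k n (Y j * a) = Y j * euler k n a + Y j * a := by
  have : Y j * a = ∑ i ∈ Finset.range n, if i = j then Y j * a else 0 := by
    rw [Finset.sum_ite_eq', if_pos (Finset.mem_range.2 h)]
  nth_rewrite 2 [this]
  rw [euler_apply, euler_apply, Finset.mul_sum, ← Finset.sum_add_distrib]
  refine Finset.sum_congr rfl fun i _ => ?_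
  rw [pderivZ_Y_mul, pderivY_Y_mul, mul_add, mul_add, mul_neg, ← mul_assoc, ← mul_assoc, Z_mul_Y,
    Y_mul_Y i j, mul_smul_comm, mul_assoc, neg_mul, neg_neg, mul_assoc, add_assoc]
  rcases eq_or_ne i j with rfl | hij
  · simp
  · simp [hij, hij.symm]

lemma IsMonomial.exists_euler {w : ℕ} {u : Superforms k} (hu : IsMonomial w u) :
    ∃ n₀, ∀ n ≥ n₀, euler k n u = (w : k) • u := by
  induction hu with
  | one => exact ⟨0, fun n _ => by simp [euler_apply]⟩
  | Z_mul j _ ih =>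
    obtain ⟨n₀, h⟩ := ih
    refine ⟨max n₀ (j + 1), fun n hn => ?_⟩
    rw [euler_Z_mul (by omega), h n (by omega), mul_smul_comm, ← add_smul]
    push_cast
    rfl
  | Y_mul j _ ih =>
    obtain ⟨n₀, h⟩ := ih
    refine ⟨max n₀ (j + 1), fun n hn => ?_⟩
    rw [euler_Y_mul (by omega), h n (by omega), mul_smul_comm, Nat.cast_succ, add_smul, one_smul]

lemma exists_euler {w : ℕ} {a : Superforms k} (ha : a ∈ homogeneous k w) :
    ∃ n₀, ∀ n ≥ n₀, euler k n a = (w : k) • a := by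
  induction ha using Submodule.span_induction with
  | mem u hu => exact hu.exists_euler
  | zero => exact ⟨0, by simp⟩
  | add x y _ _ hx hy =>
    obtain ⟨p, hp⟩ := hx
    obtain ⟨q, hq⟩ := hy
    refine ⟨max p q, fun n hn => ?_⟩
    rw [map_add, hp n (by omega), hq n (by omega), smul_add]
  | smul c x _ hx =>
    obtain ⟨p, hp⟩ := hx
    exact ⟨p, fun n hn => by rw [map_smul, hp n hn, smul_comm]⟩

/-! ### Separation of superforms by evaluations in Grassmann algebras -/

section Separation

open ExteriorAlgebra

variable {m : ℕ}

/-- The standard generators of the Grassmann algebra, indexed from zero. -/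
def gen (k : Type*) [Field k] {m : ℕ} (j : Fin m) : ExteriorAlgebra k (Fin m → k) :=
  ι k (Pi.single j 1)

/-- The span of the first `r` generators of the Grassmann algebra. -/
def genSpan (k : Type*) [Field k] (m r : ℕ) : Submodule k (ExteriorAlgebra k (Fin m → k)) :=
  Submodule.span k {u | ∃ j : Fin m, (j : ℕ) < r ∧ u = gen k j}

lemma genSpan_mono {r s : ℕ} (h : r ≤ s) : genSpan k m r ≤ genSpan k m s := by
  refine Submodule.span_mono ?_
  rintro _ ⟨j, hj, rfl⟩
  exact ⟨j, hj.trans_le h, rfl⟩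

lemma gen_mem {r : ℕ} {j : Fin m} (h : (j : ℕ) < r) : gen k j ∈ genSpan k m r :=
  Submodule.subset_span ⟨j, h, rfl⟩

lemma involution_of_mem_genSpan {r : ℕ} {u : ExteriorAlgebra k (Fin m → k)}
    (hu : u ∈ genSpan k m r) : involution u = -u := by
  induction hu using Submodule.span_induction with
  | mem x hx => obtain ⟨j, -, rfl⟩ := hx; exact involution_ι _
  | zero => simp
  | add x y _ _ hx hy => rw [map_add, hx, hy, neg_add]
  | smul c x _ hx => rw [map_smul, hx, smul_neg]

lemma involution_of_mem_genSpan_mul {r : ℕ} {u : ExteriorAlgebra k (Fin m → k)}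
    (hu : u ∈ genSpan k m r * genSpan k m r) : involution u = u := by
  induction hu using Submodule.mul_induction_on' with
  | mem_mul_mem x hx y hy =>
    rw [map_mul, involution_of_mem_genSpan hx, involution_of_mem_genSpan hy, neg_mul_neg]
  | add x _ y _ hx hy => rw [map_add, hx, hy]

/-- Evaluations of superforms using only the first `r` generators. -/
def IsEval (r : ℕ) (F : Superforms k →ₐ[k] ExteriorAlgebra k (Fin m → k)) : Prop :=
  (∀ i, F (Z i) ∈ genSpan k m r * genSpan k m r) ∧ ∀ i, F (Y i) ∈ genSpan k m r

lemma IsEval.mono {r s : ℕ} (h : r ≤ s) {F : Superforms k →ₐ[k] ExteriorAlgebra k (Fin m → k)}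
    (hF : IsEval r F) : IsEval s F :=
  ⟨fun i => mul_le_mul' (genSpan_mono h) (genSpan_mono h) (hF.1 i),
    fun i => genSpan_mono h (hF.2 i)⟩

lemma exists_isEval {r : ℕ} (z y : ℕ → ExteriorAlgebra k (Fin m → k))
    (hz : ∀ i, z i ∈ genSpan k m r * genSpan k m r) (hy : ∀ i, y i ∈ genSpan k m r) :
    ∃ F : Superforms k →ₐ[k] ExteriorAlgebra k (Fin m → k), IsEval r F ∧
      (∀ i, F (Z i) = z i) ∧ ∀ i, F (Y i) = y i := by
  obtain ⟨F, hZ, hY⟩ := exists_lift (k := k) z y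
    (fun i j => mul_comm_of_involution_eq (involution_of_mem_genSpan_mul (hz i)) _)
    (fun i j => mul_comm_of_involution_eq (involution_of_mem_genSpan_mul (hz i)) _)
    (fun i j => by
      rw [mul_eq_of_involution_eq_neg (involution_of_mem_genSpan (hy i)),
        involution_of_mem_genSpan (hy j), neg_mul])
  exact ⟨F, ⟨fun i => hZ i ▸ hz i, fun i => hY i ▸ hy i⟩, hZ, hY⟩

/-- Contraction with the `j`-th coordinate. -/
def coordContract (k : Type*) [Field k] {m : ℕ} (j : Fin m) :
    ExteriorAlgebra k (Fin m → k) →ₗ[k] ExteriorAlgebra k (Fin m → k) :=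
  CliffordAlgebra.contractLeft (Q := 0) (LinearMap.proj j)

lemma coordContract_gen_mul (j i : Fin m) (a : ExteriorAlgebra k (Fin m → k)) :
    coordContract k j (gen k i * a) = (if i = j then a else 0) - gen k i * coordContract k j a := by
  have := CliffordAlgebra.contractLeft_ι_mul (Q := (0 : QuadraticForm k (Fin m → k)))
    (LinearMap.proj (R := k) (φ := fun _ => k) j) (Pi.single i 1) a
  refine this.trans ?_
  rcases eq_or_ne i j with rfl | h
  · simp [gen, coordContract, ExteriorAlgebra.ι]
  · simp [gen, coordContract, ExteriorAlgebra.ι, h, h.symm]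

lemma coordContract_mul_eq_zero {r : ℕ} {j : Fin m} (hj : r ≤ (j : ℕ))
    {u : ExteriorAlgebra k (Fin m → k)} (hu : u ∈ genSpan k m r)
    {a : ExteriorAlgebra k (Fin m → k)} (ha : coordContract k j a = 0) :
    coordContract k j (u * a) = 0 := by
  induction hu using Submodule.span_induction with
  | mem x hx =>
    obtain ⟨i, hi, rfl⟩ := hx
    rw [coordContract_gen_mul, ha, if_neg (by rintro rfl; omega)]
    simp
  | zero => simp
  | add x y _ _ hx hy => rw [add_mul, map_add, hx, hy, add_zero]
  | smul c x _ hx => rw [smul_mul_assoc, map_smul, hx, smul_zero]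

lemma IsEval.coordContract_eq_zero {r : ℕ} {j : Fin m} (hj : r ≤ (j : ℕ))
    {F : Superforms k →ₐ[k] ExteriorAlgebra k (Fin m → k)} (hF : IsEval r F) (a : Superforms k) :
    coordContract k j (F a) = 0 := by
  induction a using induction_left with
  | one => rw [map_one]; exact CliffordAlgebra.contractLeft_one (Q := 0) _
  | add a b ha hb => rw [map_add, map_add, ha, hb, add_zero]
  | smul c a ha => rw [map_smul, map_smul, ha, smul_zero]
  | Z_mul i a ha =>
    rw [map_mul]
    have := hF.1 i
    generalize F (Z i) = u at this ⊢
    induction this using Submodule.mul_induction_on' with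
    | mem_mul_mem x hx y hy =>
      rw [mul_assoc]
      exact coordContract_mul_eq_zero hj hx (coordContract_mul_eq_zero hj hy ha)
    | add x _ y _ hx hy => rw [add_mul, map_add, hx, hy, add_zero]
  | Y_mul i a ha =>
    rw [map_mul]
    exact coordContract_mul_eq_zero hj (hF.2 i) ha

lemma eq_zero_of_gen_mul_eq_zero {j : Fin m} {u : ExteriorAlgebra k (Fin m → k)}
    (hu : coordContract k j u = 0) (h : gen k j * u = 0) : u = 0 := by
  have := coordContract_gen_mul j j u
  rw [h, hu, if_pos rfl] at this
  simpa using this.symm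

/-- Superforms vanishing under all evaluations using only the first `r` generators. -/
def evalKernel (k : Type*) [Field k] (m r : ℕ) : Submodule k (Superforms k) where
  carrier := {a | ∀ F : Superforms k →ₐ[k] ExteriorAlgebra k (Fin m → k), IsEval r F → F a = 0}
  add_mem' ha hb F hF := by rw [map_add, ha F hF, hb F hF, add_zero]
  zero_mem' F _ := map_zero F
  smul_mem' c a ha F hF := by rw [map_smul, ha F hF, smul_zero]

lemma gen_mul_gen_self (j : Fin m) : gen k j * gen k j = 0 := ι_sq_zero _

lemma pderivY_mem_evalKernel {r : ℕ} (hr : r < m) (i : ℕ) {a : Superforms k}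
    (ha : a ∈ evalKernel k m (r + 1)) : pderivY i a ∈ evalKernel k m r := by
  intro F hF
  set e := gen k (⟨r, hr⟩ : Fin m) with he
  have hF1 := hF.mono (Nat.le_succ r)
  have hmem : e ∈ genSpan k m (r + 1) := gen_mem (Nat.lt_succ_self r)
  obtain ⟨F', hF', hZ, hY⟩ := exists_isEval (r := r + 1) (fun j => F (Z j))
    (fun j => F (Y j) + if j = i then e else 0) hF1.1
    (fun j => add_mem (hF1.2 j) (by split_ifs; exacts [hmem, zero_mem _]))
  have key : ∀ a, F' a = F a + e * F (pderivY i a) := by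
    intro a
    induction a using induction_left with
    | one => simp
    | add a b ha hb => simp only [map_add, ha, hb, mul_add]; abel
    | smul c a ha => simp only [map_smul, ha, mul_smul_comm, smul_add]
    | Z_mul j a ha =>
      rw [map_mul, ha, hZ, pderivY_Z_mul, map_mul, map_mul, mul_add, ← mul_assoc (F (Z j)),
        mul_comm_of_involution_eq (involution_of_mem_genSpan_mul (hF.1 j)) e, mul_assoc]
    | Y_mul j a ha =>
      have h1 : F (Y j) * e = -(e * F (Y j)) := by
        rw [mul_eq_of_involution_eq_neg (involution_of_mem_genSpan (hF.2 j)),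
          involution_of_mem_genSpan hmem, neg_mul]
      rw [map_mul, ha, hY, pderivY_Y_mul]
      rcases eq_or_ne j i with rfl | hj
      · simp only [if_true, map_add, map_neg, map_mul, mul_add, add_mul, mul_neg]
        rw [← mul_assoc (F (Y j)), h1, ← mul_assoc e e, gen_mul_gen_self, neg_mul, mul_assoc e]
        simp only [zero_mul, add_zero]
        abel
      · simp only [hj, if_false, add_zero, map_neg, map_mul, mul_add, mul_neg]
        rw [← mul_assoc (F (Y j)), h1, neg_mul, mul_assoc e]
  have h := key a
  rw [ha F' hF', ha F hF1, zero_add] at h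
  exact eq_zero_of_gen_mul_eq_zero (hF.coordContract_eq_zero (j := ⟨r, hr⟩) le_rfl _) h.symm

lemma pderivZ_mem_evalKernel {r : ℕ} (hr : r + 1 < m) (i : ℕ) {a : Superforms k}
    (ha : a ∈ evalKernel k m (r + 2)) : pderivZ i a ∈ evalKernel k m r := by
  intro F hF
  set e := gen k (⟨r, by omega⟩ : Fin m) with he
  set e' := gen k (⟨r + 1, hr⟩ : Fin m) with he'
  have hF1 := hF.mono (Nat.le_add_right r 2)
  have hmem : e * e' ∈ genSpan k m (r + 2) * genSpan k m (r + 2) :=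
    Submodule.mul_mem_mul (gen_mem (show r < r + 2 by omega))
      (gen_mem (show r + 1 < r + 2 by omega))
  have hcomm := mul_comm_of_involution_eq (involution_of_mem_genSpan_mul hmem)
  have hsq : e * e' * (e * e') = 0 := by
    rw [← mul_assoc (e * e') e, hcomm e, ← mul_assoc e e e', gen_mul_gen_self, zero_mul, zero_mul]
  obtain ⟨F', hF', hZ, hY⟩ := exists_isEval (r := r + 2)
    (fun j => F (Z j) + if j = i then e * e' else 0) (fun j => F (Y j))
    (fun j => add_mem (hF1.1 j) (by split_ifs; exacts [hmem, zero_mem _])) hF1.2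
  have key : ∀ a, F' a = F a + e * e' * F (pderivZ i a) := by
    intro a
    induction a using induction_left with
    | one => simp
    | add a b ha hb => simp only [map_add, ha, hb, mul_add]; abel
    | smul c a ha => simp only [map_smul, ha, mul_smul_comm, smul_add]
    | Z_mul j a ha =>
      rw [map_mul, ha, hZ, pderivZ_Z_mul]
      rcases eq_or_ne j i with rfl | hj
      · simp only [if_true, map_add, map_mul, mul_add, add_mul]
        rw [← mul_assoc (F (Z j)), ← hcomm, ← mul_assoc (e * e') (e * e'), hsq,
          mul_assoc (e * e')]
        simp only [zero_mul, add_zero]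
        abel
      · simp only [hj, if_false, add_zero, map_mul, mul_add]
        rw [← mul_assoc (F (Z j)), ← hcomm, mul_assoc (e * e')]
    | Y_mul j a ha =>
      rw [map_mul, ha, hY, pderivZ_Y_mul, map_mul, map_mul, mul_add, ← mul_assoc (F (Y j)),
        ← hcomm, mul_assoc (e * e')]
  have h := key a
  rw [ha F' hF', ha F hF1, zero_add, mul_assoc] at h
  have h1 := hF.coordContract_eq_zero (j := ⟨r, by omega⟩) le_rfl (pderivZ i a)
  have h2 := hF.coordContract_eq_zero (j := ⟨r + 1, hr⟩) (Nat.le_succ r) (pderivZ i a)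
  refine eq_zero_of_gen_mul_eq_zero h2 (eq_zero_of_gen_mul_eq_zero ?_ h.symm)
  rw [coordContract_gen_mul, h1, if_neg (by simp)]
  simp

lemma scaling_mem_evalKernel {r : ℕ} (t : k) {a : Superforms k} (ha : a ∈ evalKernel k m r) :
    scaling t a ∈ evalKernel k m r := by
  intro F hF
  refine ha (F.comp (scaling t)) ⟨fun i => ?_, fun i => ?_⟩
  · rw [AlgHom.comp_apply, scaling_Z, map_smul]
    exact Submodule.smul_mem _ _ (hF.1 i)
  · rw [AlgHom.comp_apply, scaling_Y, map_smul]
    exact Submodule.smul_mem _ _ (hF.2 i)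

lemma homogeneous_zero_le : homogeneous k 0 ≤ Submodule.span k {1} := by
  refine Submodule.span_mono ?_
  rintro u hu
  cases hu
  rfl

variable [CharZero k]

/-- A superform vanishing on all evaluations with `r` Grassmann generators has weight greater
than `r`. -/
lemma evalKernel_le_weightGE {r : ℕ} (hr : r ≤ m) : evalKernel k m r ≤ weightGE k (r + 1) := by
  have : Infinite k := CharZero.infinite k
  induction r using Nat.strong_induction_on with
  | _ r ih =>
  refine le_of_inf_homogeneous_le iSup_homogeneous (fun t => (scaling t).toLinearMap)
    (fun t w a ha => scaling_of_mem_homogeneous t w ha)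
    (fun t a ha => scaling_mem_evalKernel t ha) (fun w => ?_)
  rintro a ⟨hK, hw⟩
  by_cases hrw : r < w
  · exact homogeneous_le_weightGE hrw hw
  rcases Nat.eq_zero_or_pos w with rfl | hpos
  · obtain ⟨c, rfl⟩ := Submodule.mem_span_singleton.1 (homogeneous_zero_le hw)
    obtain ⟨F, hF, -⟩ := exists_isEval (k := k) (m := m) (r := r) 0 0 (fun _ => zero_mem _)
      (fun _ => zero_mem _)
    have := hK F hF
    rw [map_smul, map_one, smul_eq_zero_iff_left one_ne_zero] at this
    rw [this, zero_smul]
    exact zero_mem _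
  · obtain ⟨s, rfl⟩ := Nat.exists_eq_succ_of_ne_zero (by omega : r ≠ 0)
    obtain ⟨n, hn⟩ := exists_euler hw
    have h := hn n le_rfl
    have hw0 : (w : k) ≠ 0 := Nat.cast_ne_zero.2 hpos.ne'
    rw [← inv_smul_smul₀ hw0 a, ← h, euler_apply]
    refine Submodule.smul_mem _ _ (Submodule.sum_mem _ fun i _ =>
      add_mem (Submodule.smul_mem _ _ ?_) ?_)
    · rcases s with _ | t
      · exact mul_mem_weightGE (r := 2) (s := 0) (Z_mem i) (mem_weightGE_zero _)
      · refine weightGE_anti (by omega) (mul_mem_weightGE (Z_mem i)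
          (ih t (by omega) (by omega) (pderivZ_mem_evalKernel (by omega) i hK)))
    · refine weightGE_anti (by omega) (mul_mem_weightGE (Y_mem i)
          (ih s (by omega) (by omega) (pderivY_mem_evalKernel (by omega) i hK)))

end Separation

/-! ### Identities and central polynomials of `G_0(m)` -/

section Central

open ExteriorAlgebra

variable {m : ℕ}

lemma ee_eq_gen (j : Fin m) : ee k m (j + 1) = gen k j := by
  rw [ee, gen]
  congr 1
  ext i
  simp [Pi.single_apply, Fin.ext_iff]

lemma gen_mem_G0 (j : Fin m) : gen k j ∈ G0 k m :=
  Submodule.subset_span ⟨1, le_rfl, fun _ => j + 1, Subsingleton.strictMono _,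
    fun _ => ⟨Nat.le_add_left 1 _, j.2⟩, by simp [ee_eq_gen]⟩

lemma gen_mul_gen_mem_G0_of_lt {i j : Fin m} (h : i < j) : gen k i * gen k j ∈ G0 k m := by
  refine Submodule.subset_span ⟨2, by omega, ![(i : ℕ) + 1, j + 1], ?_, ?_, ?_⟩
  · rw [Fin.strictMono_iff_lt_succ]
    intro a
    fin_cases a
    simpa using h
  · intro a
    fin_cases a
    · exact ⟨by simp, i.2⟩
    · exact ⟨by simp, j.2⟩
  · simp [ee_eq_gen]

lemma gen_mul_gen_mem_G0 (i j : Fin m) : gen k i * gen k j ∈ G0 k m := by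
  rcases lt_trichotomy i j with h | rfl | h
  · exact gen_mul_gen_mem_G0_of_lt h
  · rw [gen_mul_gen_self]
    exact zero_mem _
  · rw [gen, gen, ι_mul_eq, involution_ι, neg_mul]
    exact neg_mem (gen_mul_gen_mem_G0_of_lt h)

lemma genSpan_le_G0 (r : ℕ) : genSpan k m r ≤ G0 k m := by
  refine Submodule.span_le.2 ?_
  rintro _ ⟨j, -, rfl⟩
  exact gen_mem_G0 j

lemma genSpan_mul_le_G0 (r : ℕ) : genSpan k m r * genSpan k m r ≤ G0 k m := by
  rw [genSpan, Submodule.span_mul_span]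
  refine Submodule.span_le.2 ?_
  rintro _ ⟨_, ⟨i, -, rfl⟩, _, ⟨j, -, rfl⟩, rfl⟩
  exact gen_mul_gen_mem_G0 i j

lemma IsEval.map_parity {r : ℕ} {F : Superforms k →ₐ[k] ExteriorAlgebra k (Fin m → k)}
    (hF : IsEval r F) (a : Superforms k) : F (parity a) = involution (F a) := by
  induction a using induction_left with
  | one => simp
  | add a b ha hb => simp [ha, hb]
  | smul c a ha => simp [ha]
  | Z_mul j a ha =>
    rw [map_mul, parity_Z, map_mul, ha, map_mul, map_mul, involution_of_mem_genSpan_mul (hF.1 j)]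
  | Y_mul j a ha =>
    rw [map_mul, parity_Y, map_mul, ha, map_neg, map_mul, map_mul,
      involution_of_mem_genSpan (hF.2 j)]

lemma mem_F0_of_subst {ψ : FreeAlgebra k ℕ →ₐ[k] FreeAlgebra k ℕ}
    (hψ : ∀ i, ψ (FreeAlgebra.ι k i) ∈ F0 k) {f : FreeAlgebra k ℕ} (hf : f ∈ F0 k) :
    ψ f ∈ F0 k := by
  have : F0 k ≤ (F0 k).comap ψ.toLinearMap := by
    refine Submodule.span_le.2 ?_
    rintro _ ⟨a, i, b, rfl⟩
    simp only [SetLike.mem_coe, Submodule.mem_comap, AlgHom.toLinearMap_apply, map_mul]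
    exact F0_mul_mem (hψ i) _ _
  exact this hf

lemma augIdeal_pow_eq_bot_of_lt {w : ℕ} (h : m < w) : augIdeal k (Fin m → k) ^ w = ⊥ := by
  obtain ⟨c, rfl⟩ := Nat.exists_eq_add_of_le (Nat.succ_le_of_lt h)
  rw [pow_add, Nat.succ_eq_add_one, augIdeal_pow_eq_bot, Submodule.bot_mul]

lemma eq_zero_of_mem_weightGE {F : Superforms k →ₐ[k] ExteriorAlgebra k (Fin m → k)}
    (hZ : ∀ i, F (Z i) ∈ augIdeal k (Fin m → k) ^ 2) (hY : ∀ i, F (Y i) ∈ augIdeal k (Fin m → k))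
    {a : Superforms k} (ha : a ∈ weightGE k (m + 1)) : F a = 0 := by
  refine weightGE_induction (P := LinearMap.ker F.toLinearMap) (fun w u hw hu => ?_) ha
  have := hu.map_mem hZ hY
  rwa [augIdeal_pow_eq_bot_of_lt hw] at this

lemma mul_eq_zero_of_mem_weightGE {F : Superforms k →ₐ[k] ExteriorAlgebra k (Fin m → k)}
    (hZ : ∀ i, F (Z i) ∈ augIdeal k (Fin m → k) ^ 2) (hY : ∀ i, F (Y i) ∈ augIdeal k (Fin m → k))
    {a : Superforms k} (ha : a ∈ weightGE k m) {b : ExteriorAlgebra k (Fin m → k)}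
    (hb : b ∈ augIdeal k (Fin m → k)) : F a * b = 0 := by
  refine weightGE_induction (P := LinearMap.ker (LinearMap.mulRight k b ∘ₗ F.toLinearMap))
    (fun w u hw hu => ?_) ha
  have := Submodule.mul_mem_mul (hu.map_mem hZ hY) hb
  rwa [← pow_succ, augIdeal_pow_eq_bot_of_lt (Nat.lt_succ_of_le hw)] at this

/-- `T(G_0(m))` as a submodule. -/
def identities (k : Type*) [Field k] (m : ℕ) : Submodule k (FreeAlgebra k ℕ) where
  carrier := T0 k m
  add_mem' ha hb := ⟨add_mem ha.1 hb.1, fun φ hφ => by rw [map_add, ha.2 φ hφ, hb.2 φ hφ, add_zero]⟩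
  zero_mem' := ⟨zero_mem _, fun φ _ => map_zero φ⟩
  smul_mem' c _ ha :=
    ⟨Submodule.smul_mem _ c ha.1, fun φ hφ => by rw [map_smul, ha.2 φ hφ, smul_zero]⟩

/-- `CP(G_0(m))` as a submodule. -/
def centralPolys (k : Type*) [Field k] (m : ℕ) : Submodule k (FreeAlgebra k ℕ) where
  carrier := CP0 k m
  add_mem' ha hb := ⟨add_mem ha.1 hb.1, fun φ hφ a h => by
    rw [map_add, add_mul, mul_add, ha.2 φ hφ a h, hb.2 φ hφ a h]⟩
  zero_mem' := ⟨zero_mem _, fun φ _ a _ => by rw [map_zero, zero_mul, mul_zero]⟩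
  smul_mem' c _ ha := ⟨Submodule.smul_mem _ c ha.1, fun φ hφ a h => by
    rw [map_smul, smul_mul_assoc, mul_smul_comm, ha.2 φ hφ a h]⟩

lemma identities_le_centralPolys : identities k m ≤ centralPolys k m := fun _ hf =>
  ⟨hf.1, fun φ hφ a _ => by rw [hf.2 φ hφ, zero_mul, mul_zero]⟩

lemma exists_freeScaling (t : k) : ∃ ψ : FreeAlgebra k ℕ →ₐ[k] FreeAlgebra k ℕ,
    ∀ i, ψ (FreeAlgebra.ι k i) = t • FreeAlgebra.ι k i :=
  ⟨FreeAlgebra.lift k fun i => t • FreeAlgebra.ι k i, fun i => by simp⟩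

lemma subst_mem_centralPolys {ψ : FreeAlgebra k ℕ →ₐ[k] FreeAlgebra k ℕ} {t : k}
    (hψ : ∀ i, ψ (FreeAlgebra.ι k i) = t • FreeAlgebra.ι k i) {f : FreeAlgebra k ℕ}
    (hf : f ∈ centralPolys k m) : ψ f ∈ centralPolys k m := by
  refine ⟨mem_F0_of_subst (fun i => ?_) hf.1, fun φ hφ => hf.2 (φ.comp ψ) fun i => ?_⟩
  · rw [hψ]
    exact Submodule.smul_mem _ _ (ι_mem_F0 i)
  · rw [AlgHom.comp_apply, xx, hψ, map_smul]
    exact Submodule.smul_mem _ _ (hφ i)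

lemma map_of_mem_homogeneousFree {ψ : FreeAlgebra k ℕ →ₐ[k] FreeAlgebra k ℕ} {t : k}
    (hψ : ∀ i, ψ (FreeAlgebra.ι k i) = t • FreeAlgebra.ι k i) (n : ℕ) {f : FreeAlgebra k ℕ}
    (hf : f ∈ homogeneousFree k n) : ψ f = t ^ n • f := by
  induction n generalizing f with
  | zero =>
    obtain ⟨c, rfl⟩ := Submodule.mem_span_singleton.1 hf
    simp
  | succ n ih =>
    induction hf using Submodule.span_induction with
    | mem u hu =>
      obtain ⟨i, w, hw, rfl⟩ := hu
      rw [map_mul, hψ, ih hw, smul_mul_smul_comm, ← pow_succ']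
    | zero => simp
    | add x y _ _ hx hy => rw [map_add, hx, hy, smul_add]
    | smul c x _ hx => rw [map_smul, hx, smul_comm]

lemma iSup_homogeneousFree : ⨆ n, homogeneousFree k n = ⊤ := by
  refine eq_top_iff.2 fun a _ => ?_
  induction a using FreeAlgebra.induction_left with
  | one => exact Submodule.mem_iSup_of_mem 0 (Submodule.mem_span_singleton_self 1)
  | add a b ha hb => exact add_mem (ha trivial) (hb trivial)
  | smul c a ha => exact Submodule.smul_mem _ _ (ha trivial)
  | ι_mul i a ha =>
    have : ⨆ n, homogeneousFree k n ≤
        (⨆ n, homogeneousFree k n).comap (LinearMap.mulLeft k (FreeAlgebra.ι k i)) :=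
      iSup_le fun n w hw =>
        Submodule.mem_iSup_of_mem (n + 1) (Submodule.subset_span ⟨i, w, hw, rfl⟩)
    exact this (ha trivial)

lemma generic_mem_weightGE {f : FreeAlgebra k ℕ} (hf : f ∈ F0 k) : generic f ∈ weightGE k 1 := by
  have : F0 k ≤ (weightGE k 1).comap generic.toLinearMap := by
    refine Submodule.span_le.2 ?_
    rintro _ ⟨a, i, b, rfl⟩
    simp only [SetLike.mem_coe, Submodule.mem_comap, AlgHom.toLinearMap_apply, map_mul]
    refine mul_mem_weightGE (r := 1) (s := 0) (mul_mem_weightGE (r := 0) (s := 1)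
      (mem_weightGE_zero _) ?_) (mem_weightGE_zero _)
    rw [generic_ι]
    exact add_mem (weightGE_anti (by omega) (Z_mem i)) (Y_mem i)
  exact this hf

lemma eq_zero_of_mem_F0 {f : FreeAlgebra k ℕ} (hf : f ∈ F0 k) (h : f ∈ homogeneousFree k 0) :
    f = 0 := by
  obtain ⟨c, rfl⟩ := Submodule.mem_span_singleton.1 h
  have : F0 k ≤ LinearMap.ker (FreeAlgebra.lift k (0 : ℕ → k)).toLinearMap := by
    refine Submodule.span_le.2 ?_
    rintro _ ⟨a, i, b, rfl⟩
    simp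
  have := this hf
  rw [LinearMap.mem_ker, AlgHom.toLinearMap_apply, map_smul, map_one, smul_eq_mul, mul_one] at this
  rw [this, zero_smul]

lemma commutatorSpan_le_F0 : commutatorSpan k ≤ F0 k := by
  refine Submodule.span_le.2 ?_
  rintro _ ⟨a, ha, b, hb, rfl⟩
  have h1 := F0_mul_mem ha 1 b
  have h2 := F0_mul_mem hb 1 a
  rw [one_mul] at h1 h2
  exact sub_mem h1 h2

variable [CharZero k]

lemma mem_identities {f : FreeAlgebra k ℕ} (hf : f ∈ F0 k)
    (h : generic f ∈ weightGE k (m + 1)) : f ∈ identities k m := by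
  refine ⟨hf, fun φ hφ => ?_⟩
  obtain ⟨F, hFφ, -, hZ, hY⟩ := exists_factorization fun i => G0_le_augIdeal m (hφ i)
  rw [← hFφ, eq_zero_of_mem_weightGE hZ hY h]

lemma mem_centralPolys {f : FreeAlgebra k ℕ} (hf : f ∈ F0 k)
    (h : odd (generic f) ∈ weightGE k m) : f ∈ centralPolys k m := by
  refine ⟨hf, fun φ hφ a ha => ?_⟩
  obtain ⟨F, hFφ, hinv, hZ, hY⟩ := exists_factorization fun i => G0_le_augIdeal m (hφ i)
  have ha := G0_le_augIdeal m ha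
  have h1 : F (odd (generic f)) * a = 0 := mul_eq_zero_of_mem_weightGE hZ hY h ha
  have h2 : a * F (odd (generic f)) = 0 := by
    have h3 : involution a ∈ augIdeal k (Fin m → k) := by
      simpa using sub_mem ha (sub_involution_mem a)
    have h4 := mul_eq_of_involution_eq_neg (u := F (odd (generic f)))
      (by rw [← hinv, parity_odd, map_neg]) (involution a)
    rw [involution_involution] at h4
    rw [← h4, mul_eq_zero_of_mem_weightGE hZ hY h h3]
  have h5 := mul_comm_of_involution_eq (u := F (even (generic f))) (by rw [← hinv, parity_even]) a
  rw [← hFφ, ← even_add_odd (generic f), map_add, add_mul, mul_add, h1, h2, h5]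

lemma odd_generic_mem_weightGE (hm : 1 ≤ m) {f : FreeAlgebra k ℕ} (hf : f ∈ centralPolys k m) :
    odd (generic f) ∈ weightGE k m := by
  obtain ⟨r, rfl⟩ := Nat.exists_eq_succ_of_ne_zero (by omega : m ≠ 0)
  refine evalKernel_le_weightGE (m := r + 1) (Nat.le_succ r) fun F hF => ?_
  set e := gen k (⟨r, Nat.lt_succ_self r⟩ : Fin (r + 1)) with he
  have h := hf.2 (F.comp generic) (fun i => ?_) e (gen_mem_G0 _)
  · have h1 := mul_comm_of_involution_eq (u := F (even (generic f)))
      (by rw [← hF.map_parity, parity_even]) e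
    have h2 : e * F (odd (generic f)) = -(F (odd (generic f)) * e) := by
      rw [he, gen, ι_mul_eq, ← hF.map_parity, parity_odd, map_neg, neg_mul]
    rw [AlgHom.comp_apply, ← even_add_odd (generic f), map_add, add_mul, mul_add, h1,
      add_right_inj] at h
    rw [h] at h2
    exact eq_zero_of_gen_mul_eq_zero
      (hF.coordContract_eq_zero (j := ⟨r, Nat.lt_succ_self r⟩) le_rfl _)
      (eq_zero_of_eq_neg (k := k) h2)
  · rw [AlgHom.comp_apply, xx, generic_ι, map_add]
    exact add_mem (genSpan_mul_le_G0 _ (hF.1 i)) (genSpan_le_G0 _ (hF.2 i))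

lemma circSpan_weights (j : ℕ) : ∀ q ∈ circSpan k (j + 1),
    even (generic q) ∈ weightGE k (2 * j + 2) ∧ odd (generic q) ∈ weightGE k (2 * j + 1) := by
  have base : ∀ q ∈ F0 k, even (generic q) ∈ weightGE k 2 ∧ odd (generic q) ∈ weightGE k 1 :=
    fun q hq => ⟨even_mem_succ odd_one (generic_mem_weightGE hq), odd_mem (generic_mem_weightGE hq)⟩
  induction j with
  | zero => rwa [circSpan_one]
  | succ j ih =>
    suffices h : circSpan k (j + 2) ≤
        (weightGE k (2 * (j + 1) + 2)).comap (even ∘ₗ generic.toLinearMap) ⊓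
          (weightGE k (2 * (j + 1) + 1)).comap (odd ∘ₗ generic.toLinearMap) from fun q hq => h hq
    refine Submodule.span_le.2 ?_
    rintro _ ⟨q, hq, a, ha, rfl⟩
    obtain ⟨hq1, hq2⟩ := ih q hq
    obtain ⟨ha1, ha2⟩ := base a ha
    constructor
    · simp only [SetLike.mem_coe, Submodule.mem_comap, LinearMap.comp_apply,
        AlgHom.toLinearMap_apply]
      rw [map_add generic, map_mul, map_mul, even_anticommutator]
      exact Submodule.smul_mem _ _ (weightGE_anti (by omega) (mul_mem_weightGE hq1 ha1))
    · simp only [SetLike.mem_coe, Submodule.mem_comap, LinearMap.comp_apply,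
        AlgHom.toLinearMap_apply]
      rw [map_add generic, map_mul, map_mul, odd_anticommutator]
      exact Submodule.smul_mem _ _ (add_mem (weightGE_anti (by omega) (mul_mem_weightGE hq1 ha2))
        (weightGE_anti (by omega) (mul_mem_weightGE ha1 hq2)))

lemma circSpan_le_F0 (j : ℕ) : circSpan k (j + 1) ≤ F0 k := by
  rw [← circSpan_one]
  exact antitone_nat_of_succ_le (f := circSpan k) circSpan_succ_le (by omega)

lemma commutatorSpan_le_centralPolys : commutatorSpan k ≤ centralPolys k m := by
  intro c hc
  refine mem_centralPolys (commutatorSpan_le_F0 hc) ?_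
  suffices h : commutatorSpan k ≤ LinearMap.ker (odd ∘ₗ generic.toLinearMap) by
    have := h hc
    rw [LinearMap.mem_ker, LinearMap.comp_apply, AlgHom.toLinearMap_apply] at this
    rw [this]
    exact zero_mem _
  refine Submodule.span_le.2 ?_
  rintro _ ⟨a, -, b, -, rfl⟩
  simp only [SetLike.mem_coe, LinearMap.mem_ker, LinearMap.comp_apply, AlgHom.toLinearMap_apply]
  rw [map_sub, map_mul, map_mul, commutator_eq, map_smul, odd_mul, even_of_odd (parity_odd _),
    even_of_odd (parity_odd _)]
  simp

lemma circSpan_le_centralPolys (hm : ¬Even m) : circSpan k ((m + 1) / 2) ≤ centralPolys k m := by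
  obtain ⟨j, rfl⟩ := Nat.not_even_iff_odd.1 hm
  rw [show (2 * j + 1 + 1) / 2 = j + 1 by omega]
  exact fun q hq => mem_centralPolys (circSpan_le_F0 j hq) (circSpan_weights j q hq).2

lemma exists_sub_commutator (hm : 1 ≤ m) {n : ℕ} {f : FreeAlgebra k ℕ}
    (hf : f ∈ centralPolys k m) (hn : f ∈ homogeneousFree k n) :
    ∃ c ∈ commutatorSpan k, even (generic (f - c)) ∈ weightGE k (m + 1) := by
  rcases Nat.eq_zero_or_pos n with rfl | hpos
  · refine ⟨0, zero_mem _, ?_⟩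
    rw [eq_zero_of_mem_F0 hf.1 hn]
    simp
  have hn0 : (n : k) ≠ 0 := Nat.cast_ne_zero.2 hpos.ne'
  obtain ⟨c, hc, h⟩ := exists_commutatorSpan (contract (even (generic f)))
  refine ⟨(n : k)⁻¹ • c, Submodule.smul_mem _ _ hc, ?_⟩
  rw [even_of_even (by rw [parity_d, parity_contract, parity_even, map_neg, neg_neg])] at h
  have hom := homotopy_even_generic n hn
  have hco := contract_mem (odd_generic_mem_weightGE hm hf)
  rw [← h] at hom
  have hce : even (generic c) = generic c := by
    rw [h, even_of_even (by rw [parity_d, parity_contract, parity_even, map_neg, neg_neg])]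
  rw [map_sub, map_sub, map_smul, map_smul, hce, ← inv_smul_smul₀ hn0 (even (generic f)), ← hom,
    ← smul_sub, add_sub_cancel_left]
  exact Submodule.smul_mem _ _ hco

lemma homogeneous_even_le (hm : 1 ≤ m) (he : Even m) (n : ℕ) :
    centralPolys k m ⊓ homogeneousFree k n ≤ commutatorSpan k ⊔ identities k m := by
  rintro f ⟨hf, hn⟩
  obtain ⟨c, hc, h⟩ := exists_sub_commutator hm hf hn
  rw [← add_sub_cancel c f]
  have hfc := sub_mem hf (commutatorSpan_le_centralPolys hc)
  refine Submodule.add_mem_sup hc (mem_identities hfc.1 ?_)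
  rw [← even_add_odd (generic (f - c))]
  have ho := odd_mem_succ he (odd_generic_mem_weightGE hm hfc)
  rw [odd_of_odd (parity_odd _)] at ho
  exact add_mem h ho

lemma homogeneous_odd_le (hm : 1 ≤ m) (he : ¬Even m) (n : ℕ) :
    centralPolys k m ⊓ homogeneousFree k n ≤
      commutatorSpan k ⊔ circSpan k ((m + 1) / 2) ⊔ identities k m := by
  rintro f ⟨hf, hn⟩
  obtain ⟨c, hc, h⟩ := exists_sub_commutator hm hf hn
  have hfc := sub_mem hf (commutatorSpan_le_centralPolys hc)
  have h2 : 2 * ((m + 1) / 2) = m + 1 := by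
    obtain ⟨j, rfl⟩ := Nat.not_even_iff_odd.1 he
    omega
  rw [← h2] at h
  obtain ⟨g, hg, hgf⟩ := exists_circSpan_of_even h (parity_even _)
  have hfg := sub_mem hfc (circSpan_le_centralPolys he hg)
  have h0 : even (generic (f - c - g)) = 0 := by rw [map_sub generic, map_sub, hgf, sub_self]
  rw [show f = c + g + (f - c - g) by abel]
  refine Submodule.add_mem_sup (Submodule.add_mem_sup hc hg) (mem_identities hfg.1 ?_)
  rw [← even_add_odd (generic (f - c - g)), ← d_even_generic, h0, map_zero, add_zero]
  exact zero_mem _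

lemma centralPolys_le {Q : Submodule k (FreeAlgebra k ℕ)}
    (h : ∀ n, centralPolys k m ⊓ homogeneousFree k n ≤ Q) : centralPolys k m ≤ Q := by
  have : Infinite k := CharZero.infinite k
  choose ψ hψ using exists_freeScaling (k := k)
  exact le_of_inf_homogeneous_le iSup_homogeneousFree (fun t => (ψ t).toLinearMap)
    (fun t n f hf => map_of_mem_homogeneousFree (hψ t) n hf)
    (fun t f hf => subst_mem_centralPolys (hψ t) hf) h

lemma centralPolys_of_even (hm : 1 ≤ m) (he : Even m) :
    centralPolys k m = commutatorSpan k ⊔ identities k m :=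
  le_antisymm (centralPolys_le (homogeneous_even_le hm he))
    (sup_le commutatorSpan_le_centralPolys identities_le_centralPolys)

lemma centralPolys_of_not_even (hm : 1 ≤ m) (he : ¬Even m) :
    centralPolys k m = commutatorSpan k ⊔ circSpan k ((m + 1) / 2) ⊔ identities k m :=
  le_antisymm (centralPolys_le (homogeneous_odd_le hm he))
    (sup_le (sup_le commutatorSpan_le_centralPolys (circSpan_le_centralPolys he))
      identities_le_centralPolys)

end Central

/-! ### Generators of the T-spaces -/

lemma circFold_succ {A : Type*} [Ring A] (f : ℕ → A) (n : ℕ) :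
    circFold f (n + 2) = circFold f (n + 1) * f (n + 2) + f (n + 2) * circFold f (n + 1) := by
  simp [circFold, List.range_succ]

lemma map_circFold {A B : Type*} [Ring A] [Ring B] (φ : A →+* B) (f : ℕ → A) (n : ℕ) :
    φ (circFold f (n + 1)) = circFold (fun i => φ (f i)) (n + 1) := by
  induction n with
  | zero => rfl
  | succ n ih => rw [circFold_succ, circFold_succ, map_add, map_mul, map_mul, ih]

lemma circFold_congr {A : Type*} [Ring A] {f g : ℕ → A} {n : ℕ} (h : ∀ i ≤ n + 1, f i = g i) :
    circFold f (n + 1) = circFold g (n + 1) := by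
  induction n with
  | zero => exact h 1 le_rfl
  | succ n ih => rw [circFold_succ, circFold_succ, ih fun i hi => h i (by omega), h _ le_rfl]

lemma circSpan_eq_span [CharZero k] (n : ℕ) : circSpan k (n + 1) =
    Submodule.span k {u | ∃ f : ℕ → FreeAlgebra k ℕ, (∀ i, f i ∈ F0 k) ∧
      u = circFold f (n + 1)} := by
  induction n with
  | zero =>
    rw [circSpan_one]
    refine le_antisymm (fun a ha => ?_) (Submodule.span_le.2 ?_)
    · exact Submodule.subset_span ⟨fun _ => a, fun _ => ha, rfl⟩
    · rintro _ ⟨f, hf, rfl⟩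
      exact hf 1
  | succ n ih =>
    refine le_antisymm (Submodule.span_le.2 ?_) (Submodule.span_le.2 ?_)
    · rintro _ ⟨q, hq, a, ha, rfl⟩
      rw [ih] at hq
      rw [SetLike.mem_coe]
      induction hq using Submodule.span_induction with
      | mem u hu =>
        obtain ⟨f, hf, rfl⟩ := hu
        refine Submodule.subset_span ⟨fun i => if i = n + 2 then a else f i, fun i => ?_, ?_⟩
        · dsimp only
          split_ifs
          exacts [ha, hf i]
        · rw [circFold_succ, if_pos rfl,
            circFold_congr (g := f) fun i hi => if_neg (by omega : i ≠ n + 2)]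
      | zero => simp
      | add x y _ _ hx hy =>
        rw [add_mul, mul_add, add_add_add_comm]
        exact add_mem hx hy
      | smul c x _ hx =>
        rw [smul_mul_assoc, mul_smul_comm, ← smul_add]
        exact Submodule.smul_mem _ c hx
    · rintro _ ⟨f, hf, rfl⟩
      rw [circFold_succ]
      exact anticommutator_mem (ih ▸ Submodule.subset_span ⟨f, hf, rfl⟩) (hf _)

lemma setOf_commutator_eq : {u : FreeAlgebra k ℕ | ∃ a ∈ F0 k, ∃ b ∈ F0 k, u = a * b - b * a} =
    {y | ∃ ψ : FreeAlgebra k ℕ →ₐ[k] FreeAlgebra k ℕ, (∀ i, ψ (xx k i) ∈ F0 k) ∧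
      y = ψ (brk (xx k 1) (xx k 2))} := by
  ext u
  constructor
  · rintro ⟨a, ha, b, hb, rfl⟩
    refine ⟨FreeAlgebra.lift k fun i => if i = 1 then a else b, fun i => ?_, by simp [brk, xx]⟩
    rw [xx, FreeAlgebra.lift_ι_apply]
    split_ifs
    exacts [ha, hb]
  · rintro ⟨ψ, hψ, rfl⟩
    exact ⟨_, hψ 1, _, hψ 2, by simp [brk]⟩

lemma setOf_circFold_eq (n : ℕ) :
    {u : FreeAlgebra k ℕ | ∃ f : ℕ → FreeAlgebra k ℕ, (∀ i, f i ∈ F0 k) ∧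
      u = circFold f (n + 1)} =
    {y | ∃ ψ : FreeAlgebra k ℕ →ₐ[k] FreeAlgebra k ℕ, (∀ i, ψ (xx k i) ∈ F0 k) ∧
      y = ψ (circFold (xx k) (n + 1))} := by
  ext u
  constructor
  · rintro ⟨f, hf, rfl⟩
    refine ⟨FreeAlgebra.lift k f, fun i => ?_, ?_⟩
    · rw [xx, FreeAlgebra.lift_ι_apply]
      exact hf i
    · refine ((map_circFold (FreeAlgebra.lift k f).toRingHom (xx k) n).trans ?_).symm
      exact circFold_congr fun i _ => FreeAlgebra.lift_ι_apply f i
  · rintro ⟨ψ, hψ, rfl⟩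
    exact ⟨fun i => ψ (xx k i), hψ, map_circFold ψ.toRingHom (xx k) n⟩

lemma CP0_of_even [CharZero k] {m : ℕ} (hm : 1 ≤ m) (he : Even m) : CP0 k m =
    (↑(Submodule.span k {y : FreeAlgebra k ℕ |
      ∃ ψ : FreeAlgebra k ℕ →ₐ[k] FreeAlgebra k ℕ, (∀ i, ψ (xx k i) ∈ F0 k) ∧
        y = ψ (brk (xx k 1) (xx k 2))}) : Set (FreeAlgebra k ℕ)) + T0 k m := by
  rw [← setOf_commutator_eq]
  exact (congrArg SetLike.coe (centralPolys_of_even (k := k) hm he)).trans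
    (Submodule.coe_sup _ _)

lemma CP0_of_not_even [CharZero k] {m : ℕ} (hm : 1 ≤ m) (he : ¬Even m) : CP0 k m =
    (↑(Submodule.span k {y : FreeAlgebra k ℕ |
      ∃ ψ : FreeAlgebra k ℕ →ₐ[k] FreeAlgebra k ℕ, (∀ i, ψ (xx k i) ∈ F0 k) ∧
        (y = ψ (brk (xx k 1) (xx k 2)) ∨
          y = ψ (circFold (xx k) ((m + 1) / 2)))}) : Set (FreeAlgebra k ℕ)) + T0 k m := by
  obtain ⟨n, hn⟩ : ∃ n, (m + 1) / 2 = n + 1 := ⟨(m + 1) / 2 - 1, by omega⟩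
  have h := centralPolys_of_not_even (k := k) hm he
  rw [hn, circSpan_eq_span, setOf_circFold_eq, commutatorSpan, setOf_commutator_eq,
    ← Submodule.span_union] at h
  rw [hn]
  refine (congrArg SetLike.coe h).trans ((Submodule.coe_sup _ _).trans ?_)
  congr 3
  ext y
  simp only [Set.mem_union, Set.mem_ofPred_eq, ← exists_or, ← and_or_left]

end Superforms

end Superforms

/-- Let `k` be a field of characteristic `0` and `m ≥ 1`.  Then
`CP(G_0(m)) = S(m) + T(G_0(m))`, where `S(m)` is the nonunitary T-space generated by
`[x_1,x_2]` if `m` is even, and by `[x_1,x_2]` and `x_1 ∘ ⋯ ∘ x_{(m+1)/2}` if `m` is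
odd. -/
theorem stmt14 (k : Type*) [Field k] [CharZero k] (m : ℕ) (hm : 1 ≤ m) :
    (Even m →
      CP0 k m =
        (↑(Submodule.span k {y : FreeAlgebra k ℕ |
            ∃ ψ : FreeAlgebra k ℕ →ₐ[k] FreeAlgebra k ℕ, (∀ i, ψ (xx k i) ∈ F0 k) ∧
              y = ψ (brk (xx k 1) (xx k 2))}) : Set (FreeAlgebra k ℕ)) + T0 k m) ∧
    (¬ Even m →
      CP0 k m =
        (↑(Submodule.span k {y : FreeAlgebra k ℕ |
            ∃ ψ : FreeAlgebra k ℕ →ₐ[k] FreeAlgebra k ℕ, (∀ i, ψ (xx k i) ∈ F0 k) ∧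
              (y = ψ (brk (xx k 1) (xx k 2)) ∨
                y = ψ (circFold (xx k) ((m + 1) / 2)))}) : Set (FreeAlgebra k ℕ))
          + T0 k m) :=
  ⟨Superforms.CP0_of_even hm, Superforms.CP0_of_not_even hm⟩

end
end

section
/- Let k be a field of characteristic 0, let m ≥ 2 be an integer, and set b_m = ⌊m/2⌋ + 1. Then CP(G_0(m)) equals the nonunitary T-space of F_0 generated by the four elements [x_1, x_2], [x_1, x_2][x_3, x_4], x_1 ∘ x_2 ∘ ⋯ ∘ x_{b_m}, and (x_1 ∘ x_2 ∘ ⋯ ∘ x_{b_m}) · x_{b_m+1}. -/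
noncomputable section

universe u

section Jordan

variable (k : Type*) [Field k] {A : Type*} [Ring A] [Algebra k A]

/-- The normalised Jordan product `(a b + b a) / 2` as a bilinear map. -/
def jmul : A →ₗ[k] A →ₗ[k] A := (2⁻¹ : k) • (LinearMap.mul k A + (LinearMap.mul k A).flip)

/-- Half of the commutator. -/
def hbrk (a b : A) : A := (2⁻¹ : k) • brk a b

lemma jmul_apply (a b : A) : jmul k a b = (2⁻¹ : k) • (a * b + b * a) := by
  simp [jmul]

lemma jmul_comm (a b : A) : jmul k a b = jmul k b a := by
  rw [jmul_apply, jmul_apply, add_comm]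

lemma mul_eq_jmul_add_hbrk [CharZero k] (a b : A) : a * b = jmul k a b + hbrk k a b := by
  rw [jmul_apply, hbrk, ← smul_add, brk, show a * b + b * a + (a * b - b * a) = (2 : k) • (a * b) by
    rw [two_smul]; abel, smul_smul, inv_mul_cancel₀ two_ne_zero, one_smul]

lemma hbrk_swap (a b : A) : hbrk k a b = -hbrk k b a := by
  rw [hbrk, hbrk, ← smul_neg, brk, brk, neg_sub]

lemma hbrk_jmul (b a w : A) :
    hbrk k b (jmul k a w) = jmul k (hbrk k b a) w + jmul k a (hbrk k b w) := by
  simp only [jmul_apply, hbrk, brk, mul_smul_comm, smul_mul_assoc, ← smul_add, ← smul_sub]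
  congr 2
  noncomm_ring

variable {k}

/-- Every commutator is central (Lie nilpotency of class two). -/
def LieNilTwo (A : Type*) [Ring A] : Prop := ∀ a b c : A, brk (brk a b) c = 0

lemma LieNilTwo.brk_mul (h3 : LieNilTwo A) (a b c : A) : brk a b * c = c * brk a b :=
  sub_eq_zero.1 (h3 a b c)

lemma LieNilTwo.brk_mul_brk (h3 : LieNilTwo A) (a b c z : A) :
    brk c a * brk b z = -(brk c b * brk a z) := by
  have h := h3 (a * b) c z
  have e : brk (brk (a * b) c) z = a * brk (brk b c) z + brk (brk a c) z * b
      + brk a z * brk b c + brk a c * brk b z := by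
    simp only [brk]; noncomm_ring
  rw [e, h3, h3, mul_zero, zero_mul, zero_add, zero_add] at h
  have e1 : brk c a = -brk a c := by simp [brk]
  have e2 : brk c b = -brk b c := by simp [brk]
  rw [e1, e2, neg_mul, neg_mul, neg_neg, h3.brk_mul b c, neg_eq_iff_add_eq_zero, add_comm, h]

lemma jmul_assoc (h3 : LieNilTwo A) (a b c : A) :
    jmul k (jmul k a b) c = jmul k a (jmul k b c) := by
  simp only [jmul_apply, mul_smul_comm, smul_mul_assoc, ← smul_add]
  congr 2
  have h := h3 a c b
  rw [← sub_eq_zero]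
  rw [← neg_eq_zero] at h
  rw [← h]
  simp only [brk]; noncomm_ring

lemma jmul_left_comm (h3 : LieNilTwo A) (a b c : A) :
    jmul k a (jmul k b c) = jmul k b (jmul k a c) := by
  rw [← jmul_assoc h3, jmul_comm k a b, jmul_assoc h3]

lemma hbrk_mul_eq [CharZero k] (h3 : LieNilTwo A) (b a w : A) :
    hbrk k b (a * w) = jmul k (hbrk k b a) w + jmul k a (hbrk k b w) := by
  rw [mul_eq_jmul_add_hbrk k a w, ← hbrk_jmul]
  have : brk b (brk a w) = 0 := by
    rw [brk, h3.brk_mul, sub_self]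
  have h2 : hbrk k b (hbrk k a w) = 0 := by
    simp only [hbrk, brk, mul_smul_comm, smul_mul_assoc, ← smul_sub] at this ⊢
    rw [this]; simp
  have h4 : hbrk k b (jmul k a w + hbrk k a w) = hbrk k b (jmul k a w) + hbrk k b (hbrk k a w) := by
    simp only [hbrk, ← smul_add, brk]; congr 1; noncomm_ring
  rw [h4, h2, add_zero]

lemma jmul_hbrk_hbrk (h3 : LieNilTwo A) (c a b z : A) :
    jmul k (hbrk k c a) (hbrk k b z) = -jmul k (hbrk k c b) (hbrk k a z) := by
  simp only [jmul_apply, hbrk, mul_smul_comm, smul_mul_assoc, ← smul_add, ← smul_neg]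
  congr 3
  rw [h3.brk_mul b z, h3.brk_mul a z, h3.brk_mul_brk a b c z, ← two_mul, ← two_mul, mul_neg]

variable (k) {ι : Type*} [DecidableEq ι]

/-- One step of the recursion defining `formPair`. -/
def formStep (J : Finset ι) (y : ι → A) (i : ι) (p : A × (A → A)) : A × (A → A) :=
  if i ∈ J then (p.2 (y i), fun b => jmul k (hbrk k b (y i)) p.1)
  else (jmul k (y i) p.1, fun b => jmul k (y i) (p.2 b))

/-- For a word in letters `y i`, the summand in which the letters indexed by `J` are
replaced by their differentials: the first component is the even form itself (zero if an odd number
of letters lies in `J`), the second one is `b ↦ db ∧ -` applied to the odd form. -/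
def formPair (J : Finset ι) (y : ι → A) (l : List ι) : A × (A → A) :=
  l.foldr (formStep k J y) (1, 0)

variable (J : Finset ι) (y : ι → A)

lemma formPair_cons (i : ι) (l : List ι) :
    formPair k J y (i :: l) = formStep k J y i (formPair k J y l) := rfl

lemma formStep_smul (i : ι) (s : k) (p : A × (A → A)) :
    formStep k J y i (s • p) = s • formStep k J y i p := by
  unfold formStep
  split_ifs
  · refine Prod.ext rfl ?_
    funext b
    simp
  · refine Prod.ext ?_ ?_
    · simp
    funext b
    simp

/-- The sign picked up when two letters with parities given by `J` are exchanged. -/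
def swapSign (i j : ι) : k := if i ∈ J ∧ j ∈ J then -1 else 1

/-- A function on words that is graded-symmetric with respect to the parities given by `J`. -/
def GradedSymm {M : Type*} [AddCommGroup M] [Module k M] (Φ : List ι → M) : Prop :=
  ∀ l₁ i j l₂, Φ (l₁ ++ i :: j :: l₂) = swapSign k J i j • Φ (l₁ ++ j :: i :: l₂)

variable {k}

lemma formPair_antisymm (h3 : LieNilTwo A) (c : A) (l : List ι) : ∀ a b : A,
    jmul k (hbrk k c a) ((formPair k J y l).2 b) = -jmul k (hbrk k c b) ((formPair k J y l).2 a) := by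
  induction l with
  | nil => intro a b; simp [formPair]
  | cons i l ih =>
    intro a b
    rw [formPair_cons, formStep]
    split_ifs
    · simp only
      rw [← jmul_assoc h3, jmul_hbrk_hbrk h3, map_neg, LinearMap.neg_apply, jmul_assoc h3]
    · simp only
      rw [jmul_left_comm h3, ih, map_neg, jmul_left_comm h3]

lemma formPair_gradedSymm (h3 : LieNilTwo A) : GradedSymm k J (formPair k J y) := by
  intro l₁ i j l₂
  induction l₁ with
  | cons c l₁ ih =>
    rw [List.cons_append, List.cons_append, formPair_cons, formPair_cons, ih, formStep_smul]
  | nil =>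
    simp only [List.nil_append, formPair_cons]
    have hanti := fun c => formPair_antisymm J y h3 c l₂ (k := k)
    generalize formPair k J y l₂ = p at hanti ⊢
    by_cases hi : i ∈ J <;> by_cases hj : j ∈ J
    · simp only [formStep, hi, hj, swapSign, and_self, if_true]
      refine Prod.ext ?_ (funext fun c => ?_)
      · simp only [Prod.fst_neg, neg_smul, one_smul]
        rw [hbrk_swap, map_neg, LinearMap.neg_apply]
      · simp only [Prod.snd_neg, Pi.neg_apply, neg_smul, one_smul]
        rw [hanti]
    · simp only [formStep, hi, hj, swapSign, if_true, if_false, and_false, one_smul]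
      refine Prod.ext rfl (funext fun c => ?_)
      exact jmul_left_comm h3 _ _ _
    · simp only [formStep, hi, hj, swapSign, if_true, if_false, false_and, one_smul]
      refine Prod.ext rfl (funext fun c => ?_)
      exact jmul_left_comm h3 _ _ _
    · simp only [formStep, hi, hj, swapSign, if_false, false_and, one_smul]
      refine Prod.ext (jmul_left_comm h3 _ _ _) (funext fun c => jmul_left_comm h3 _ _ _)

lemma exists_perm_sign {l l' : List ι} (h : l.Perm l') :
    ∃ s : k, ∀ (M : Type u) [AddCommGroup M] [Module k M] (Φ : List ι → M), GradedSymm k J Φ →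
      Φ l = s • Φ l' := by
  induction h with
  | nil => exact ⟨1, fun M _ _ Φ _ => by simp⟩
  | cons a _ ih =>
    obtain ⟨s, hs⟩ := ih
    refine ⟨s, fun M _ _ Φ hΦ => hs M (fun l => Φ (a :: l)) fun l₁ i j l₂ => ?_⟩
    exact hΦ (a :: l₁) i j l₂
  | swap a b l => exact ⟨swapSign k J b a, fun M _ _ Φ hΦ => hΦ [] b a l⟩
  | trans _ _ ih₁ ih₂ =>
    obtain ⟨s, hs⟩ := ih₁
    obtain ⟨t, ht⟩ := ih₂
    exact ⟨s * t, fun M _ _ Φ hΦ => by rw [hs M Φ hΦ, ht M Φ hΦ, smul_smul]⟩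

lemma formPair_insert_of_notMem {i : ι} {l : List ι} (hi : i ∉ l) :
    formPair k (insert i J) y l = formPair k J y l := by
  induction l with
  | nil => rfl
  | cons a l ih =>
    rw [List.mem_cons, not_or] at hi
    rw [formPair_cons, formPair_cons, ih hi.2, formStep, formStep]
    simp [Finset.mem_insert, Ne.symm hi.1]

lemma sum_formPair [CharZero k] (h3 : LieNilTwo A) {l : List ι} (hl : l.Nodup) :
    (∑ J ∈ l.toFinset.powerset, (formPair k J y l).1 = (l.map y).prod) ∧
    ∀ b, ∑ J ∈ l.toFinset.powerset, (formPair k J y l).2 b = hbrk k b (l.map y).prod := by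
  induction l with
  | nil => simp [formPair, hbrk, brk]
  | cons a l ih =>
    obtain ⟨ha, hl⟩ := List.nodup_cons.1 hl
    obtain ⟨ih₁, ih₂⟩ := ih hl
    have ha' : a ∉ l.toFinset := by simpa using ha
    have e₁ : ∀ J ∈ l.toFinset.powerset, formPair k J y (a :: l) =
        (jmul k (y a) (formPair k J y l).1, fun b => jmul k (y a) ((formPair k J y l).2 b)) := by
      intro J hJ
      rw [formPair_cons, formStep, if_neg fun h => ha' (Finset.mem_powerset.1 hJ h)]
    have e₂ : ∀ J, formPair k (insert a J) y (a :: l) = ((formPair k J y l).2 (y a),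
        fun b => jmul k (hbrk k b (y a)) (formPair k J y l).1) := by
      intro J
      rw [formPair_cons, formStep, if_pos (Finset.mem_insert_self _ _),
        formPair_insert_of_notMem J y ha]
    rw [List.toFinset_cons, List.map_cons, List.prod_cons]
    refine ⟨?_, fun b => ?_⟩
    · rw [Finset.sum_powerset_insert ha', Finset.sum_congr rfl fun J hJ => by rw [e₁ J hJ]]
      simp only [e₂]
      rw [← map_sum, ih₁, ih₂, ← mul_eq_jmul_add_hbrk]
    · rw [Finset.sum_powerset_insert ha', Finset.sum_congr rfl fun J hJ => by rw [e₁ J hJ]]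
      simp only [e₂]
      rw [← map_sum, ← map_sum, ih₁, ih₂, hbrk_mul_eq h3, add_comm]

end Jordan
section Powers

variable (k : Type*) [Field k] {A : Type*} [Ring A] [Algebra k A]

/-- The powers of `I` for the normalised Jordan product, with `jpow I 0 = ⊤`. -/
def jpow (I : Submodule k A) : ℕ → Submodule k A
  | 0 => ⊤
  | r + 1 => Submodule.span k {x | ∃ a ∈ I, ∃ z ∈ jpow I r, x = jmul k a z}

variable {k} {I : Submodule k A}

lemma jmul_mem_jpow {a z : A} {r : ℕ} (ha : a ∈ I) (hz : z ∈ jpow k I r) :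
    jmul k a z ∈ jpow k I (r + 1) :=
  Submodule.subset_span ⟨a, ha, z, hz, rfl⟩

lemma jpow_antitone : Antitone (jpow k I) := by
  refine antitone_nat_of_succ_le fun r => ?_
  induction r with
  | zero => exact le_top
  | succ r ih =>
    refine Submodule.span_le.2 ?_
    rintro x ⟨a, ha, z, hz, rfl⟩
    exact jmul_mem_jpow ha (ih hz)

lemma jpow_one_le (hI : ∀ a ∈ I, ∀ z, a * z ∈ I ∧ z * a ∈ I) : jpow k I 1 ≤ I := by
  refine Submodule.span_le.2 ?_
  rintro x ⟨a, ha, z, -, rfl⟩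
  rw [jmul_apply]
  exact I.smul_mem _ (I.add_mem (hI a ha z).1 (hI a ha z).2)

lemma circFold_succ (f : ℕ → A) (r : ℕ) :
    circFold f (r + 2) = circFold f (r + 1) * f (r + 2) + f (r + 2) * circFold f (r + 1) := by
  simp [circFold, List.range_succ]

lemma circFold_congr {f g : ℕ → A} {r : ℕ} (h : ∀ i ≤ r + 1, f i = g i) :
    circFold f (r + 1) = circFold g (r + 1) := by
  induction r with
  | zero => simpa [circFold] using h 1 le_rfl
  | succ r ih => rw [circFold_succ, circFold_succ, ih fun i hi => h i (by omega), h _ le_rfl]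

lemma map_circFold {B : Type*} [Ring B] (φ : A →+* B) (f : ℕ → A) (r : ℕ) :
    φ (circFold f (r + 1)) = circFold (fun i => φ (f i)) (r + 1) := by
  induction r with
  | zero => simp [circFold]
  | succ r ih => rw [circFold_succ, circFold_succ, map_add, map_mul, map_mul, ih]

lemma jpow_le_span_circFold [CharZero k] (hI : ∀ a ∈ I, ∀ z, a * z ∈ I ∧ z * a ∈ I) (r : ℕ) :
    jpow k I (r + 1) ≤
      Submodule.span k {x | ∃ f : ℕ → A, (∀ i, f i ∈ I) ∧ x = circFold f (r + 1)} := by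
  induction r with
  | zero =>
    intro x hx
    exact Submodule.subset_span ⟨fun _ => x, fun _ => jpow_one_le hI hx, rfl⟩
  | succ r ih =>
    refine Submodule.span_le.2 ?_
    rintro x ⟨a, ha, z, hz, rfl⟩
    have hz' := ih hz
    clear hz
    rw [SetLike.mem_coe]
    induction hz' using Submodule.span_induction with
    | mem z hz =>
      obtain ⟨f, hf, rfl⟩ := hz
      rw [jmul_apply]
      refine Submodule.smul_mem _ _ (Submodule.subset_span
        ⟨Function.update f (r + 2) a, fun i => ?_, ?_⟩)
      · by_cases h : i = r + 2
        · subst h; simpa using ha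
        · simpa [h] using hf i
      · rw [circFold_succ, Function.update_self, add_comm]
        rw [circFold_congr (f := Function.update f (r + 2) a) (g := f)
          fun i hi => Function.update_of_ne (by omega) _ _]
    | zero => simp
    | add x y _ _ hx hy => rw [map_add]; exact Submodule.add_mem _ hx hy
    | smul c x _ hx => rw [map_smul]; exact Submodule.smul_mem _ _ hx

variable {ι : Type*} [DecidableEq ι] (J : Finset ι) {y : ι → A}

lemma hbrk_mem (hI : ∀ a ∈ I, ∀ z, a * z ∈ I ∧ z * a ∈ I) {a : A} (ha : a ∈ I) (b : A) :
    hbrk k a b ∈ I :=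
  I.smul_mem _ (I.sub_mem (hI a ha b).1 (hI a ha b).2)

lemma formPair_mem_jpow (hI : ∀ a ∈ I, ∀ z, a * z ∈ I ∧ z * a ∈ I) (hy : ∀ i, y i ∈ I)
    (l : List ι) :
    (formPair k J y l).1 ∈ jpow k I (l.countP (· ∉ J) + l.countP (· ∈ J) / 2) ∧
    ∀ b ∈ I, (formPair k J y l).2 b ∈ jpow k I (l.countP (· ∉ J) + (l.countP (· ∈ J) + 1) / 2) := by
  induction l with
  | nil => exact ⟨by simp [jpow], fun b _ => by simp [jpow]⟩
  | cons i l ih =>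
    obtain ⟨ih₁, ih₂⟩ := ih
    rw [formPair_cons, formStep]
    by_cases hi : i ∈ J
    · simp only [hi, if_true, List.countP_cons, not_true_eq_false, decide_false, decide_true]
      refine ⟨ih₂ _ (hy i), fun b hb => ?_⟩
      refine jpow_antitone ?_ (jmul_mem_jpow (hbrk_mem hI hb (y i)) ih₁)
      simp; omega
    · simp only [hi, if_false, List.countP_cons, not_false_eq_true, decide_false, decide_true]
      refine ⟨jpow_antitone ?_ (jmul_mem_jpow (hy i) ih₁),
        fun b hb => jpow_antitone ?_ (jmul_mem_jpow (hy i) (ih₂ b hb))⟩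
      · simp; omega
      · simp; omega

lemma formPair_eq_zero (l : List ι) :
    (Odd (l.countP (· ∈ J)) → (formPair k J y l).1 = 0) ∧
    (Even (l.countP (· ∈ J)) → (formPair k J y l).2 = 0) := by
  induction l with
  | nil => exact ⟨fun h => by simp at h, fun _ => rfl⟩
  | cons i l ih =>
    obtain ⟨ih₁, ih₂⟩ := ih
    rw [formPair_cons, formStep]
    by_cases hi : i ∈ J
    · simp only [hi, if_true, List.countP_cons, decide_true, Nat.odd_add_one, Nat.even_add_one,
        Nat.not_odd_iff_even, Nat.not_even_iff_odd]
      refine ⟨fun h => by rw [ih₂ h]; rfl, fun h => funext fun b => by rw [ih₁ h, map_zero,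
        Pi.zero_apply]⟩
    · simp only [hi, if_false, List.countP_cons, decide_false, Bool.false_eq_true, add_zero]
      refine ⟨fun h => by rw [ih₁ h, map_zero],
        fun h => funext fun b => by rw [ih₂ h, Pi.zero_apply, map_zero]⟩

end Powers

section Reduction

variable {k : Type u} [Field k] [CharZero k] {A : Type u} [Ring A] [Algebra k A]

lemma sum_perm_words_mem (h3 : LieNilTwo A) {S I : Submodule k A} (hS : ∀ a b, brk a b ∈ S)
    (hI : ∀ a ∈ I, ∀ z, a * z ∈ I ∧ z * a ∈ I) {t : ℕ}
    (hcirc : ∀ f : ℕ → A, (∀ i, f i ∈ I) → circFold f (t + 1) ∈ S) {r : ℕ} {y : Fin (r + 1) → A}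
    (hy : ∀ i, y i ∈ I) (c : Equiv.Perm (Fin (r + 1)) → k)
    (l₁ l₂ : Equiv.Perm (Fin (r + 1)) → List (Fin (r + 1)))
    (hl : ∀ q : Equiv.Perm (Fin (r + 1)), List.ofFn q = l₁ q ++ 0 :: l₂ q)
    (hc : ∀ J : Finset (Fin (r + 1)), 0 ∈ J → Odd J.card → 2 * (r + 1) < J.card + 2 * t + 1 →
      ∀ s : Equiv.Perm (Fin (r + 1)) → k,
        (∀ (M : Type u) [AddCommGroup M] [Module k M] (Φ : List (Fin (r + 1)) → M),
          GradedSymm k J Φ → ∀ q : Equiv.Perm (Fin (r + 1)), Φ (l₂ q ++ l₁ q) = s q • Φ ((List.finRange r).map Fin.succ)) →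
        ∑ q, c q * s q = 0) :
    ∑ q, c q • (List.ofFn fun i => y (q i)).prod ∈ S := by
  set std := (List.finRange r).map Fin.succ with hstd
  have hperm : ∀ q, (l₂ q ++ l₁ q).Perm std := by
    intro q
    have h1 : (List.ofFn q).Perm (0 :: std) := by
      have : (0 :: std : List (Fin (r + 1))) = List.ofFn (id : Fin (r + 1) → Fin (r + 1)) := by
        rw [List.ofFn_id, List.finRange_succ]
      rw [this]
      simpa using Equiv.Perm.ofFn_comp_perm q (id : Fin (r + 1) → Fin (r + 1))
    rw [hl] at h1
    exact (List.perm_append_comm.trans ((List.perm_cons 0).1 (List.perm_middle.symm.trans h1)))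
  have hnd : std.Nodup := (List.nodup_finRange r).map (Fin.succ_injective r)
  have h0 : (0 : Fin (r + 1)) ∉ std := by simp [hstd, Fin.succ_ne_zero]
  have hrot : ∀ q : Equiv.Perm (Fin (r + 1)), (List.ofFn fun i => y (q i)).prod -
      y 0 * ((l₂ q ++ l₁ q).map y).prod ∈ S := by
    intro q
    have : (List.ofFn fun i => y (q i)) = (List.ofFn q).map y := by
      rw [List.map_ofFn]; rfl
    rw [this, hl]
    have := hS (((l₁ q).map y).prod) (y 0 * ((l₂ q).map y).prod)
    simpa [brk, mul_assoc] using this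
  have hexp : ∀ q, y 0 * ((l₂ q ++ l₁ q).map y).prod =
      ∑ J ∈ std.toFinset.powerset, y 0 * (formPair k J y (l₂ q ++ l₁ q)).1 := by
    intro q
    rw [← Finset.mul_sum, ← (sum_formPair (k := k) y h3 ((hperm q).nodup_iff.2 hnd)).1,
      List.toFinset_eq_of_perm _ _ (hperm q)]
  have hmain : ∑ q, c q • (y 0 * ((l₂ q ++ l₁ q).map y).prod) ∈ S := by
    simp_rw [hexp, Finset.smul_sum]
    rw [Finset.sum_comm]
    refine S.sum_mem fun J hJ => ?_
    have hJ' : J ⊆ std.toFinset := Finset.mem_powerset.1 hJ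
    have h0J : (0 : Fin (r + 1)) ∉ J := fun h => h0 (by simpa using hJ' h)
    choose s hs using fun q => exists_perm_sign.{u} (k := k) (insert 0 J) (hperm q)
    have h0q : ∀ q, (0 : Fin (r + 1)) ∉ l₂ q ++ l₁ q := fun q h => h0 ((hperm q).mem_iff.1 h)
    have hform : ∀ q, formPair k J y (l₂ q ++ l₁ q) = s q • formPair k J y std := by
      intro q
      have := hs q _ _ (formPair_gradedSymm (insert 0 J) y h3)
      rwa [formPair_insert_of_notMem _ _ (h0q q), formPair_insert_of_notMem _ _ h0] at this
    have : ∑ q, c q • (y 0 * (formPair k J y (l₂ q ++ l₁ q)).1) =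
        (∑ q, c q * s q) • (y 0 * (formPair k J y std).1) := by
      rw [Finset.sum_smul]
      refine Finset.sum_congr rfl fun q _ => ?_
      rw [hform, Prod.smul_fst, mul_smul_comm, smul_smul]
    rw [this]
    have hcount : std.countP (· ∈ J) = J.card := by
      rw [List.countP_eq_length_filter, ← List.toFinset_card_of_nodup (hnd.filter _)]
      congr 1
      ext x
      simp only [List.mem_toFinset, List.mem_filter, decide_eq_true_eq]
      exact ⟨fun h => h.2, fun h => ⟨by simpa using hJ' h, h⟩⟩
    have hlen : std.countP (· ∈ J) + std.countP (· ∉ J) = r := by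
      have := List.length_eq_countP_add_countP (l := std) (p := (· ∈ J))
      rw [show std.length = r by simp [hstd]] at this
      simpa using this.symm
    rcases Nat.even_or_odd J.card with hev | hodd
    · by_cases hlt : 2 * (r + 1) < (insert 0 J).card + 2 * t + 1
      · rw [hc (insert 0 J) (Finset.mem_insert_self _ _)
          (by rw [Finset.card_insert_of_notMem h0J]; exact hev.add_one) hlt s
          fun M _ _ Φ hΦ q => hs q M Φ hΦ, zero_smul]
        exact S.zero_mem
      · rw [Finset.card_insert_of_notMem h0J] at hlt
        refine S.smul_mem _ ?_
        rw [mul_eq_jmul_add_hbrk k]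
        refine S.add_mem ?_ (S.smul_mem _ (hS _ _))
        have h1 := jmul_mem_jpow (hy 0) (formPair_mem_jpow J hI hy std).1
        have h2 : jpow k I (t + 1) ≤ S := (jpow_le_span_circFold hI t).trans
          (Submodule.span_le.2 (by rintro x ⟨f, hf, rfl⟩; exact hcirc f hf))
        refine h2 (jpow_antitone ?_ h1)
        obtain ⟨e, he⟩ := hev
        omega
    · rw [(formPair_eq_zero J std).1 (by rwa [hcount]), mul_zero, smul_zero]
      exact S.zero_mem
  have : ∑ q, c q • (List.ofFn fun i => y (q i)).prod =
      ∑ q, c q • ((List.ofFn fun i => y (q i)).prod - y 0 * ((l₂ q ++ l₁ q).map y).prod) +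
      ∑ q, c q • (y 0 * ((l₂ q ++ l₁ q).map y).prod) := by
    rw [← Finset.sum_add_distrib]
    refine Finset.sum_congr rfl fun q _ => ?_
    rw [← smul_add, sub_add_cancel]
  rw [this]
  exact S.add_mem (S.sum_mem fun q _ => S.smul_mem _ (hrot q)) hmain

end Reduction
section Tspace

variable (k : Type u) [Field k]

/-- The nonunitary T-space generated by the four polynomials of the theorem, with `t + 1` factors in
the circle products. -/
def tSpace (t : ℕ) : Submodule k (FreeAlgebra k ℕ) :=
  Submodule.span k {y : FreeAlgebra k ℕ |
    ∃ ψ : FreeAlgebra k ℕ →ₐ[k] FreeAlgebra k ℕ, (∀ i, ψ (xx k i) ∈ F0 k) ∧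
      (y = ψ (brk (xx k 1) (xx k 2)) ∨
        y = ψ (brk (xx k 1) (xx k 2) * brk (xx k 3) (xx k 4)) ∨
        y = ψ (circFold (xx k) (t + 1)) ∨
        y = ψ (circFold (xx k) (t + 1) * xx k (t + 1 + 1)))}

variable {k}

lemma F0_mul_mem {a : FreeAlgebra k ℕ} (ha : a ∈ F0 k) (z : FreeAlgebra k ℕ) :
    a * z ∈ F0 k ∧ z * a ∈ F0 k := by
  unfold F0 at ha
  induction ha using Submodule.span_induction with
  | mem x hx =>
    obtain ⟨a, i, b, rfl⟩ := hx
    exact ⟨Submodule.subset_span ⟨a, i, b * z, by simp only [mul_assoc]⟩,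
      Submodule.subset_span ⟨z * a, i, b, by simp only [mul_assoc]⟩⟩
  | zero => simp
  | add x y _ _ hx hy =>
    rw [add_mul, mul_add]
    exact ⟨Submodule.add_mem _ hx.1 hy.1, Submodule.add_mem _ hx.2 hy.2⟩
  | smul c x _ hx =>
    rw [smul_mul_assoc, mul_smul_comm]
    exact ⟨Submodule.smul_mem _ _ hx.1, Submodule.smul_mem _ _ hx.2⟩

lemma ι_mem_F0 (i : ℕ) : FreeAlgebra.ι k i ∈ F0 k :=
  Submodule.subset_span ⟨1, i, 1, by simp⟩

lemma exists_sub_algebraMap_mem_F0 (a : FreeAlgebra k ℕ) :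
    ∃ c : k, a - algebraMap k _ c ∈ F0 k := by
  induction a using FreeAlgebra.induction with
  | grade0 r => exact ⟨r, by simp⟩
  | grade1 i => exact ⟨0, by simpa using ι_mem_F0 i⟩
  | mul a b ha hb =>
    obtain ⟨c, hc⟩ := ha
    obtain ⟨d, hd⟩ := hb
    refine ⟨c * d, ?_⟩
    have : a * b - algebraMap k _ (c * d) =
        (a - algebraMap k _ c) * b + algebraMap k _ c * (b - algebraMap k _ d) := by
      rw [map_mul]; noncomm_ring
    rw [this]
    exact Submodule.add_mem _ (F0_mul_mem hc _).1 (F0_mul_mem hd _).2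
  | add a b ha hb =>
    obtain ⟨c, hc⟩ := ha
    obtain ⟨d, hd⟩ := hb
    refine ⟨c + d, ?_⟩
    rw [map_add, add_sub_add_comm]
    exact Submodule.add_mem _ hc hd

lemma exists_brk_eq (a : FreeAlgebra k ℕ) :
    ∃ a' ∈ F0 k, (∀ b, brk a b = brk a' b) ∧ ∀ b, brk b a = brk b a' := by
  obtain ⟨c, hc⟩ := exists_sub_algebraMap_mem_F0 a
  refine ⟨_, hc, fun b => ?_, fun b => ?_⟩
  · simp only [brk, sub_mul, mul_sub, Algebra.commutes c b]; abel
  · simp only [brk, sub_mul, mul_sub, Algebra.commutes c b]; abel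

variable (t : ℕ)

lemma brk_mem_tSpace (a b : FreeAlgebra k ℕ) : brk a b ∈ tSpace k t := by
  obtain ⟨a', ha, ha', -⟩ := exists_brk_eq a
  obtain ⟨b', hb, -, hb'⟩ := exists_brk_eq b
  rw [ha', hb']
  refine Submodule.subset_span ⟨FreeAlgebra.lift k fun i => if i = 1 then a' else b', fun i => ?_,
    Or.inl ?_⟩
  · rw [xx, FreeAlgebra.lift_ι_apply]; split_ifs <;> assumption
  · simp [brk, xx]

lemma brk_mul_brk_mem_tSpace (a b c d : FreeAlgebra k ℕ) : brk a b * brk c d ∈ tSpace k t := by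
  obtain ⟨a', ha, ha', -⟩ := exists_brk_eq a
  obtain ⟨b', hb, -, hb'⟩ := exists_brk_eq b
  obtain ⟨c', hc, hc', -⟩ := exists_brk_eq c
  obtain ⟨d', hd, -, hd'⟩ := exists_brk_eq d
  rw [ha', hb', hc', hd']
  refine Submodule.subset_span ⟨FreeAlgebra.lift k fun i => if i = 1 then a' else if i = 2 then b'
    else if i = 3 then c' else d', fun i => ?_, Or.inr (Or.inl ?_)⟩
  · rw [xx, FreeAlgebra.lift_ι_apply]; split_ifs <;> assumption
  · simp [brk, xx]

lemma circFold_mem_tSpace {f : ℕ → FreeAlgebra k ℕ} (hf : ∀ i, f i ∈ F0 k) :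
    circFold f (t + 1) ∈ tSpace k t := by
  refine Submodule.subset_span ⟨FreeAlgebra.lift k f, fun i => ?_, Or.inr (Or.inr (Or.inl ?_))⟩
  · rw [xx, FreeAlgebra.lift_ι_apply]; exact hf i
  · have := map_circFold (FreeAlgebra.lift k f : FreeAlgebra k ℕ →ₐ[k] _).toRingHom (xx k) t
    rw [AlgHom.toRingHom_eq_coe, RingHom.coe_coe] at this
    rw [this]
    simp [xx]

lemma mul_brk_brk_mul_mem_tSpace (u v a b c : FreeAlgebra k ℕ) :
    u * brk (brk a b) c * v ∈ tSpace k t := by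
  have : u * brk (brk a b) c * v = brk u (brk (brk a b) c * v) + brk (brk a b * (v * u)) c +
      brk a b * brk c (v * u) := by
    simp only [brk]; noncomm_ring
  rw [this]
  exact Submodule.add_mem _ (Submodule.add_mem _ (brk_mem_tSpace t _ _) (brk_mem_tSpace t _ _))
    (brk_mul_brk_mem_tSpace t _ _ _ _)

/-- The congruence of the largest two-sided ideal contained in a subspace. -/
def coreCon (S : Submodule k (FreeAlgebra k ℕ)) : RingCon (FreeAlgebra k ℕ) where
  r x y := ∀ u v, u * (x - y) * v ∈ S
  iseqv :=
    { refl := fun x u v => by simp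
      symm := fun {x y} h u v => by
        rw [← neg_sub x y, mul_neg, neg_mul]
        exact S.neg_mem (h u v)
      trans := fun {x y z} h h' u v => by
        rw [← sub_add_sub_cancel x y z, mul_add, add_mul]
        exact S.add_mem (h u v) (h' u v) }
  add' {w x y z} h h' u v := by
    rw [add_sub_add_comm, mul_add, add_mul]
    exact S.add_mem (h u v) (h' u v)
  mul' {w x y z} h h' u v := by
    have : u * (w * y - x * z) * v = u * (w - x) * (y * v) + (u * x) * (y - z) * v := by
      noncomm_ring
    rw [this]
    exact S.add_mem (h _ _) (h' _ _)

lemma exists_lieNilTwo_quotient :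
    ∃ (A : Type u) (_ : Ring A) (_ : Algebra k A) (π : FreeAlgebra k ℕ →ₐ[k] A),
      Function.Surjective π ∧ LieNilTwo A ∧ ∀ x, π x = 0 → x ∈ tSpace k t := by
  let π : FreeAlgebra k ℕ →ₐ[k] (coreCon (tSpace k t)).Quotient :=
    { (coreCon (tSpace k t)).mk' with commutes' := fun _ => rfl }
  have hπ : Function.Surjective π := (coreCon (tSpace k t)).mk'_surjective
  have h0 : ∀ x, π x = 0 ↔ ∀ u v, u * x * v ∈ tSpace k t := by
    intro x
    rw [← map_zero π]
    refine (RingCon.eq (coreCon (tSpace k t))).trans ?_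
    change (∀ u v, u * (x - 0) * v ∈ tSpace k t) ↔ _
    rw [sub_zero]
  refine ⟨_, inferInstance, inferInstance, π, hπ, fun a b c => ?_, fun x hx => ?_⟩
  · obtain ⟨a, rfl⟩ := hπ a
    obtain ⟨b, rfl⟩ := hπ b
    obtain ⟨c, rfl⟩ := hπ c
    have : brk (brk (π a) (π b)) (π c) = π (brk (brk a b) c) := by simp [brk]
    rw [this, h0]
    exact fun u v => mul_brk_brk_mul_mem_tSpace t u v a b c
  · simpa using (h0 x).1 hx 1 1

lemma sum_perm_words_mem_tSpace [CharZero k] {r : ℕ} {y : Fin (r + 1) → FreeAlgebra k ℕ}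
    (hy : ∀ i, y i ∈ F0 k) (c : Equiv.Perm (Fin (r + 1)) → k)
    (l₁ l₂ : Equiv.Perm (Fin (r + 1)) → List (Fin (r + 1)))
    (hl : ∀ q : Equiv.Perm (Fin (r + 1)), List.ofFn q = l₁ q ++ 0 :: l₂ q)
    (hc : ∀ J : Finset (Fin (r + 1)), 0 ∈ J → Odd J.card → 2 * (r + 1) < J.card + 2 * t + 1 →
      ∀ s : Equiv.Perm (Fin (r + 1)) → k,
        (∀ (M : Type u) [AddCommGroup M] [Module k M] (Φ : List (Fin (r + 1)) → M),
          GradedSymm k J Φ → ∀ q : Equiv.Perm (Fin (r + 1)),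
            Φ (l₂ q ++ l₁ q) = s q • Φ ((List.finRange r).map Fin.succ)) →
        ∑ q, c q * s q = 0) :
    ∑ q, c q • (List.ofFn fun i => y (q i)).prod ∈ tSpace k t := by
  obtain ⟨A, _, _, π, hπ, h3, hker⟩ := exists_lieNilTwo_quotient (k := k) t
  have key := sum_perm_words_mem (t := t) h3 (S := (tSpace k t).map π.toLinearMap)
    (I := (F0 k).map π.toLinearMap) (fun a b => ?_) (fun a ha z => ?_) (fun f hf => ?_)
    (y := fun i => π (y i)) (fun i => ⟨y i, hy i, rfl⟩) c l₁ l₂ hl hc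
  · have : ∑ q, c q • (List.ofFn fun i => π (y (q i))).prod =
        π (∑ q, c q • (List.ofFn fun i => y (q i)).prod) := by
      rw [map_sum]
      refine Finset.sum_congr rfl fun q _ => ?_
      rw [map_smul, map_list_prod, List.map_ofFn]
      rfl
    rw [this] at key
    obtain ⟨z, hz, hz'⟩ := key
    rw [AlgHom.toLinearMap_apply, ← sub_eq_zero, ← map_sub] at hz'
    simpa only [sub_sub_cancel] using (tSpace k t).sub_mem hz (hker _ hz')
  · obtain ⟨a, rfl⟩ := hπ a
    obtain ⟨b, rfl⟩ := hπ b
    exact ⟨brk a b, brk_mem_tSpace t a b, by simp [brk]⟩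
  · obtain ⟨a, ha, rfl⟩ := ha
    obtain ⟨z, rfl⟩ := hπ z
    exact ⟨⟨a * z, (F0_mul_mem ha z).1, by simp⟩, ⟨z * a, (F0_mul_mem ha z).2, by simp⟩⟩
  · choose g hg hg' using hf
    refine ⟨circFold g (t + 1), circFold_mem_tSpace t hg, ?_⟩
    have := map_circFold π.toRingHom g t
    refine this.trans (congrArg (fun h => circFold h (t + 1)) (funext hg'))

end Tspace
section Exterior

variable {k : Type u} [Field k]

section

variable {V : Type*} [AddCommGroup V] [Module k V]

variable (k) in
/-- The exterior product of a list of vectors. -/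
def extProd (l : List V) : ExteriorAlgebra k V := (l.map (ExteriorAlgebra.ι k)).prod

@[simp] lemma extProd_append (l l' : List V) :
    extProd k (l ++ l') = extProd k l * extProd k l' := by simp [extProd]

@[simp] lemma extProd_cons (v : V) (l : List V) :
    extProd k (v :: l) = ExteriorAlgebra.ι k v * extProd k l := by simp [extProd]

@[simp] lemma extProd_nil : extProd k ([] : List V) = 1 := by simp [extProd]

lemma extProd_flatMap {ι : Type*} (B : ι → List V) (l : List ι) :
    extProd k (l.flatMap B) = (l.map fun p => extProd k (B p)).prod := by
  induction l with
  | nil => simp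
  | cons a l ih => simp [ih]

lemma extProd_eq_ιMulti (l : List V) :
    extProd k l = ExteriorAlgebra.ιMulti k l.length l.get := by
  rw [ExteriorAlgebra.ιMulti_apply, extProd]
  congr 1
  conv_lhs => rw [← List.ofFn_get l, List.map_ofFn]
  rfl

lemma extProd_mul_extProd (l l' : List V) :
    extProd k l * extProd k l' = (-1 : k) ^ (l.length * l'.length) • (extProd k l' * extProd k l) := by
  have h1 : ∀ (v : V) (l : List V), ExteriorAlgebra.ι k v * extProd k l =
      (-1 : k) ^ l.length • (extProd k l * ExteriorAlgebra.ι k v) := by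
    intro v l
    induction l with
    | nil => simp
    | cons w l ih =>
      have := eq_neg_of_add_eq_zero_left (ExteriorAlgebra.ι_add_mul_swap (R := k) v w)
      rw [extProd_cons, ← mul_assoc, this, neg_mul, mul_assoc, ih, mul_smul_comm, List.length_cons,
        pow_succ, mul_neg_one, neg_smul, mul_assoc]
  induction l with
  | nil => simp
  | cons v l ih =>
    rw [extProd_cons, mul_assoc, ih, mul_smul_comm, ← mul_assoc, h1, smul_mul_assoc, smul_smul,
      mul_assoc, List.length_cons, ← pow_add]
    congr 2
    ring

lemma extProd_comm {l l' : List V} (h : Even (l.length * l'.length)) :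
    extProd k l * extProd k l' = extProd k l' * extProd k l := by
  rw [extProd_mul_extProd, h.neg_one_pow, one_smul]

lemma extProd_eq_zero [FiniteDimensional k V] {l : List V} (h : Module.finrank k V < l.length) :
    extProd k l = 0 := by
  rw [extProd_eq_ιMulti]
  refine AlternatingMap.map_linearDependent _ _ fun hli => ?_
  have := hli.fintype_card_le_finrank
  rw [Fintype.card_fin] at this
  omega

lemma extProd_eq_zero_of_not_nodup {l : List V} (h : ¬ l.Nodup) : extProd k l = 0 := by
  rw [extProd_eq_ιMulti]
  rw [List.nodup_iff_injective_get] at h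
  simp only [Function.Injective, not_forall] at h
  obtain ⟨i, j, hij, hne⟩ := h
  exact AlternatingMap.map_eq_zero_of_eq _ _ hij hne

end

variable {m : ℕ}

/-- A standard basis vector. -/
def stdVec (k : Type u) [Field k] (i : Fin m) : Fin m → k := Pi.single i 1

lemma exists_extProd_coeff {L : List (Fin m)} (hL : L.Nodup) :
    ∃ D : ExteriorAlgebra k (Fin m → k) →ₗ[k] k, D (extProd k (L.map (stdVec k))) = 1 ∧
      ∀ l : List (Fin m → k), l.length ≠ L.length → D (extProd k l) = 0 := by
  let A : (Fin m → k) [⋀^Fin L.length]→ₗ[k] k :=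
    Matrix.detRowAlternating.compLinearMap (LinearMap.funLeft k k L.get)
  let F : (i : ℕ) → (Fin m → k) [⋀^Fin i]→ₗ[k] k := Pi.single L.length A
  refine ⟨ExteriorAlgebra.liftAlternating F, ?_, fun l hl => ?_⟩
  · have : extProd k (L.map (stdVec k)) =
        ExteriorAlgebra.ιMulti k L.length fun i => stdVec k (L.get i) := by
      rw [ExteriorAlgebra.ιMulti_apply, extProd]
      congr 1
      conv_lhs => rw [← List.ofFn_get L, List.map_ofFn, List.map_ofFn]
      rfl
    rw [this, ExteriorAlgebra.liftAlternating_apply_ιMulti]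
    simp only [F, Pi.single_eq_same, A, AlternatingMap.compLinearMap_apply]
    have h1 : (fun i => LinearMap.funLeft k k L.get (stdVec k (L.get i))) =
        (1 : Matrix (Fin L.length) (Fin L.length) k) := by
      ext i j
      simp only [LinearMap.funLeft_apply, stdVec, Matrix.one_apply, Pi.single_apply]
      by_cases h : i = j
      · simp [h]
      · rw [if_neg h, if_neg]
        exact fun h' => h (List.nodup_iff_injective_get.1 hL h').symm
    change Matrix.det (fun i => LinearMap.funLeft k k L.get (stdVec k (L.get i))) = 1
    rw [h1, Matrix.det_one]
  · rw [extProd_eq_ιMulti, ExteriorAlgebra.liftAlternating_apply_ιMulti]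
    simp [F, Pi.single_eq_of_ne hl]

lemma ee_eq (i : Fin m) : ee k m (i + 1) = ExteriorAlgebra.ι k (stdVec k i) := by
  rw [ee, stdVec]
  congr 1
  ext j
  simp [Pi.single_apply, Fin.ext_iff]

lemma ι_stdVec_mem_G0 (i : Fin m) : ExteriorAlgebra.ι k (stdVec k i) ∈ G0 k m := by
  refine Submodule.subset_span ⟨1, le_rfl, fun _ => i + 1, Subsingleton.strictMono _,
    fun _ => ⟨Nat.succ_pos _, i.isLt⟩, ?_⟩
  simp [ee_eq]

lemma ι_stdVec_mul_mem_G0 {i j : Fin m} (h : i ≠ j) :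
    ExteriorAlgebra.ι k (stdVec k i) * ExteriorAlgebra.ι k (stdVec k j) ∈ G0 k m := by
  wlog hij : i < j generalizing i j
  · rw [eq_neg_of_add_eq_zero_left (ExteriorAlgebra.ι_add_mul_swap (R := k) _ _)]
    exact Submodule.neg_mem _ (this h.symm (lt_of_le_of_ne (not_lt.1 hij) h.symm))
  refine Submodule.subset_span ⟨2, by omega, ![i + 1, j + 1], ?_, ?_, ?_⟩
  · intro a b hab
    fin_cases a <;> fin_cases b <;> simp_all
  · intro a
    fin_cases a <;> simp
  · simp [List.ofFn_succ, ee_eq]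

lemma exists_blocks {n : ℕ} (J : Finset (Fin n)) (hJ : 2 * n + 1 ≤ m + J.card) :
    ∃ (B : Fin n → List (Fin m)) (i₀ : Fin m), ((List.finRange n).flatMap B ++ [i₀]).Nodup ∧
      ∀ p, (B p).length = if p ∈ J then 1 else 2 := by
  let sz : Fin n → ℕ := fun p => if p ∈ J then 1 else 2
  have hsum : ∑ p, sz p + J.card = 2 * n := by
    have : J.card = ∑ p : Fin n, if p ∈ J then 1 else 0 := by simp
    rw [this, ← Finset.sum_add_distrib, Finset.sum_congr rfl (g := fun _ => 2)]
    · simp [mul_comm]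
    · intro p _
      simp only [sz]
      split_ifs <;> rfl
  obtain ⟨g⟩ : Nonempty (Option (Σ p, Fin (sz p)) ↪ Fin m) := by
    refine Function.Embedding.nonempty_of_card_le ?_
    simp only [Fintype.card_option, Fintype.card_sigma, Fintype.card_fin]
    omega
  refine ⟨fun p => (List.finRange (sz p)).map fun j => g (some ⟨p, j⟩), g none, ?_, fun p => ?_⟩
  · rw [List.nodup_append]
    refine ⟨List.nodup_flatMap.2 ⟨fun p _ => (List.nodup_finRange _).map ?_, ?_⟩, by simp, ?_⟩
    · intro a b h
      simpa using g.injective h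
    · refine (List.nodup_finRange n).imp fun {p q} hpq => ?_
      rw [Function.onFun, List.disjoint_left]
      intro x hx hx'
      obtain ⟨a, -, rfl⟩ := List.mem_map.1 hx
      obtain ⟨b, -, hb⟩ := List.mem_map.1 hx'
      have := g.injective hb
      simp only [Option.some.injEq, Sigma.mk.injEq] at this
      exact hpq this.1.symm
    · intro x hx y hy hxy
      obtain ⟨p, -, hp⟩ := List.mem_flatMap.1 hx
      obtain ⟨a, -, rfl⟩ := List.mem_map.1 hp
      rw [List.mem_singleton.1 hy] at hxy
      simpa using g.injective hxy
  · simp [sz]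

end Exterior
section Evaluation

variable {k : Type u} [Field k] {m : ℕ}

lemma sum_perm_eq_sum {n : ℕ} {g : (Fin n → Fin n) → k}
    (h : ∀ q, ¬ Function.Injective q → g q = 0) :
    ∑ q : Equiv.Perm (Fin n), g q = ∑ q, g q := by
  refine Finset.sum_of_injOn (fun q : Equiv.Perm (Fin n) => (q : Fin n → Fin n))
    (fun a _ b _ hab => DFunLike.coe_injective hab) (fun _ _ => Finset.mem_coe.2 (Finset.mem_univ _))
    (fun q _ hq => h q fun hinj => hq ?_) fun _ _ => rfl
  exact ⟨Equiv.ofBijective q (Finite.injective_iff_bijective.1 hinj),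
    Finset.mem_coe.2 (Finset.mem_univ _), rfl⟩

lemma lift_word {G : Type*} [Ring G] [Algebra k G] {n n' N : ℕ} (τ : Fin n → Fin N)
    (a : Fin n → G) (τ' : Fin n' → Fin N) :
    FreeAlgebra.lift k (fun i : ℕ => ∑ p with (τ p : ℕ) = i, a p)
      (List.ofFn fun i => FreeAlgebra.ι k (τ' i : ℕ)).prod =
    ∑ q : Fin n' → Fin n with τ ∘ q = τ', (List.ofFn fun i => a (q i)).prod := by
  rw [map_list_prod, List.map_ofFn]
  have h := (MultilinearMap.mkPiAlgebraFin k n' G).map_sum_finset (fun _ p => a p)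
    fun i => Finset.univ.filter fun p => (τ p : ℕ) = τ' i
  simp only [MultilinearMap.mkPiAlgebraFin_apply] at h
  have e : (⇑((FreeAlgebra.lift k) fun i : ℕ => ∑ p with (τ p : ℕ) = i, a p) ∘
      fun i => FreeAlgebra.ι k (τ' i : ℕ)) = fun i => ∑ p with (τ p : ℕ) = τ' i, a p := by
    funext i
    simp
  rw [e, h]
  refine Finset.sum_congr ?_ fun _ _ => rfl
  ext q
  simp [Fintype.mem_piFinset, funext_iff, Fin.ext_iff]

lemma sum_coeff_mul_sign_eq_zero [CharZero k] {N D : ℕ} {c : ∀ n, (Fin n → Fin N) → k}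
    {f : FreeAlgebra k ℕ} (hf : f = ∑ n ∈ Finset.range D, ∑ τ : Fin n → Fin N,
      c n τ • (List.ofFn fun i => FreeAlgebra.ι k (τ i : ℕ)).prod) (hCP : f ∈ CP0 k m)
    {r : ℕ} (hr : r + 1 < D) (τ : Fin (r + 1) → Fin N)
    {l₁ l₂ : Equiv.Perm (Fin (r + 1)) → List (Fin (r + 1))}
    (hl : ∀ q : Equiv.Perm (Fin (r + 1)), List.ofFn q = l₁ q ++ 0 :: l₂ q)
    {J : Finset (Fin (r + 1))} (hodd : Odd J.card) (hJ : 2 * (r + 1) + 1 ≤ m + J.card)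
    {s : Equiv.Perm (Fin (r + 1)) → k}
    (hs : ∀ (M : Type u) [AddCommGroup M] [Module k M] (Φ : List (Fin (r + 1)) → M),
      GradedSymm k J Φ → ∀ q : Equiv.Perm (Fin (r + 1)),
        Φ (l₂ q ++ l₁ q) = s q • Φ ((List.finRange r).map Fin.succ)) :
    ∑ q : Equiv.Perm (Fin (r + 1)), c (r + 1) (τ ∘ q) * s q = 0 := by
  obtain ⟨B, i₀, hnd, hB⟩ := exists_blocks J hJ
  obtain ⟨D₀, hD₁, hD₂⟩ := exists_extProd_coeff (k := k) hnd
  set V : Fin (r + 1) → List (Fin m → k) := fun p => (B p).map (stdVec k) with hV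
  have hVlen : ∀ p, (V p).length = if p ∈ J then 1 else 2 := fun p => by simp [hV, hB]
  set a : Fin (r + 1) → ExteriorAlgebra k (Fin m → k) := fun p => extProd k (V p) with ha
  set e₀ : ExteriorAlgebra k (Fin m → k) := extProd k [stdVec k i₀] with he₀
  have hndB : ∀ p, (B p).Nodup := fun p =>
    (List.nodup_flatMap.1 (List.nodup_append.1 hnd).1).1 p (List.mem_finRange p)
  have haG : ∀ p, a p ∈ G0 k m := by
    intro p
    simp only [ha, hV]
    have h1 := hB p
    have h2 := hndB p
    split_ifs at h1
    · obtain ⟨i, hi⟩ := List.length_eq_one_iff.1 h1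
      rw [hi]
      simpa using ι_stdVec_mem_G0 (k := k) i
    · obtain ⟨i, j, hij⟩ := List.length_eq_two.1 h1
      rw [hij] at h2 ⊢
      simpa using ι_stdVec_mul_mem_G0 (k := k) (i := i) (j := j) (by simpa using h2)
  let W : ExteriorAlgebra k (Fin m → k) →ₗ[k] k :=
    D₀ ∘ₗ (LinearMap.mulRight k e₀ - LinearMap.mulLeft k e₀)
  have hW : ∀ x, W x = D₀ (x * e₀ - e₀ * x) := fun x => rfl
  set φ : FreeAlgebra k ℕ →ₐ[k] ExteriorAlgebra k (Fin m → k) :=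
    FreeAlgebra.lift k (fun i : ℕ => ∑ p with (τ p : ℕ) = i, a p) with hφ
  have hWf : W (φ f) = 0 := by
    rw [hW, hCP.2 φ (fun i => ?_) e₀ ?_, sub_self, map_zero]
    · rw [he₀]
      simpa using ι_stdVec_mem_G0 (k := k) i₀
    · rw [xx, hφ, FreeAlgebra.lift_ι_apply]
      exact Submodule.sum_mem _ fun p _ => haG p
  set d := ((List.finRange (r + 1)).flatMap V).length with hd
  have hdsum : d = ∑ p, (V p).length := by
    rw [hd, List.length_flatMap, ← List.ofFn_eq_map, List.sum_ofFn]
  have hdJ : d + J.card = 2 * (r + 1) := by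
    have : J.card = ∑ p : Fin (r + 1), if p ∈ J then 1 else 0 := by simp
    rw [hdsum, this, ← Finset.sum_add_distrib, Finset.sum_congr rfl (g := fun _ => 2)]
    · simp [mul_comm]
    · intro p _
      rw [hVlen]
      split_ifs <;> rfl
  have hdodd : Odd d := by
    obtain ⟨e, he⟩ := hodd
    rw [← Nat.not_even_iff_odd]
    rintro ⟨e', he'⟩
    omega
  have hword : ∀ {n' : ℕ} (q : Fin n' → Fin (r + 1)),
      (List.ofFn fun i => a (q i)).prod = extProd k ((List.ofFn q).flatMap V) := by
    intro n' q
    rw [extProd_flatMap, List.map_ofFn]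
    rfl
  have hlen0 : ((List.finRange (r + 1)).flatMap B ++ [i₀]).length = d + 1 := by
    simp [hd, hV, List.length_flatMap]
  have hW0 : ∀ {n' : ℕ} (q : Fin n' → Fin (r + 1)), ¬ Function.Injective q →
      W (List.ofFn fun i => a (q i)).prod = 0 := by
    intro n' q hq
    rw [hword, extProd_eq_zero_of_not_nodup, map_zero]
    rw [List.nodup_flatMap]
    rintro ⟨-, h⟩
    refine hq (List.nodup_ofFn.1 (h.imp fun {x y} hxy hne => ?_))
    rw [Function.onFun, hne] at hxy
    have := hVlen y
    rw [List.eq_nil_iff_forall_not_mem.2 fun v hv => hxy hv hv] at this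
    split_ifs at this
  have hW1 : ∀ {n' : ℕ} (q : Fin n' → Fin (r + 1)), n' ≠ r + 1 →
      W (List.ofFn fun i => a (q i)).prod = 0 := by
    intro n' q hn
    by_cases hq : Function.Injective q
    · have hlt : ((List.ofFn q).flatMap V).length < d := by
        rw [List.length_flatMap, List.map_ofFn, List.sum_ofFn, hdsum]
        simp only [Function.comp_apply]
        rw [← Finset.sum_image (s := Finset.univ) (g := q) (f := fun p => (V p).length)
          fun x _ y _ h => hq h]
        have hcard : (Finset.univ.image q).card = n' := by
          rw [Finset.card_image_of_injective _ hq, Finset.card_univ, Fintype.card_fin]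
        have hne : Finset.univ.image q ≠ Finset.univ := by
          intro h
          rw [h, Finset.card_univ, Fintype.card_fin] at hcard
          exact hn hcard.symm
        obtain ⟨p, hp⟩ : ∃ p, p ∉ Finset.univ.image q := by
          by_contra! h
          exact hne (Finset.eq_univ_iff_forall.2 h)
        refine Finset.sum_lt_sum_of_subset (Finset.subset_univ _) (Finset.mem_univ p) hp ?_
          fun _ _ _ => Nat.zero_le _
        rw [hVlen]
        split_ifs <;> omega
      rw [hword, hW, he₀, map_sub, ← extProd_append, ← extProd_append, hD₂, hD₂, sub_zero]
      · rw [hlen0, List.length_append, List.length_singleton]; omega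
      · rw [hlen0, List.length_append, List.length_singleton]; omega
    · exact hW0 q hq
  have hmain : ∑ q : Equiv.Perm (Fin (r + 1)),
      c (r + 1) (τ ∘ q) * W (List.ofFn fun i => a (q i)).prod = 0 := by
    rw [sum_perm_eq_sum (g := fun q => c (r + 1) (τ ∘ q) * W (List.ofFn fun i => a (q i)).prod)
      fun q hq => by rw [hW0 q hq, mul_zero]]
    rw [hf, map_sum, map_sum, Finset.sum_eq_single (r + 1)] at hWf
    · rw [← hWf, map_sum, map_sum]
      simp_rw [map_smul, hφ, lift_word, map_sum, smul_eq_mul, Finset.mul_sum, Finset.sum_filter]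
      rw [Finset.sum_comm]
      refine Finset.sum_congr rfl fun q _ => ?_
      simp
    · intro n' _ hn'
      simp_rw [map_sum, map_smul, hφ, lift_word, map_sum]
      exact Finset.sum_eq_zero fun _ _ => by
        rw [Finset.sum_eq_zero fun q _ => hW1 q hn', smul_zero]
    · intro h
      exact absurd (Finset.mem_range.2 hr) h
  have hswap : ∀ i j, a i * a j = swapSign k J i j • (a j * a i) := by
    intro i j
    simp only [ha]
    rw [extProd_mul_extProd, hVlen, hVlen, swapSign]
    by_cases hi : i ∈ J <;> by_cases hj : j ∈ J <;> simp [hi, hj, Even.neg_one_pow (show Even 4 by decide)]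
  have hsymm : GradedSymm k J fun l => a 0 * (l.map a).prod := by
    intro l₁ i j l₂
    simp only [List.map_append, List.map_cons, List.prod_append, List.prod_cons]
    rw [← mul_assoc (a i), hswap, smul_mul_assoc, mul_smul_comm, mul_smul_comm, mul_assoc (a j)]
  have hstd : a 0 * (((List.finRange r).map Fin.succ).map a).prod =
      extProd k ((List.finRange (r + 1)).flatMap V) := by
    rw [List.finRange_succ, extProd_flatMap]
    rfl
  have hWstd : W (extProd k ((List.finRange (r + 1)).flatMap V)) = 2 := by
    have h1 : extProd k ((List.finRange (r + 1)).flatMap V) * e₀ =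
        -(e₀ * extProd k ((List.finRange (r + 1)).flatMap V)) := by
      rw [he₀, extProd_mul_extProd, ← hd, List.length_singleton, mul_one, hdodd.neg_one_pow,
        neg_one_smul]
    have h2 : extProd k ((List.finRange (r + 1)).flatMap V) * e₀ =
        extProd k (((List.finRange (r + 1)).flatMap B ++ [i₀]).map (stdVec k)) := by
      rw [List.map_append, extProd_append, List.map_flatMap]
      rfl
    rw [hW, eq_neg_iff_add_eq_zero.1 h1 |> eq_neg_of_add_eq_zero_right, sub_neg_eq_add, h2, map_add,
      hD₁, one_add_one_eq_two]
  have hperm : ∀ q : Equiv.Perm (Fin (r + 1)),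
      (List.ofFn fun i => a (q i)).prod = a 0 * ((l₂ q ++ l₁ q).map a).prod := by
    intro q
    have h1 : (List.ofFn fun i => a (q i)) = (List.ofFn q).map a := by
      rw [List.map_ofFn]; rfl
    have hlen : ((l₁ q).flatMap V).length + ((0 :: l₂ q).flatMap V).length = d := by
      rw [← List.length_append, ← List.flatMap_append, ← hl, List.length_flatMap, List.map_ofFn,
        List.sum_ofFn, hdsum]
      exact Equiv.sum_comp q fun p => (V p).length
    have hev : Even (((l₁ q).flatMap V).length * ((0 :: l₂ q).flatMap V).length) := by
      rw [Nat.even_mul]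
      by_contra! h
      rw [Nat.not_even_iff_odd, Nat.not_even_iff_odd] at h
      rw [← hlen, ← Nat.not_even_iff_odd] at hdodd
      exact hdodd (h.1.add_odd h.2)
    have h2 := extProd_comm (k := k) hev
    rw [extProd_flatMap, extProd_flatMap] at h2
    rw [h1, hl, List.map_append, List.prod_append, h2, List.map_append, List.prod_append,
      List.map_cons, List.prod_cons, mul_assoc]
  have h2s : (∑ q : Equiv.Perm (Fin (r + 1)), c (r + 1) (τ ∘ q) * s q) * 2 = 0 := by
    rw [← hmain, Finset.sum_mul]
    refine Finset.sum_congr rfl fun q _ => ?_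
    have := hs _ _ hsymm q
    rw [hperm, this, hstd, map_smul, hWstd, smul_eq_mul, mul_assoc]
  exact (mul_eq_zero.1 h2s).resolve_right two_ne_zero

end Evaluation
section Polarization

variable {k : Type u} [Field k] {m : ℕ}

lemma mem_span_words (f : FreeAlgebra k ℕ) :
    f ∈ Submodule.span k (Set.range fun l : List ℕ => (l.map (FreeAlgebra.ι k)).prod) := by
  induction f using FreeAlgebra.induction with
  | grade0 r =>
    rw [Algebra.algebraMap_eq_smul_one]
    exact Submodule.smul_mem _ _ (Submodule.subset_span ⟨[], by simp⟩)
  | grade1 i => exact Submodule.subset_span ⟨[i], by simp⟩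
  | mul a b ha hb =>
    have h := Submodule.mul_mem_mul ha hb
    rw [Submodule.span_mul_span] at h
    refine Submodule.span_mono ?_ h
    rintro _ ⟨_, ⟨l, rfl⟩, _, ⟨l', rfl⟩, rfl⟩
    exact ⟨l ++ l', by simp⟩
  | add a b ha hb => exact Submodule.add_mem _ ha hb

lemma exists_eq_sum_words (f : FreeAlgebra k ℕ) :
    ∃ (N D : ℕ) (c : ∀ n, (Fin n → Fin N) → k), f = ∑ n ∈ Finset.range D, ∑ τ : Fin n → Fin N,
      c n τ • (List.ofFn fun i => FreeAlgebra.ι k (τ i : ℕ)).prod := by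
  classical
  obtain ⟨d, rfl⟩ := Finsupp.mem_span_range_iff_exists_finsupp.1 (mem_span_words f)
  obtain ⟨D, hD⟩ : ∃ D, ∀ l ∈ d.support, l.length < D :=
    ⟨d.support.sup List.length + 1, fun l hl => Nat.lt_succ_of_le (Finset.le_sup hl)⟩
  obtain ⟨N, hN⟩ : ∃ N, ∀ l ∈ d.support, ∀ i ∈ l, i < N :=
    ⟨d.support.sup List.sum + 1, fun l hl i hi =>
      Nat.lt_succ_of_le ((List.single_le_sum (fun _ _ => Nat.zero_le _) i hi).trans
        (Finset.le_sup (f := List.sum) hl))⟩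
  refine ⟨N, D, fun n τ => d (List.ofFn fun i => (τ i : ℕ)), ?_⟩
  let e : (Σ n, Fin n → Fin N) → List ℕ := fun x => List.ofFn fun i => (x.2 i : ℕ)
  have he : Function.Injective e := by
    rintro ⟨n, τ⟩ ⟨n', τ'⟩ h
    have h' := List.ofFn_inj'.1 h
    obtain rfl : n = n' := congrArg Sigma.fst h'
    refine Sigma.ext rfl (heq_of_eq (funext fun i => Fin.ext ?_))
    simpa using congrFun (eq_of_heq (Sigma.mk.inj h').2) i
  have hsub : d.support ⊆ ((Finset.range D).sigma fun n => (Finset.univ : Finset (Fin n → Fin N))).image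
      e := by
    intro l hl
    refine Finset.mem_image.2 ⟨⟨l.length, fun i => ⟨l.get i, hN l hl _ (List.get_mem l i)⟩⟩, ?_, ?_⟩
    · simpa using hD l hl
    · exact List.ofFn_get l
  rw [Finsupp.sum, Finset.sum_subset hsub fun l _ hl => by
    rw [Finsupp.notMem_support_iff.1 hl, zero_smul], Finset.sum_image he.injOn, Finset.sum_sigma]
  refine Finset.sum_congr rfl fun n _ => Finset.sum_congr rfl fun τ _ => ?_
  simp only [e, List.map_ofFn]
  rfl

lemma coeff_zero_eq_zero {N D : ℕ} {c : ∀ n, (Fin n → Fin N) → k}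
    {f : FreeAlgebra k ℕ} (hf : f = ∑ n ∈ Finset.range D, ∑ τ : Fin n → Fin N,
      c n τ • (List.ofFn fun i => FreeAlgebra.ι k (τ i : ℕ)).prod) (hF : f ∈ F0 k)
    (hD : 0 < D) (τ : Fin 0 → Fin N) : c 0 τ = 0 := by
  let ε : FreeAlgebra k ℕ →ₐ[k] k := FreeAlgebra.lift k fun _ => 0
  have hε : ε f = 0 := by
    have : F0 k ≤ LinearMap.ker ε.toLinearMap := by
      refine Submodule.span_le.2 ?_
      rintro _ ⟨a, i, b, rfl⟩
      simp [ε]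
    exact this hF
  rw [hf, map_sum, Finset.sum_eq_single 0] at hε
  · simpa [Subsingleton.elim _ τ] using hε
  · rintro (_ | n) _ hn
    · exact absurd rfl hn
    · simp [ε, List.ofFn_succ]
  · intro h
    exact absurd (Finset.mem_range.2 hD) h

lemma factorial_smul_sum {M : Type*} [AddCommGroup M] {n N : ℕ} (g : (Fin n → Fin N) → M) :
    n.factorial • ∑ τ, g τ = ∑ τ : Fin n → Fin N, ∑ q : Equiv.Perm (Fin n), g (τ ∘ q) := by
  conv_rhs => rw [Finset.sum_comm, Finset.sum_congr rfl (g := fun _ => ∑ τ, g τ) fun q _ =>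
    Equiv.sum_comp (q.symm.arrowCongr (Equiv.refl (Fin N))) g]
  simp [Fintype.card_perm]

theorem CP0_subset_tSpace [CharZero k] : CP0 k m ⊆ tSpace k (m / 2) := by
  intro f hCP
  obtain ⟨N, D, c, hf⟩ := exists_eq_sum_words f
  rw [hf]
  refine Submodule.sum_mem _ fun n hn => ?_
  obtain _ | r := n
  · refine Submodule.sum_mem _ fun τ _ => ?_
    rw [coeff_zero_eq_zero hf hCP.1 (Finset.mem_range.1 hn), zero_smul]
    exact Submodule.zero_mem _
  · rw [← Submodule.smul_mem_iff _ (Nat.cast_ne_zero.2 (r + 1).factorial_ne_zero : _ ≠ (0 : k)),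
      Nat.cast_smul_eq_nsmul, factorial_smul_sum]
    refine Submodule.sum_mem _ fun τ _ => ?_
    have hmem : ∀ q : Equiv.Perm (Fin (r + 1)), ∃ l₁ l₂ : List (Fin (r + 1)),
        List.ofFn q = l₁ ++ 0 :: l₂ := fun q =>
      List.append_of_mem (List.mem_ofFn.2 (q.surjective 0))
    choose l₁ l₂ hl using hmem
    exact sum_perm_words_mem_tSpace (m / 2) (y := fun i => FreeAlgebra.ι k (τ i : ℕ))
      (fun i => ι_mem_F0 _) (fun q => c (r + 1) (τ ∘ q)) l₁ l₂ hl fun J _ hodd hJ s hs =>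
        sum_coeff_mul_sign_eq_zero hf hCP (Finset.mem_range.1 hn) τ hl hodd
          (by obtain ⟨e, he⟩ := hodd; omega) hs

end Polarization
section Central

variable {k : Type u} [Field k]

section

variable {V : Type*} [AddCommGroup V] [Module k V] {P Q R : ℕ → Prop}

variable (k V) in
/-- The span of the products of `n` vectors, for `n` satisfying `P`. -/
def extDeg (P : ℕ → Prop) : Submodule k (ExteriorAlgebra k V) :=
  Submodule.span k {x | ∃ l : List V, P l.length ∧ x = extProd k l}

lemma extDeg_mono (h : ∀ n, P n → Q n) : extDeg k V P ≤ extDeg k V Q :=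
  Submodule.span_mono fun _ ⟨l, hl, hx⟩ => ⟨l, h _ hl, hx⟩

lemma mul_mem_extDeg (h : ∀ a b, P a → Q b → R (a + b)) {x y : ExteriorAlgebra k V}
    (hx : x ∈ extDeg k V P) (hy : y ∈ extDeg k V Q) : x * y ∈ extDeg k V R := by
  have hxy := Submodule.mul_mem_mul hx hy
  rw [extDeg, extDeg, Submodule.span_mul_span] at hxy
  refine Submodule.span_mono ?_ hxy
  rintro _ ⟨_, ⟨l, hl, rfl⟩, _, ⟨l', hl', rfl⟩, rfl⟩
  exact ⟨l ++ l', by simpa using h _ _ hl hl', by simp⟩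

lemma circ_mem_extDeg (h : ∀ a b, P a → Q b → R (a + b)) {x y : ExteriorAlgebra k V}
    (hx : x ∈ extDeg k V P) (hy : y ∈ extDeg k V Q) : x * y + y * x ∈ extDeg k V R :=
  Submodule.add_mem _ (mul_mem_extDeg h hx hy)
    (mul_mem_extDeg (fun a b ha hb => add_comm b a ▸ h b a hb ha) hy hx)

lemma mul_eq_smul_of_mem_extDeg {s : k} (h : ∀ a b, P a → Q b → (-1 : k) ^ (a * b) = s)
    {x y : ExteriorAlgebra k V} (hx : x ∈ extDeg k V P) (hy : y ∈ extDeg k V Q) :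
    x * y = s • (y * x) := by
  unfold extDeg at hx hy
  induction hx, hy using Submodule.span_induction₂ with
  | mem_mem x y hx hy =>
    obtain ⟨l, hl, rfl⟩ := hx
    obtain ⟨l', hl', rfl⟩ := hy
    rw [extProd_mul_extProd, h _ _ hl hl']
  | zero_left => simp
  | zero_right => simp
  | add_left x y z _ _ _ hx hy => rw [add_mul, mul_add, hx, hy, smul_add]
  | add_right x y z _ _ _ hx hy => rw [add_mul, mul_add, hx, hy, smul_add]
  | smul_left r x y _ _ h => rw [smul_mul_assoc, mul_smul_comm, h, smul_comm]
  | smul_right r x y _ _ h => rw [smul_mul_assoc, mul_smul_comm, h, smul_comm]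

lemma commute_of_even {x y : ExteriorAlgebra k V} (hx : x ∈ extDeg k V fun n => Even n ∧ 1 ≤ n)
    (hy : y ∈ extDeg k V (1 ≤ ·)) : x * y = y * x := by
  rw [mul_eq_smul_of_mem_extDeg (s := 1) (fun a b ha _ => (ha.1.mul_right b).neg_one_pow) hx hy,
    one_smul]

lemma circ_eq_zero_of_odd {x y : ExteriorAlgebra k V} (hx : x ∈ extDeg k V Odd)
    (hy : y ∈ extDeg k V Odd) : x * y + y * x = 0 := by
  rw [mul_eq_smul_of_mem_extDeg (s := -1) (fun a b ha hb => (ha.mul hb).neg_one_pow) hx hy,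
    neg_one_smul, neg_add_cancel]

lemma exists_even_add_odd {x : ExteriorAlgebra k V} (hx : x ∈ extDeg k V (1 ≤ ·)) :
    ∃ y ∈ extDeg k V (fun n => Even n ∧ 1 ≤ n), ∃ z ∈ extDeg k V Odd, y + z = x := by
  rw [← Submodule.mem_sup]
  refine Submodule.span_le.2 ?_ hx
  rintro _ ⟨l, hl, rfl⟩
  rcases Nat.even_or_odd l.length with h | h
  · exact Submodule.mem_sup_left (Submodule.subset_span ⟨l, ⟨h, hl⟩, rfl⟩)
  · exact Submodule.mem_sup_right (Submodule.subset_span ⟨l, h, rfl⟩)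

lemma eq_zero_of_mem_extDeg [FiniteDimensional k V] (h : ∀ n, P n → Module.finrank k V < n)
    {x : ExteriorAlgebra k V} (hx : x ∈ extDeg k V P) : x = 0 := by
  rw [← Submodule.mem_bot k]
  refine Submodule.span_le.2 ?_ hx
  rintro _ ⟨l, hl, rfl⟩
  exact extProd_eq_zero (h _ hl)

lemma mem_extDeg_true (x : ExteriorAlgebra k V) : x ∈ extDeg k V fun _ => True := by
  induction x using ExteriorAlgebra.induction with
  | algebraMap r =>
    rw [Algebra.algebraMap_eq_smul_one]
    exact Submodule.smul_mem _ _ (Submodule.subset_span ⟨[], trivial, by simp⟩)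
  | ι v => exact Submodule.subset_span ⟨[v], trivial, by simp⟩
  | mul a b ha hb => exact mul_mem_extDeg (fun _ _ _ _ => trivial) ha hb
  | add a b ha hb => exact Submodule.add_mem _ ha hb

/-- A commutator of elements of positive degree is even. -/
lemma brk_mem_extDeg {x y : ExteriorAlgebra k V} (hx : x ∈ extDeg k V (1 ≤ ·))
    (hy : y ∈ extDeg k V (1 ≤ ·)) : brk x y ∈ extDeg k V fun n => Even n ∧ 1 ≤ n := by
  have hy' := hy
  obtain ⟨x₀, hx₀, x₁, hx₁, rfl⟩ := exists_even_add_odd hx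
  obtain ⟨y₀, hy₀, y₁, hy₁, rfl⟩ := exists_even_add_odd hy
  have hodd : ∀ n, Odd n → 1 ≤ n := fun n h => h.pos
  have h0 := commute_of_even hx₀ hy'
  have h1 := commute_of_even hy₀ (extDeg_mono hodd hx₁)
  have : brk (x₀ + x₁) (y₀ + y₁) = x₁ * y₁ - y₁ * x₁ := by
    rw [brk, add_mul, mul_add (y₀ + y₁), h0, mul_add x₁, add_mul y₀ y₁ x₁, h1]
    abel
  rw [this]
  have hR : ∀ a b : ℕ, Odd a → Odd b → Even (a + b) ∧ 1 ≤ a + b := fun a b ha hb =>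
    ⟨ha.add_odd hb, ha.pos.trans_le (Nat.le_add_right _ _)⟩
  exact Submodule.sub_mem _ (mul_mem_extDeg hR hx₁ hy₁) (mul_mem_extDeg hR hy₁ hx₁)

lemma circFold_mem_sup {f : ℕ → ExteriorAlgebra k V} (hf : ∀ i, f i ∈ extDeg k V (1 ≤ ·)) (r : ℕ) :
    circFold f (r + 1) ∈ extDeg k V (fun n => Even n ∧ 2 * r + 2 ≤ n) ⊔
      extDeg k V fun n => Odd n ∧ 2 * r + 1 ≤ n := by
  rw [Submodule.mem_sup]
  induction r with
  | zero =>
    obtain ⟨y, hy, z, hz, h⟩ := exists_even_add_odd (hf 1)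
    refine ⟨y, extDeg_mono ?_ hy, z, extDeg_mono ?_ hz, ?_⟩
    · rintro n ⟨⟨e, he⟩, h⟩
      exact ⟨⟨e, he⟩, by omega⟩
    · intro n h
      exact ⟨h, by have := h.pos; omega⟩
    · simpa [circFold] using h
  | succ r ih =>
    obtain ⟨E, hE, O, hO, h⟩ := ih
    obtain ⟨y, hy, z, hz, h'⟩ := exists_even_add_odd (hf (r + 2))
    refine ⟨E * y + y * E, circ_mem_extDeg ?_ hE hy, (E * z + z * E) + (O * y + y * O),
      Submodule.add_mem _ (circ_mem_extDeg ?_ hE hz) (circ_mem_extDeg ?_ hO hy), ?_⟩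
    · rintro a b ⟨ha, ha'⟩ ⟨hb, hb'⟩
      refine ⟨ha.add hb, ?_⟩
      obtain ⟨e, rfl⟩ := hb
      omega
    · rintro a b ⟨ha, ha'⟩ hb
      exact ⟨ha.add_odd hb, by have := hb.pos; omega⟩
    · rintro a b ⟨ha, ha'⟩ ⟨hb, hb'⟩
      refine ⟨ha.add_even hb, ?_⟩
      obtain ⟨e, rfl⟩ := hb
      omega
    · have h0 := circ_eq_zero_of_odd (extDeg_mono (fun _ h => h.1) hO) hz
      rw [circFold_succ, ← h, ← h', eq_comm, ← sub_eq_zero, ← h0]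
      noncomm_ring

end

variable {m : ℕ}

lemma G0_le_extDeg : G0 k m ≤ extDeg k (Fin m → k) (1 ≤ ·) := by
  refine Submodule.span_le.2 ?_
  rintro _ ⟨r, hr, s, -, -, rfl⟩
  refine Submodule.subset_span ⟨List.ofFn fun a => fun j : Fin m => if (j : ℕ) + 1 = s a then 1 else 0,
    by simpa using hr, ?_⟩
  rw [extProd, List.map_ofFn]
  rfl

lemma map_mem_extDeg {V : Type*} [AddCommGroup V] [Module k V]
    {φ : FreeAlgebra k ℕ →ₐ[k] ExteriorAlgebra k V}
    (hφ : ∀ i, φ (xx k i) ∈ extDeg k V (1 ≤ ·)) {f : FreeAlgebra k ℕ} (hf : f ∈ F0 k) :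
    φ f ∈ extDeg k V (1 ≤ ·) := by
  have : F0 k ≤ (extDeg k V (1 ≤ ·)).comap φ.toLinearMap := by
    refine Submodule.span_le.2 ?_
    rintro _ ⟨a, i, b, rfl⟩
    change φ (_ * _ * _) ∈ extDeg k V _
    rw [map_mul, map_mul]
    exact mul_mem_extDeg (fun a b ha _ => Nat.le_add_right_of_le ha) (mul_mem_extDeg
      (fun a b _ hb => Nat.le_add_left_of_le hb) (mem_extDeg_true _) (hφ i)) (mem_extDeg_true _)
  exact this hf

lemma circFold_mem_F0 {f : ℕ → FreeAlgebra k ℕ} (hf : ∀ i, f i ∈ F0 k) (r : ℕ) :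
    circFold f (r + 1) ∈ F0 k := by
  cases r with
  | zero => simpa [circFold] using hf 1
  | succ r =>
    rw [circFold_succ]
    exact Submodule.add_mem _ (F0_mul_mem (hf _) _).2 (F0_mul_mem (hf _) _).1

lemma circFold_mem_extDeg {f : ℕ → ExteriorAlgebra k (Fin m → k)}
    (hf : ∀ i, f i ∈ extDeg k (Fin m → k) (1 ≤ ·)) :
    circFold f (m / 2 + 1) ∈ extDeg k (Fin m → k) (m ≤ ·) := by
  refine sup_le (extDeg_mono ?_) (extDeg_mono ?_) (circFold_mem_sup hf (m / 2))
  · rintro n ⟨-, h⟩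
    omega
  · rintro n ⟨-, h⟩
    omega

lemma mul_eq_zero_of_mem_extDeg {x y : ExteriorAlgebra k (Fin m → k)}
    (hx : x ∈ extDeg k (Fin m → k) (m ≤ ·)) (hy : y ∈ extDeg k (Fin m → k) (1 ≤ ·)) :
    x * y = 0 ∧ y * x = 0 := by
  have h : ∀ n, m + 1 ≤ n → Module.finrank k (Fin m → k) < n := fun n hn => by
    simpa using hn
  exact ⟨eq_zero_of_mem_extDeg h (mul_mem_extDeg (fun a b ha hb => add_le_add ha hb) hx hy),
    eq_zero_of_mem_extDeg h
      (mul_mem_extDeg (fun a b ha hb => (add_le_add hb ha).trans_eq (add_comm _ _)) hy hx)⟩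

theorem tSpace_subset_CP0 : (tSpace k (m / 2) : Set (FreeAlgebra k ℕ)) ⊆ CP0 k m := by
  intro f hf
  refine ⟨?_, fun φ hφ a ha => ?_⟩
  · refine Submodule.span_le.2 ?_ hf
    have hb : ∀ (a b : FreeAlgebra k ℕ), a ∈ F0 k → brk a b ∈ F0 k := fun a b ha =>
      Submodule.sub_mem _ (F0_mul_mem ha b).1 (F0_mul_mem ha b).2
    rintro _ ⟨ψ, hψ, rfl | rfl | rfl | rfl⟩
    · simpa [brk] using hb _ (ψ (xx k 2)) (hψ 1)
    · simpa [brk] using (F0_mul_mem (hb _ (ψ (xx k 2)) (hψ 1)) (ψ (brk (xx k 3) (xx k 4)))).1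
    · rw [← RingHom.coe_coe ψ, map_circFold]
      exact circFold_mem_F0 hψ _
    · rw [map_mul]
      exact (F0_mul_mem (hψ _) _).2
  · have ha' := G0_le_extDeg ha
    have hspan : tSpace k (m / 2) ≤ LinearMap.eqLocus
        (LinearMap.mulRight k a ∘ₗ φ.toLinearMap) (LinearMap.mulLeft k a ∘ₗ φ.toLinearMap) := by
      refine Submodule.span_le.2 ?_
      rintro _ ⟨ψ, hψ, h⟩
      have hx : ∀ i, φ (ψ (xx k i)) ∈ extDeg k (Fin m → k) (1 ≤ ·) := fun i =>
        map_mem_extDeg (fun i => G0_le_extDeg (hφ i)) (hψ i)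
      have hcirc : φ (ψ (circFold (xx k) (m / 2 + 1))) ∈ extDeg k (Fin m → k) (m ≤ ·) := by
        have := map_circFold (φ.comp ψ : FreeAlgebra k ℕ →+* ExteriorAlgebra k (Fin m → k)) (xx k) (m / 2)
        rw [RingHom.coe_coe] at this
        rw [← AlgHom.comp_apply, this]
        exact circFold_mem_extDeg hx
      change φ _ * a = a * φ _
      rcases h with rfl | rfl | rfl | rfl
      · have : φ (ψ (brk (xx k 1) (xx k 2))) = brk (φ (ψ (xx k 1))) (φ (ψ (xx k 2))) := by
          simp [brk]
        rw [this]
        exact commute_of_even (brk_mem_extDeg (hx 1) (hx 2)) ha'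
      · have : φ (ψ (brk (xx k 1) (xx k 2) * brk (xx k 3) (xx k 4))) =
            brk (φ (ψ (xx k 1))) (φ (ψ (xx k 2))) * brk (φ (ψ (xx k 3))) (φ (ψ (xx k 4))) := by
          simp [brk]
        rw [this, mul_assoc, commute_of_even (brk_mem_extDeg (hx 3) (hx 4)) ha', ← mul_assoc,
          commute_of_even (brk_mem_extDeg (hx 1) (hx 2)) ha', mul_assoc]
      · rw [(mul_eq_zero_of_mem_extDeg hcirc ha').1, (mul_eq_zero_of_mem_extDeg hcirc ha').2]
      · rw [map_mul, map_mul, (mul_eq_zero_of_mem_extDeg hcirc (hx _)).1, zero_mul, mul_zero]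
    exact hspan hf

end Central

/-- Let `k` be a field of characteristic `0`, `m ≥ 2`,
`b_m = ⌊m/2⌋ + 1`.  Then `CP(G_0(m))` equals the nonunitary T-space generated by
`[x_1,x_2]`, `[x_1,x_2][x_3,x_4]`, `x_1 ∘ ⋯ ∘ x_{b_m}` and
`(x_1 ∘ ⋯ ∘ x_{b_m}) x_{b_m+1}`. -/
theorem stmt16 (k : Type*) [Field k] [CharZero k] (m : ℕ) (hm : 2 ≤ m) :
    CP0 k m =
      ↑(Submodule.span k {y : FreeAlgebra k ℕ |
          ∃ ψ : FreeAlgebra k ℕ →ₐ[k] FreeAlgebra k ℕ, (∀ i, ψ (xx k i) ∈ F0 k) ∧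
            (y = ψ (brk (xx k 1) (xx k 2)) ∨
              y = ψ (brk (xx k 1) (xx k 2) * brk (xx k 3) (xx k 4)) ∨
              y = ψ (circFold (xx k) (m / 2 + 1)) ∨
              y = ψ (circFold (xx k) (m / 2 + 1) * xx k (m / 2 + 1 + 1)))}) := by
  exact Set.Subset.antisymm CP0_subset_tSpace tSpace_subset_CP0

end
end
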